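/- Let Ξ ⊆ Ω be a prediction set satisfying Assumption A. Define ℋ^gen := { H + GS : H, G ∈ ℋ } (the generalized simple processes, where (GS)_t(ω) := G_t(ω)S_t(ω)), with pathwise integral ((H+GS)·S)_t := (H·S)_t + (G·𝕊)_t. Define Φ^gen(ξ) := inf{ λ ∈ ℝ : there is a sequence (H^n) in ℋ^gen such that λ + (H^n·S)_t ≥ 0 on Ξ for all n and all t ∈ [0,T], and λ + liminf_{n→∞} (H^n·S)_T ≥ ξ on Ξ }. Then for every function ξ : C[0,T] → [0,∞] of the form ξ(ω) = liminf_{n→∞} ξ̄_n(ω, ⟨ω⟩), where each ξ̄_n : C[0,T]×C[0,T] → [0,∞) is bounded and upper semicontinuous, one has Φ^gen(ξ) = sup_{Q ∈ M(Ξ)} E_Q[ξ]. -/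

import Mathlib

open MeasureTheory Filter Set Topology
open scoped ENNReal Classical

noncomputable section

namespace PathwiseSuperhedging

/-- The path space `C[0,T]`: continuous functions on `[0,T]` with the sup-norm. -/
abbrev Path (T : ℝ) := C(Set.Icc (0:ℝ) T, ℝ)

variable (T : ℝ)

instance : MeasurableSpace (Path T) := borel _
instance : BorelSpace (Path T) := ⟨rfl⟩

variable (hT : 0 ≤ T)

/-- time `0` as an element of `[0,T]`. -/
def t0 : Set.Icc (0:ℝ) T := ⟨0, le_refl 0, hT⟩

/-- clamp a real time into `[0,T]`. -/
def clamp (t : ℝ) : Set.Icc (0:ℝ) T := Set.projIcc 0 T hT t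

/-- evaluation of a path at a (clamped) real time. -/
def ev (ω : Path T) (t : ℝ) : ℝ := ω (clamp T hT t)

/-- The stopping times `σ^m_k`:  `σ^m_0 = 0` and
`σ^m_{k+1} = inf { t ≥ σ^m_k : |S_t - S_{σ^m_k}| ≥ 2^{-m} }` (equal to `T+1` if no such
time `t ≤ T` exists). -/
def sig (m : ℕ) : ℕ → Path T → ℝ
  | 0 => fun _ => 0
  | k + 1 => fun ω =>
      sInf ({t : ℝ | sig m k ω ≤ t ∧ t ≤ T ∧
        (2:ℝ) ^ (-(m:ℤ)) ≤ |ev T hT ω t - ev T hT ω (sig m k ω)|} ∪ {T + 1})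

/-- The discretized integral `𝕊^m_t = ∑_k S_{σ^m_k} (S_{σ^m_{k+1} ∧ t} - S_{σ^m_k ∧ t})`. -/
def Sm (m : ℕ) (t : ℝ) (ω : Path T) : ℝ :=
  ∑' k : ℕ, ev T hT ω (sig T hT m k ω) *
    (ev T hT ω (min (sig T hT m (k + 1) ω) t) - ev T hT ω (min (sig T hT m k ω) t))

/-- The pathwise integral `𝕊_t = liminf_m 𝕊^m_t`. -/
def SS (t : ℝ) (ω : Path T) : ℝ := Filter.liminf (fun m => Sm T hT m t ω) Filter.atTop

/-- The candidate quadratic variation `S_t² - S_0² - 2 𝕊_t`. -/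
def qvRaw (ω : Path T) (t : ℝ) : ℝ := (ev T hT ω t) ^ 2 - (ev T hT ω 0) ^ 2 - 2 * SS T hT t ω

/-- The set `Ω` of paths for which `𝕊^m → 𝕊` uniformly and
`t ↦ S_t² - S_0² - 2𝕊_t` is nondecreasing. -/
def BigOmega : Set (Path T) :=
  {ω | TendstoUniformly (fun m (t : Set.Icc (0:ℝ) T) => Sm T hT m (t : ℝ) ω)
        (fun t => SS T hT (t : ℝ) ω) Filter.atTop ∧
      MonotoneOn (qvRaw T hT ω) (Set.Icc (0:ℝ) T)}

/-- The pathwise quadratic variation `⟨ω⟩`, as an element of `C[0,T]`; it equals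
`S² - S_0² - 2𝕊` for `ω ∈ Ω` (this function being continuous there) and `0` otherwise. -/
def qv (ω : Path T) : Path T :=
  if h : ω ∈ BigOmega T hT ∧ Continuous fun t : Set.Icc (0:ℝ) T => qvRaw T hT ω (t : ℝ)
  then ⟨fun t => qvRaw T hT ω (t : ℝ), h.2⟩ else 0

/-- The raw filtration `F_t = σ(S_s : s ≤ t)` generated by the canonical process. -/
def Fraw (t : ℝ) : MeasurableSpace (Path T) :=
  ⨆ (s : Set.Icc (0:ℝ) T) (_ : (s : ℝ) ≤ t),
    MeasurableSpace.comap (fun ω : Path T => ω s) inferInstance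

/-- The right-continuous filtration `F_{t+} = ⋂_{s > t} F_{s ∧ T}`. -/
def Fplus (t : ℝ) : MeasurableSpace (Path T) :=
  ⨅ (s : ℝ) (_ : t < s), Fraw T (min s T)

/-- `τ` is a stopping time for the raw filtration `𝔽`. -/
def IsStopRaw (τ : Path T → ℝ) : Prop :=
  ∀ t ∈ Set.Icc (0:ℝ) T, MeasurableSet[Fraw T t] {ω | τ ω ≤ t}

/-- `τ` is a stopping time for the right-continuous filtration `𝔽₊`. -/
def IsStopPlus (τ : Path T → ℝ) : Prop :=
  ∀ t ∈ Set.Icc (0:ℝ) T, MeasurableSet[Fplus T t] {ω | τ ω ≤ t}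

/-- `f` is measurable with respect to the σ-field `F_{τ+}`. -/
def MeasAtStopPlus (τ f : Path T → ℝ) : Prop :=
  ∀ B : Set ℝ, MeasurableSet B → ∀ t ∈ Set.Icc (0:ℝ) T,
    MeasurableSet[Fplus T t] (f ⁻¹' B ∩ {ω | τ ω ≤ t})

/-- The set `ℋ` of simple trading strategies `H = ∑_{l=1}^L h_l 1_{(τ_l, τ_{l+1}]}`
with `𝔽₊`-stopping times `0 ≤ τ_1 ≤ ⋯ ≤ τ_{L+1} ≤ T` and bounded `F_{τ_l+}`-measurable
coefficients `h_l`. -/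
structure SimpleStrategy where
  L : ℕ
  τ : Fin (L + 1) → Path T → ℝ
  coeff : Fin L → Path T → ℝ
  τ_nonneg : ∀ ω, 0 ≤ τ 0 ω
  τ_mono : ∀ (l : Fin L) (ω), τ l.castSucc ω ≤ τ l.succ ω
  τ_le : ∀ ω, τ (Fin.last L) ω ≤ T
  τ_stop : ∀ l, IsStopPlus T (τ l)
  coeff_bdd : ∀ l, ∃ C : ℝ, ∀ ω, |coeff l ω| ≤ C
  coeff_meas : ∀ l : Fin L, MeasAtStopPlus T (τ l.castSucc) (coeff l)

/-- The pathwise stochastic integral `(H · X)_t(ω)` of a simple strategy against a process. -/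
def integ (H : SimpleStrategy T) (X : ℝ → Path T → ℝ) (t : ℝ) (ω : Path T) : ℝ :=
  ∑ l : Fin H.L, H.coeff l ω *
    (X (min (H.τ l.succ ω) t) ω - X (min (H.τ l.castSucc ω) t) ω)

/-- The canonical process `S_t(ω) = ω(t)`. -/
def Sproc (t : ℝ) (ω : Path T) : ℝ := ev T hT ω t

/-- `X` is a `Q`-`𝔽`-martingale (on the time interval `[0,T]`). -/
def IsMart (Q : Measure (Path T)) (X : ℝ → Path T → ℝ) : Prop :=
  (∀ t ∈ Set.Icc (0:ℝ) T, Integrable (X t) Q) ∧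
  ∀ s t : ℝ, s ∈ Set.Icc (0:ℝ) T → t ∈ Set.Icc (0:ℝ) T → s ≤ t →
    ∀ A : Set (Path T), MeasurableSet[Fraw T s] A →
      ∫ ω in A, X t ω ∂Q = ∫ ω in A, X s ω ∂Q

/-- `X` is a `Q`-`𝔽`-local martingale: there are `𝔽`-stopping times increasing `Q`-a.s.
to `∞` such that each stopped process is a `Q`-`𝔽`-martingale. -/
def IsLocalMart (Q : Measure (Path T)) (X : ℝ → Path T → ℝ) : Prop :=
  ∃ τ : ℕ → Path T → ℝ,
    (∀ m, IsStopRaw T (τ m)) ∧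
    (∀ᵐ ω ∂Q, Monotone (fun m => τ m ω) ∧ Tendsto (fun m => τ m ω) atTop atTop) ∧
    (∀ m, IsMart T Q (fun t ω => X (min (τ m ω) t) ω))

/-- The set `M(Ξ)` of local martingale measures concentrated on `Ξ`. -/
def MSet (Ξ : Set (Path T)) : Set (Measure (Path T)) :=
  {Q | IsProbabilityMeasure Q ∧ IsLocalMart T Q (Sproc T hT) ∧ Q Ξ = 1}

/-- The set `M_Z(Ξ)` of local martingale measures concentrated on `Ξ` with `E_Q[Z] < ∞`. -/
def MZSet (Ξ : Set (Path T)) (Z : Path T → ℝ≥0∞) : Set (Measure (Path T)) :=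
  {Q | IsProbabilityMeasure Q ∧ IsLocalMart T Q (Sproc T hT) ∧ Q Ξ = 1 ∧
       ∫⁻ ω, Z ω ∂Q ≠ ⊤}

/-- The stopped path `ω^t(s) = ω(t ∧ s)`. -/
def stopPath (ω : Path T) (t : Set.Icc (0:ℝ) T) : Path T :=
  ⟨fun s => ω ⟨min t.1 s.1, le_min t.2.1 s.2.1, (min_le_left _ _).trans t.2.2⟩,
    ω.continuous.comp ((continuous_const.min continuous_subtype_val).subtype_mk _)⟩

/-- Assumption A on the prediction set `Ξ` and its lift `Ξ̄`. -/
structure AssumptionA (Ξ : Set (Path T)) (Xibar : Set (Path T × Path T)) : Prop where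
  xi_nonempty : Ξ.Nonempty
  xibar_nonempty : Xibar.Nonempty
  xi_eq : Ξ = {ω ∈ BigOmega T hT | (ω, qv T hT ω) ∈ Xibar}
  A1 : ∃ K : ℕ → Set (Path T × Path T), (∀ n, IsCompact (K n)) ∧ Xibar = ⋃ n, K n
  A2 : ∀ p ∈ Xibar, p.2 (t0 T hT) = 0 ∧ Monotone p.2
  A3 : ∀ p ∈ Xibar, ∀ t : Set.Icc (0:ℝ) T, (stopPath T p.1 t, stopPath T p.2 t) ∈ Xibar

/-! ### The enlarged space -/

/-- The enlarged space `Ω̄ = C[0,T] × C[0,T]`. -/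
abbrev PathPair (T : ℝ) := Path T × Path T

/-- The embedding `ψ(ω) = (ω, ⟨ω⟩)`. -/
def psiMap (ω : Path T) : PathPair T := (ω, qv T hT ω)

/-- The diagonal set `Δ̄ = ψ(Ω)`. -/
def Delta : Set (PathPair T) := psiMap T hT '' BigOmega T hT

/-- The first canonical process `S̄_t(ω,ν) = ω(t)` on the enlarged space. -/
def SbarProc (t : ℝ) (p : PathPair T) : ℝ := ev T hT p.1 t

/-- The second canonical process `V̄_t(ω,ν) = ν(t)` on the enlarged space. -/
def VbarProc (t : ℝ) (p : PathPair T) : ℝ := ev T hT p.2 t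

/-- The process `𝕊̄ = (S̄² - S̄_0² - V̄)/2` on the enlarged space. -/
def SSbarProc (t : ℝ) (p : PathPair T) : ℝ :=
  ((ev T hT p.1 t) ^ 2 - (ev T hT p.1 0) ^ 2 - ev T hT p.2 t) / 2

/-- The raw filtration `F̄_t = σ(S̄_s, V̄_s : s ≤ t)` on the enlarged space. -/
def FbarRaw (t : ℝ) : MeasurableSpace (PathPair T) :=
  ⨆ (s : Set.Icc (0:ℝ) T) (_ : (s : ℝ) ≤ t),
    MeasurableSpace.comap (fun p : PathPair T => (p.1 s, p.2 s)) inferInstance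

/-- The right-continuous filtration `F̄_{t+} = ⋂_{s>t} F̄_{s ∧ T}` on the enlarged space. -/
def FbarPlus (t : ℝ) : MeasurableSpace (PathPair T) :=
  ⨅ (s : ℝ) (_ : t < s), FbarRaw T (min s T)

/-- The σ-field generated by all subsets of `Δ̄ᶜ`. -/
def nullDelta : MeasurableSpace (PathPair T) :=
  MeasurableSpace.generateFrom {N : Set (PathPair T) | N ⊆ (Delta T hT)ᶜ}

/-- The `Δ̄`-augmented raw filtration `F̄^Δ_t`. -/
def FbarDelta (t : ℝ) : MeasurableSpace (PathPair T) := FbarRaw T t ⊔ nullDelta T hT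

/-- The `Δ̄`-augmented right-continuous filtration `F̄^Δ_{t+}`. -/
def FbarDeltaPlus (t : ℝ) : MeasurableSpace (PathPair T) := FbarPlus T t ⊔ nullDelta T hT

/-- `τ` is a stopping time for the raw filtration `𝔽̄` on the enlarged space. -/
def IsStopBarRaw (τ : PathPair T → ℝ) : Prop :=
  ∀ t ∈ Set.Icc (0:ℝ) T, MeasurableSet[FbarRaw T t] {p | τ p ≤ t}

/-- `τ` is a stopping time for the filtration `𝔽̄₊^Δ`. -/
def IsStopBarDeltaPlus (τ : PathPair T → ℝ) : Prop :=
  ∀ t ∈ Set.Icc (0:ℝ) T, MeasurableSet[FbarDeltaPlus T hT t] {p | τ p ≤ t}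

/-- `f` is measurable with respect to `F̄^Δ_{τ+}`. -/
def MeasAtStopBarDeltaPlus (τ f : PathPair T → ℝ) : Prop :=
  ∀ B : Set ℝ, MeasurableSet B → ∀ t ∈ Set.Icc (0:ℝ) T,
    MeasurableSet[FbarDeltaPlus T hT t] (f ⁻¹' B ∩ {p | τ p ≤ t})

/-- The set `ℋ̄` of simple strategies on the enlarged space. -/
structure SimpleStrategyBar where
  L : ℕ
  τ : Fin (L + 1) → PathPair T → ℝ
  coeff : Fin L → PathPair T → ℝ
  τ_nonneg : ∀ p, 0 ≤ τ 0 p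
  τ_mono : ∀ (l : Fin L) (p), τ l.castSucc p ≤ τ l.succ p
  τ_le : ∀ p, τ (Fin.last L) p ≤ T
  τ_stop : ∀ l, IsStopBarDeltaPlus T hT (τ l)
  coeff_bdd : ∀ l, ∃ C : ℝ, ∀ p, |coeff l p| ≤ C
  coeff_meas : ∀ l : Fin L, MeasAtStopBarDeltaPlus T hT (τ l.castSucc) (coeff l)

/-- The pathwise stochastic integral on the enlarged space. -/
def integBar (H : SimpleStrategyBar T hT) (X : ℝ → PathPair T → ℝ) (t : ℝ)
    (p : PathPair T) : ℝ :=
  ∑ l : Fin H.L, H.coeff l p *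
    (X (min (H.τ l.succ p) t) p - X (min (H.τ l.castSucc p) t) p)

/-- `X` is a `Q̄`-`𝔽̄`-martingale on the enlarged space. -/
def IsMartBar (Q : Measure (PathPair T)) (X : ℝ → PathPair T → ℝ) : Prop :=
  (∀ t ∈ Set.Icc (0:ℝ) T, Integrable (X t) Q) ∧
  ∀ s t : ℝ, s ∈ Set.Icc (0:ℝ) T → t ∈ Set.Icc (0:ℝ) T → s ≤ t →
    ∀ A : Set (PathPair T), MeasurableSet[FbarRaw T s] A →
      ∫ p in A, X t p ∂Q = ∫ p in A, X s p ∂Q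

/-- `X` is a `Q̄`-`𝔽̄`-local martingale on the enlarged space. -/
def IsLocalMartBar (Q : Measure (PathPair T)) (X : ℝ → PathPair T → ℝ) : Prop :=
  ∃ τ : ℕ → PathPair T → ℝ,
    (∀ m, IsStopBarRaw T (τ m)) ∧
    (∀ᵐ p ∂Q, Monotone (fun m => τ m p) ∧ Tendsto (fun m => τ m p) atTop atTop) ∧
    (∀ m, IsMartBar T Q (fun t p => X (min (τ m p) t) p))

/-- The set `M̄(Ξ̄)` of measures on the enlarged space under which `S̄` and `𝕊̄` are local
martingales and which are concentrated on `Ξ̄`. -/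
def MbarSet (Xibar : Set (PathPair T)) : Set (Measure (PathPair T)) :=
  {Q | IsProbabilityMeasure Q ∧ IsLocalMartBar T Q (SbarProc T hT) ∧
       IsLocalMartBar T Q (SSbarProc T hT) ∧ Q Xibar = 1}

/-- The set `M̄_{Z̄}(Ξ̄)`. -/
def MbarZSet (Xibar : Set (PathPair T)) (Zbar : PathPair T → ℝ≥0∞) :
    Set (Measure (PathPair T)) :=
  {Q | IsProbabilityMeasure Q ∧ IsLocalMartBar T Q (SbarProc T hT) ∧
       IsLocalMartBar T Q (SSbarProc T hT) ∧ Q Xibar = 1 ∧ ∫⁻ p, Zbar p ∂Q ≠ ⊤}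

/-! ### Expectations and superhedging functionals -/

/-- The positive part of an extended real number, as an element of `[0,∞]`. -/
def erealPos (x : EReal) : ℝ≥0∞ := if x = ⊤ then ⊤ else ENNReal.ofReal x.toReal

/-- The expectation `E_Q[ξ]` of an extended-real-valued random variable, as an
extended real number (positive part minus negative part). -/
def expEReal {α : Type*} [MeasurableSpace α] (Q : Measure α) (ξ : α → EReal) : EReal :=
  ((∫⁻ x, erealPos (ξ x) ∂Q : ℝ≥0∞) : EReal) - ((∫⁻ x, erealPos (-ξ x) ∂Q : ℝ≥0∞) : EReal)

/-- The set of initial capitals `λ` that allow superhedging `ξ` on `Ξ`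
(trading in `S` and `𝕊` with simple strategies, in the liminf sense). -/
def PhiSet (Ξ : Set (Path T)) (ξ : Path T → EReal) : Set ℝ :=
  {lam : ℝ | ∃ H G : ℕ → SimpleStrategy T,
    (∀ n : ℕ, ∀ t ∈ Set.Icc (0:ℝ) T, ∀ ω ∈ Ξ,
      0 ≤ lam + integ T (H n) (Sproc T hT) t ω + integ T (G n) (SS T hT) t ω) ∧
    (∀ ω ∈ Ξ, ξ ω ≤ (lam : EReal) +
      Filter.liminf (fun n =>
        ((integ T (H n) (Sproc T hT) T ω + integ T (G n) (SS T hT) T ω : ℝ) : EReal))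
        Filter.atTop)}

/-- The superhedging price `Φ(ξ)`. -/
def Phi (Ξ : Set (Path T)) (ξ : Path T → EReal) : EReal :=
  sInf ((fun lam : ℝ => (lam : EReal)) '' PhiSet T hT Ξ ξ)

/-- The supremum of the pricing functionals `E_Q[ξ]` over `Q ∈ M(Ξ)`,
for a nonnegative claim `ξ`. -/
def supMart (Ξ : Set (Path T)) (ξ : Path T → ℝ≥0∞) : ℝ≥0∞ :=
  ⨆ Q ∈ MSet T hT Ξ, ∫⁻ ω, ξ ω ∂Q

/-- The liminf-closure `𝒢^Ξ_λ`: the smallest set of functions `C[0,T] → [-∞,∞]`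
containing `λ + (H·S)_T` for admissible simple `H` and closed under countable liminf. -/
inductive GG (Ξ : Set (Path T)) (lam : ℝ) : (Path T → EReal) → Prop
  | base (H : SimpleStrategy T)
      (hadm : ∀ t ∈ Set.Icc (0:ℝ) T, ∀ ω ∈ Ξ, 0 ≤ lam + integ T H (Sproc T hT) t ω) :
      GG Ξ lam (fun ω => ((lam + integ T H (Sproc T hT) T ω : ℝ) : EReal))
  | lim (X : ℕ → Path T → EReal) (h : ∀ n, GG Ξ lam (X n)) :
      GG Ξ lam (fun ω => Filter.liminf (fun n => X n ω) Filter.atTop)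

/-- The superhedging price `Φ^cl(ξ)` defined via the liminf-closure. -/
def PhiCl (Ξ : Set (Path T)) (ξ : Path T → EReal) : EReal :=
  sInf {x : EReal | ∃ lam : ℝ, x = (lam : EReal) ∧
    ∃ Y : Path T → EReal, GG T hT Ξ lam Y ∧ ∀ ω ∈ Ξ, ξ ω ≤ Y ω}


/-- The set of initial capitals allowing superhedging on the enlarged space
(superhedging on `Δ̄ ∩ Ξ̄`). -/
def PhiBarSet (Xibar : Set (PathPair T)) (ξ : PathPair T → EReal) : Set ℝ :=
  {lam : ℝ | ∃ H G : ℕ → SimpleStrategyBar T hT,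
    (∀ n : ℕ, ∀ t ∈ Set.Icc (0:ℝ) T, ∀ p ∈ Delta T hT ∩ Xibar,
      0 ≤ lam + integBar T hT (H n) (SbarProc T hT) t p
            + integBar T hT (G n) (SSbarProc T hT) t p) ∧
    (∀ p ∈ Delta T hT ∩ Xibar, ξ p ≤ (lam : EReal) +
      Filter.liminf (fun n =>
        ((integBar T hT (H n) (SbarProc T hT) T p
          + integBar T hT (G n) (SSbarProc T hT) T p : ℝ) : EReal)) Filter.atTop)}

/-- The superhedging price `Φ̄(ξ̄)` on the enlarged space. -/
def PhiBar (Xibar : Set (PathPair T)) (ξ : PathPair T → EReal) : EReal :=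
  sInf ((fun lam : ℝ => (lam : EReal)) '' PhiBarSet T hT Xibar ξ)

/-- The supremum of pricing functionals over `M̄(Ξ̄)` for a nonnegative claim. -/
def supMartBar (Xibar : Set (PathPair T)) (ξ : PathPair T → ℝ≥0∞) : ℝ≥0∞ :=
  ⨆ Q ∈ MbarSet T hT Xibar, ∫⁻ p, ξ p ∂Q

/-- Assumption B on the prediction set `Ξ`, determined by a growth function `Z̄`
(with values in `[1,∞]`). -/
structure AssumptionB (Ξ : Set (Path T)) (Zbar : PathPair T → ℝ≥0∞) : Prop where
  xi_nonempty : Ξ.Nonempty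
  one_le : ∀ p, 1 ≤ Zbar p
  xi_eq : Ξ = {ω ∈ BigOmega T hT | Zbar (ω, qv T hT ω) ≠ ⊤}
  B1 : ∀ c : ℝ≥0∞, c ≠ ⊤ → IsCompact {p : PathPair T | Zbar p ≤ c}
  B2 : ∀ p : PathPair T, Zbar p ≠ ⊤ → p.2 (t0 T hT) = 0 ∧ Monotone p.2
  B3 : ∀ p : PathPair T, ENNReal.ofReal (‖p.1‖ + ‖p.2‖) ≤ Zbar p

/-- The set of initial capitals allowing `Z`-admissible superhedging of `ξ` on `Ξ`. -/
def PhiZSet (Ξ : Set (Path T)) (Z : Path T → ℝ≥0∞) (ξ : Path T → EReal) : Set ℝ :=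
  {lam : ℝ | ∃ c : ℝ, 0 ≤ c ∧ ∃ H G : ℕ → SimpleStrategy T,
    (∀ n : ℕ, ∀ ω ∈ Ξ,
      -(c * (Z ω).toReal) ≤
        lam + integ T (H n) (Sproc T hT) T ω + integ T (G n) (SS T hT) T ω) ∧
    (∀ ω ∈ Ξ, ξ ω ≤ (lam : EReal) +
      Filter.liminf (fun n =>
        ((integ T (H n) (Sproc T hT) T ω + integ T (G n) (SS T hT) T ω : ℝ) : EReal))
        Filter.atTop)}

/-- The superhedging price `Φ^Z(ξ)`. -/
def PhiZ (Ξ : Set (Path T)) (Z : Path T → ℝ≥0∞) (ξ : Path T → EReal) : EReal :=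
  sInf ((fun lam : ℝ => (lam : EReal)) '' PhiZSet T hT Ξ Z ξ)

/-- The `α`-Hölder norm `‖ω‖_α = |ω(0)| + sup_{s ≠ t} |ω(t) - ω(s)| / |t-s|^α`,
with values in `[0,∞]`. -/
def holderNormE (α : ℝ) (ω : Path T) : ℝ≥0∞ :=
  ENNReal.ofReal |ω (t0 T hT)| +
    ⨆ (s : Set.Icc (0:ℝ) T) (t : Set.Icc (0:ℝ) T) (_ : s ≠ t),
      ENNReal.ofReal (|ω t - ω s| / |t.1 - s.1| ^ α)

/-- The set of Hölder continuous paths `⋃_n { ω : ‖ω‖_{1/n} ≤ n }`. -/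
def CHolder : Set (Path T) :=
  ⋃ n : ℕ, {ω : Path T | 0 < n ∧ holderNormE T hT (1 / n) ω ≤ (n : ℝ≥0∞)}

end PathwiseSuperhedging

namespace PathwiseSuperhedging

/-- A generalized simple strategy `H + G S ∈ ℋ^gen` is encoded by the pair `(H, G)` of
simple strategies; its pathwise integral against `S` is `((H + GS)·S) = (H·S) + (G·𝕊)`. -/
def genInteg (T : ℝ) (hT : 0 ≤ T) (HG : SimpleStrategy T × SimpleStrategy T)
    (t : ℝ) (ω : Path T) : ℝ :=
  integ T HG.1 (Sproc T hT) t ω + integ T HG.2 (SS T hT) t ω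

/-- The set of initial capitals allowing superhedging of `ξ` on `Ξ` using generalized
simple strategies in `ℋ^gen`. -/
def PhiGenSet (T : ℝ) (hT : 0 ≤ T) (Ξ : Set (Path T)) (ξ : Path T → EReal) : Set ℝ :=
  {lam : ℝ | ∃ H : ℕ → SimpleStrategy T × SimpleStrategy T,
    (∀ n : ℕ, ∀ t ∈ Set.Icc (0:ℝ) T, ∀ ω ∈ Ξ, 0 ≤ lam + genInteg T hT (H n) t ω) ∧
    (∀ ω ∈ Ξ, ξ ω ≤ (lam : EReal) +
      Filter.liminf (fun n => ((genInteg T hT (H n) T ω : ℝ) : EReal)) Filter.atTop)}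

/-- The superhedging price `Φ^gen(ξ)` using generalized simple strategies. -/
def PhiGen (T : ℝ) (hT : 0 ≤ T) (Ξ : Set (Path T)) (ξ : Path T → EReal) : EReal :=
  sInf ((fun lam : ℝ => (lam : EReal)) '' PhiGenSet T hT Ξ ξ)

section Part1

section PathLevel
variable {T : ℝ} {hT : 0 ≤ T}

lemma continuous_clamp : Continuous (clamp T hT) := continuous_projIcc (h := hT)

lemma ev_joint : Continuous (fun x : Path T × ℝ => ev T hT x.1 x.2) := by
  unfold ev
  exact (continuous_eval (F := Path T)).comp
    (continuous_fst.prodMk ((continuous_clamp (hT := hT)).comp continuous_snd))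

lemma ev_cont (ω : Path T) : Continuous (ev T hT ω) :=
  ω.continuous.comp continuous_clamp

lemma ev_cont' (t : ℝ) : Continuous (fun ω : Path T => ev T hT ω t) :=
  ev_joint.comp (continuous_id.prodMk continuous_const)

lemma meas_ev {α : Type*} [MeasurableSpace α] {f : α → Path T} {t : α → ℝ}
    (hf : Measurable f) (ht : Measurable t) : Measurable (fun a => ev T hT (f a) (t a)) :=
  (ev_joint (hT := hT)).measurable.comp (hf.prodMk ht)

lemma ev_unif (ω : Path T) : UniformContinuous (ev T hT ω) := by
  have h1 : UniformContinuous ω := CompactSpace.uniformContinuous_of_continuous ω.continuous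
  have h2 : UniformContinuous (clamp T hT) := (LipschitzWith.projIcc hT).uniformContinuous
  exact h1.comp h2

lemma ev_coe (ω : Path T) (t : Set.Icc (0:ℝ) T) : ev T hT ω t = ω t := by
  simp [ev, clamp]

lemma ev_abs_le (ω : Path T) (t : ℝ) : |ev T hT ω t| ≤ ‖ω‖ := ω.norm_coe_le_norm _

lemma ev_stop (ω : Path T) (t : Set.Icc (0:ℝ) T) (s : ℝ) :
    ev T hT (stopPath T ω t) s = ev T hT ω (min t.1 s) := by
  have h := t.2
  unfold ev stopPath clamp
  simp only [ContinuousMap.coe_mk]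
  congr 1
  ext
  simp only [Set.coe_projIcc]
  rcases le_total t.1 s with h1 | h1 <;> rcases le_total 0 s with h2 | h2 <;>
  rcases le_total s T with h3 | h3 <;> simp [*] <;> grind

lemma sig_nonneg (m k : ℕ) (ω : Path T) : 0 ≤ sig T hT m k ω := by
  induction k with
  | zero => simp [sig]
  | succ k ih =>
    simp only [sig]
    apply Real.sInf_nonneg
    rintro x (hx | hx)
    · exact ih.trans hx.1
    · simp at hx; linarith

lemma sig_le (m k : ℕ) (ω : Path T) : sig T hT m k ω ≤ T + 1 := by
  cases k with
  | zero => simp [sig]; linarith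
  | succ k =>
    simp only [sig]
    refine csInf_le ⟨0, ?_⟩ (Or.inr rfl)
    rintro x (hx | hx)
    · exact (sig_nonneg m k ω).trans hx.1
    · simp at hx; linarith

lemma sig_mono_succ (m k : ℕ) (ω : Path T) : sig T hT m k ω ≤ sig T hT m (k+1) ω := by
  conv_rhs => simp only [sig]
  apply le_csInf ⟨T+1, Or.inr rfl⟩
  rintro x (hx | hx)
  · exact hx.1
  · rw [hx]; exact sig_le m k ω

lemma sig_mono (m : ℕ) (ω : Path T) : Monotone (fun k => sig T hT m k ω) :=
  monotone_nat_of_le_succ fun k => sig_mono_succ m k ω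

lemma sig_succ_le_iff (m k : ℕ) (ω : Path T) {x : ℝ} (hx : x ≤ T) :
    sig T hT m (k+1) ω ≤ x ↔ ∃ u, sig T hT m k ω ≤ u ∧ u ≤ x ∧
      (2:ℝ) ^ (-(m:ℤ)) ≤ |ev T hT ω u - ev T hT ω (sig T hT m k ω)| := by
  set A : Set ℝ := {t : ℝ | sig T hT m k ω ≤ t ∧ t ≤ T ∧
        (2:ℝ) ^ (-(m:ℤ)) ≤ |ev T hT ω t - ev T hT ω (sig T hT m k ω)|} with hA
  have hs : sig T hT m (k+1) ω = sInf (A ∪ {T+1}) := by rw [sig]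
  have hb : BddBelow (A ∪ {T+1}) := by
    refine ⟨0, ?_⟩
    rintro x (hx | hx)
    · exact (sig_nonneg m k ω).trans hx.1
    · simp at hx; linarith
  have hc : IsClosed (A ∪ {T+1}) := by
    apply IsClosed.union _ isClosed_singleton
    apply IsClosed.inter isClosed_Ici
    apply IsClosed.inter isClosed_Iic
    exact isClosed_le continuous_const (((ev_cont ω).sub continuous_const).abs)
  constructor
  · intro h
    have := hc.csInf_mem ⟨T+1, Or.inr rfl⟩ hb
    rw [← hs] at this
    rcases this with h' | h'
    · exact ⟨_, h'.1, h, h'.2.2⟩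
    · simp at h'; linarith
  · rintro ⟨u, h1, h2, h3⟩
    rw [hs]
    exact (csInf_le hb (Or.inl ⟨h1, h2.trans hx, h3⟩)).trans h2

lemma sig_eventually (m : ℕ) (ω : Path T) : ∃ K, ∀ k, K ≤ k → T < sig T hT m k ω := by
  by_contra hcon
  push Not at hcon
  have hle : ∀ k, sig T hT m k ω ≤ T := by
    intro k
    obtain ⟨k', h1, h2⟩ := hcon k
    exact (sig_mono m ω h1).trans h2
  have hconv := tendsto_atTop_ciSup (sig_mono (hT := hT) m ω) ⟨T, by rintro _ ⟨k, rfl⟩; exact hle k⟩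
  have h1 := ((ev_cont (hT := hT) ω).tendsto _).comp hconv
  have h2 := h1.comp (tendsto_add_atTop_nat 1)
  have h3 := (h2.sub h1).abs
  simp only [sub_self, abs_zero] at h3
  have hpos : (0:ℝ) < (2:ℝ) ^ (-(m:ℤ)) := by positivity
  obtain ⟨k, hk⟩ := (h3.eventually (gt_mem_nhds hpos)).exists
  obtain ⟨u, hu1, hu2, hu3⟩ := (sig_succ_le_iff m k ω (hle (k+1))).1 le_rfl
  have : u = sig T hT m (k+1) ω :=
    le_antisymm hu2 ((sig_succ_le_iff m k ω (hu2.trans (hle (k+1)))).2 ⟨u, hu1, le_rfl, hu3⟩)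
  rw [this] at hu3
  simp only [Function.comp_apply] at hk
  linarith

lemma Sm_eq {m K : ℕ} {ω : Path T} (hK : ∀ k, K ≤ k → T < sig T hT m k ω) {t : ℝ} (ht : t ≤ T) :
    Sm T hT m t ω = ∑ k ∈ Finset.range K, ev T hT ω (sig T hT m k ω) *
    (ev T hT ω (min (sig T hT m (k + 1) ω) t) - ev T hT ω (min (sig T hT m k ω) t)) := by
  unfold Sm
  apply tsum_eq_sum
  intro k hk
  simp only [Finset.mem_range, not_lt] at hk
  rw [min_eq_right (ht.trans (hK k hk).le), min_eq_right (ht.trans (hK (k+1) (by omega)).le)]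
  simp

lemma Sm_cont (m : ℕ) (ω : Path T) : ContinuousOn (fun t => Sm T hT m t ω) (Set.Iic T) := by
  obtain ⟨K, hK⟩ := sig_eventually (hT := hT) m ω
  have : ContinuousOn (fun t => ∑ k ∈ Finset.range K, ev T hT ω (sig T hT m k ω) *
    (ev T hT ω (min (sig T hT m (k + 1) ω) t) - ev T hT ω (min (sig T hT m k ω) t)))
      (Set.Iic T) := by
    apply Continuous.continuousOn
    have := ev_cont (hT := hT) ω
    fun_prop
  exact this.congr fun t ht => Sm_eq hK ht

/-- the piecewise constant integrand -/
def phi (T : ℝ) (hT : 0 ≤ T) (m : ℕ) (u : ℝ) (ω : Path T) : ℝ :=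
  ∑' k : ℕ, ev T hT ω (sig T hT m k ω) *
    ((if u < sig T hT m (k+1) ω then 1 else 0) - (if u < sig T hT m k ω then 1 else 0))

lemma phi_eq {m K : ℕ} {ω : Path T} (hK : ∀ k, K ≤ k → T < sig T hT m k ω) {u : ℝ} (hu : u ≤ T) :
    phi T hT m u ω = ∑ k ∈ Finset.range K, ev T hT ω (sig T hT m k ω) *
    ((if u < sig T hT m (k+1) ω then 1 else 0) - (if u < sig T hT m k ω then 1 else 0)) := by
  unfold phi
  apply tsum_eq_sum
  intro k hk
  simp only [Finset.mem_range, not_lt] at hk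
  rw [if_pos (hu.trans_lt (hK k hk)), if_pos (hu.trans_lt (hK (k+1) (by omega)))]
  simp

lemma phi_exists (m : ℕ) (ω : Path T) {u : ℝ} (hu : u ∈ Set.Icc 0 T) :
    ∃ k, sig T hT m k ω ≤ u ∧ u < sig T hT m (k+1) ω ∧
      phi T hT m u ω = ev T hT ω (sig T hT m k ω) := by
  obtain ⟨K, hK⟩ := sig_eventually (hT := hT) m ω
  have hex : ∃ k, u < sig T hT m k ω := ⟨K, hu.2.trans_lt (hK K le_rfl)⟩
  obtain ⟨k, hk⟩ : ∃ k, Nat.find hex = k + 1 := by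
    apply Nat.exists_eq_succ_of_ne_zero
    intro h0
    have := Nat.find_spec hex
    rw [h0] at this
    simp [sig] at this
    linarith [hu.1]
  have h1 : u < sig T hT m (k+1) ω := hk ▸ Nat.find_spec hex
  have h2 : sig T hT m k ω ≤ u := not_lt.1 (Nat.find_min hex (by omega))
  refine ⟨k, h2, h1, ?_⟩
  unfold phi
  rw [tsum_eq_single k]
  · rw [if_pos h1, if_neg (not_lt.2 h2)]; simp
  · intro k' hk'
    rcases lt_or_gt_of_ne hk' with h | h
    · have a1 : sig T hT m (k'+1) ω ≤ sig T hT m k ω := sig_mono m ω (by omega)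
      have a2 := sig_mono_succ (hT := hT) m k' ω
      rw [if_neg (by linarith), if_neg (by linarith)]; simp
    · have a1 : sig T hT m (k+1) ω ≤ sig T hT m k' ω := sig_mono m ω (by omega)
      have a2 := sig_mono_succ (hT := hT) m k' ω
      rw [if_pos (by linarith), if_pos (by linarith)]; simp

lemma phi_close (m : ℕ) (ω : Path T) {u : ℝ} (hu : u ∈ Set.Icc 0 T) :
    |phi T hT m u ω - ev T hT ω u| ≤ (2:ℝ) ^ (-(m:ℤ)) := by
  obtain ⟨k, h1, h2, h3⟩ := phi_exists (hT := hT) m ω hu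
  rw [h3, abs_sub_comm]
  by_contra hcon
  push Not at hcon
  have := (sig_succ_le_iff m k ω hu.2).2 ⟨u, h1, le_rfl, hcon.le⟩
  linarith

lemma phi_abs_le (m : ℕ) (ω : Path T) {u : ℝ} (hu : u ∈ Set.Icc 0 T) :
    |phi T hT m u ω| ≤ ‖ω‖ := by
  obtain ⟨k, h1, h2, h3⟩ := phi_exists (hT := hT) m ω hu
  rw [h3]; exact ev_abs_le _ _

lemma sig_stop (m k : ℕ) (ω : Path T) (t : Set.Icc (0:ℝ) T) :
    ∀ x ≤ t.1, (sig T hT m k (stopPath T ω t) ≤ x ↔ sig T hT m k ω ≤ x) := by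
  induction k with
  | zero => intro x hx; simp [sig]
  | succ k ih =>
    intro x hx
    have hxT := hx.trans t.2.2
    rw [sig_succ_le_iff m k _ hxT, sig_succ_le_iff m k _ hxT]
    have heq : sig T hT m k ω ≤ x → sig T hT m k (stopPath T ω t) = sig T hT m k ω := fun h =>
      le_antisymm ((ih _ (h.trans hx)).2 le_rfl)
        ((ih _ (((ih _ hx).2 h).trans hx)).1 le_rfl)
    constructor
    · rintro ⟨u, h1, h2, h3⟩
      have h4 := heq ((ih x hx).1 (h1.trans h2))
      rw [h4] at h1 h3
      rw [ev_stop, ev_stop, min_eq_right (h2.trans hx), min_eq_right (h1.trans (h2.trans hx))] at h3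
      exact ⟨u, h1, h2, h3⟩
    · rintro ⟨u, h1, h2, h3⟩
      have h4 := heq (h1.trans h2)
      refine ⟨u, by rwa [h4], h2, ?_⟩
      rw [h4, ev_stop, ev_stop, min_eq_right (h2.trans hx), min_eq_right (h1.trans (h2.trans hx))]
      exact h3

lemma sig_stop_eq {m k : ℕ} {ω : Path T} {t : Set.Icc (0:ℝ) T} (h : sig T hT m k ω ≤ t) :
    sig T hT m k (stopPath T ω t) = sig T hT m k ω :=
  le_antisymm ((sig_stop m k ω t _ h).2 le_rfl)
    ((sig_stop m k ω t _ ((sig_stop m k ω t _ le_rfl).2 h)).1 le_rfl)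

lemma sig_stop_gt {m k : ℕ} {ω : Path T} {t : Set.Icc (0:ℝ) T} (h : t.1 < sig T hT m k ω) :
    t.1 < sig T hT m k (stopPath T ω t) := by
  by_contra hc
  have := (sig_stop m k ω t _ le_rfl).1 (not_lt.1 hc)
  linarith

lemma Sm_stop (m : ℕ) (ω : Path T) (t : Set.Icc (0:ℝ) T) (u : ℝ) :
    Sm T hT m u (stopPath T ω t) = Sm T hT m (min t.1 u) ω := by
  unfold Sm
  congr 1
  funext k
  simp only [ev_stop]
  rcases le_or_gt (sig T hT m k ω) t.1 with h1 | h1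
  · rw [sig_stop_eq h1, min_eq_right h1]
    rcases le_or_gt (sig T hT m (k+1) ω) t.1 with h2 | h2
    · rw [sig_stop_eq h2]
      congr 3 <;> rw [min_left_comm]
    · have h3 := sig_stop_gt h2
      have : min t.1 (min (sig T hT m (k+1) (stopPath T ω t)) u)
        = min (sig T hT m (k+1) ω) (min t.1 u) := by
        rw [min_left_comm, min_eq_right ((min_le_left _ _).trans h3.le),
          min_eq_right ((min_le_left _ _).trans h2.le)]
      rw [this, min_left_comm t.1]
  · have h2 : t.1 < sig T hT m (k+1) ω := h1.trans_le (sig_mono_succ m k ω)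
    have h3 := sig_stop_gt h1
    have h4 := sig_stop_gt h2
    have aux : ∀ s : ℝ, t.1 < s → min t.1 (min s u) = min t.1 u := fun s hs => by
      rw [min_left_comm, min_eq_right ((min_le_left _ _).trans hs.le)]
    have aux2 : ∀ s : ℝ, t.1 < s → min s (min t.1 u) = min t.1 u := fun s hs => by
      rw [min_eq_right ((min_le_left _ _).trans hs.le)]
    rw [aux _ h3, aux _ h4, aux2 _ h1, aux2 _ h2]
    simp

lemma phi_stop (m : ℕ) (ω : Path T) (t : Set.Icc (0:ℝ) T) {u : ℝ} (hu : u ≤ t.1) :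
    phi T hT m u (stopPath T ω t) = phi T hT m u ω := by
  unfold phi
  congr 1
  funext k
  have e : ∀ k, (u < sig T hT m k (stopPath T ω t)) = (u < sig T hT m k ω) := fun k => by
    have := sig_stop (hT := hT) m k ω t u hu
    simp only [← not_le, this]
  simp only [e]
  by_cases h : u < sig T hT m k ω
  · rw [if_pos h, if_pos (h.trans_le (sig_mono_succ m k ω))]; simp
  · have h' := (not_lt.1 h).trans hu
    rw [sig_stop_eq h', ev_stop, min_eq_right h']

/-! discretization -/

/-- dyadic grid -/
def gr (T : ℝ) (j i : ℕ) : ℝ := T * i / 2 ^ j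

lemma gr_zero (j : ℕ) : gr T j 0 = 0 := by simp [gr]
lemma gr_last (j : ℕ) : gr T j (2^j) = T := by simp [gr]
lemma gr_succ (j i : ℕ) : gr T j (i+1) = gr T j i + T / 2^j := by simp [gr]; ring
lemma gr_mono (hT : 0 ≤ T) (j : ℕ) : Monotone (gr T j) := by
  intro a b h
  unfold gr
  have : (a:ℝ) ≤ b := by exact_mod_cast h
  gcongr
lemma gr_mem (hT : 0 ≤ T) {j i : ℕ} (hi : i ≤ 2^j) : gr T j i ∈ Set.Icc 0 T := by
  constructor
  · rw [← gr_zero (T := T) j]; exact gr_mono hT j (Nat.zero_le _)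
  · exact (gr_mono hT j hi).trans (gr_last (T := T) j).le

/-- discretized integral -/
def Idis (T : ℝ) (hT : 0 ≤ T) (ω : Path T) (j : ℕ) (θ : ℝ → ℝ) (t : ℝ) : ℝ :=
  ∑ i ∈ Finset.range (2^j), θ (gr T j i) *
    (ev T hT ω (min (gr T j (i+1)) t) - ev T hT ω (min (gr T j i) t))

/-- convergence of discretized integrals, uniformly in time -/
def Conv (T : ℝ) (hT : 0 ≤ T) (ω : Path T) (θ : ℝ → ℝ) (Z : ℝ → ℝ) : Prop :=
  ∀ ε > 0, ∃ j0, ∀ j ≥ j0, ∀ t ∈ Set.Icc 0 T, |Idis T hT ω j θ t - Z t| ≤ ε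

lemma Conv.add {ω : Path T} {θ θ' Z Z' : ℝ → ℝ} (h : Conv T hT ω θ Z) (h' : Conv T hT ω θ' Z') :
    Conv T hT ω (fun u => θ u + θ' u) (fun t => Z t + Z' t) := by
  intro ε hε
  obtain ⟨j0, h0⟩ := h (ε/2) (by positivity)
  obtain ⟨j1, h1⟩ := h' (ε/2) (by positivity)
  refine ⟨max j0 j1, fun j hj t ht => ?_⟩
  have a := h0 j (le_trans (le_max_left _ _) hj) t ht
  have b := h1 j (le_trans (le_max_right _ _) hj) t ht
  have : Idis T hT ω j (fun u => θ u + θ' u) t = Idis T hT ω j θ t + Idis T hT ω j θ' t := by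
    unfold Idis; rw [← Finset.sum_add_distrib]; congr 1; funext i; ring
  rw [this]
  rw [abs_le] at *
  constructor <;> linarith [a.1, a.2, b.1, b.2]

lemma Conv.smul {ω : Path T} {θ Z : ℝ → ℝ} (h : Conv T hT ω θ Z) (c : ℝ) :
    Conv T hT ω (fun u => c * θ u) (fun t => c * Z t) := by
  intro ε hε
  obtain ⟨j0, h0⟩ := h (ε/(|c|+1)) (by positivity)
  refine ⟨j0, fun j hj t ht => ?_⟩
  have a := h0 j hj t ht
  have : Idis T hT ω j (fun u => c * θ u) t = c * Idis T hT ω j θ t := by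
    unfold Idis; rw [Finset.mul_sum]; congr 1; funext i; ring
  rw [this, ← mul_sub, abs_mul]
  calc |c| * _ ≤ (|c|+1) * (ε/(|c|+1)) := by gcongr; linarith
    _ = ε := by field_simp

lemma Conv.sub {ω : Path T} {θ θ' Z Z' : ℝ → ℝ} (h : Conv T hT ω θ Z) (h' : Conv T hT ω θ' Z') :
    Conv T hT ω (fun u => θ u - θ' u) (fun t => Z t - Z' t) := by
  have := h.add (h'.smul (-1))
  simpa [sub_eq_add_neg] using this

lemma Conv.sum {ι : Type*} {s : Finset ι} {ω : Path T} {θ Z : ι → ℝ → ℝ}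
    (h : ∀ i ∈ s, Conv T hT ω (θ i) (Z i)) :
    Conv T hT ω (fun u => ∑ i ∈ s, θ i u) (fun t => ∑ i ∈ s, Z i t) := by
  induction s using Finset.induction_on with
  | empty => intro ε hε; refine ⟨0, fun j _ t _ => ?_⟩; simp [Idis]; exact hε.le
  | insert a s ha ih =>
    simp only [Finset.sum_insert ha]
    exact (h a (by simp)).add (ih fun i hi => h i (by simp [hi]))

lemma Conv.congr {ω : Path T} {θ θ' Z Z' : ℝ → ℝ} (h : Conv T hT ω θ Z)
    (h1 : ∀ u ∈ Set.Icc 0 T, θ' u = θ u) (h2 : ∀ t ∈ Set.Icc 0 T, Z' t = Z t) :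
    Conv T hT ω θ' Z' := by
  intro ε hε
  obtain ⟨j0, h0⟩ := h ε hε
  refine ⟨j0, fun j hj t ht => ?_⟩
  have : Idis T hT ω j θ' t = Idis T hT ω j θ t := by
    unfold Idis
    apply Finset.sum_congr rfl
    intro i hi
    rw [h1 _ (gr_mem hT (Finset.mem_range.1 hi).le)]
  rw [this, h2 t ht]
  exact h0 j hj t ht

lemma mesh_tendsto : Tendsto (fun j : ℕ => T / 2^j) atTop (𝓝 0) := by
  have := (tendsto_pow_atTop_nhds_zero_of_lt_one (r := (1/2:ℝ)) (by norm_num) (by norm_num)).const_mul T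
  simp only [mul_zero] at this
  refine this.congr fun j => ?_
  rw [div_pow, one_pow]; ring

lemma Conv_half (ω : Path T) {b : ℝ} (hb : 0 ≤ b) {D : ℝ → Prop} (h1 : ∀ u < b, D u)
    (h2 : ∀ u, D u → u ≤ b) (h3 : ∀ u v, D u → v ≤ u → D v) :
    Conv T hT ω (fun u => if D u then 1 else 0) (fun t => ev T hT ω (min b t) - ev T hT ω 0) := by
  intro ε hε
  obtain ⟨δ, hδ, hu⟩ := Metric.uniformContinuous_iff.1 (ev_unif (hT := hT) ω) ε hε
  obtain ⟨j0, hj0⟩ := eventually_atTop.1 ((mesh_tendsto (T := T)).eventually (gt_mem_nhds hδ))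
  refine ⟨j0, fun j hj t ht => ?_⟩
  have hmesh := hj0 j hj
  have hm0 : 0 ≤ T / 2^j := by positivity
  have key : ∀ n, ∃ x, 0 ≤ x ∧ (∑ i ∈ Finset.range n, (if D (gr T j i) then (1:ℝ) else 0) *
      (ev T hT ω (min (gr T j (i+1)) t) - ev T hT ω (min (gr T j i) t)))
      = ev T hT ω (min x t) - ev T hT ω 0 ∧
      ((x = gr T j n ∧ gr T j n ≤ b + T/2^j) ∨ (|x - b| ≤ T/2^j ∧ ¬ D (gr T j n))) := by
    intro n
    induction n with
    | zero => exact ⟨0, le_rfl, by simp [ht.1], Or.inl ⟨(gr_zero j).symm, by rw [gr_zero]; linarith⟩⟩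
    | succ n ih =>
      obtain ⟨x, hx0, hx, hor⟩ := ih
      have hgm : gr T j n ≤ gr T j (n+1) := gr_mono hT j (Nat.le_succ n)
      rw [Finset.sum_range_succ, hx]
      by_cases hD : D (gr T j n)
      · rcases hor with ⟨rfl, h⟩ | ⟨_, h⟩
        · refine ⟨gr T j (n+1), hx0.trans hgm, by rw [if_pos hD]; ring, Or.inl ⟨rfl, ?_⟩⟩
          rw [gr_succ]; linarith [h2 _ hD]
        · exact absurd hD h
      · refine ⟨x, hx0, by rw [if_neg hD]; ring, Or.inr ⟨?_, fun h => hD (h3 _ _ h hgm)⟩⟩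
        rcases hor with ⟨rfl, h⟩ | ⟨h, _⟩
        · have : b ≤ gr T j n := by
            by_contra hc; exact hD (h1 _ (not_le.1 hc))
          rw [abs_le]; constructor <;> linarith
        · exact h
  obtain ⟨x, hx0, hx, hor⟩ := key (2^j)
  unfold Idis
  rw [hx]
  have : |min x t - min b t| ≤ T/2^j := by
    rcases hor with ⟨rfl, h⟩ | ⟨h, _⟩
    · rw [gr_last] at *
      rw [min_eq_right ht.2]
      rcases le_total b t with h' | h'
      · rw [min_eq_left h', abs_of_nonneg (by linarith)]; linarith [ht.2]
      · rw [min_eq_right h']; simpa using hm0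
    · exact (abs_min_sub_min_le_max x t b t).trans (by simp [h, hm0])
  have h4 := hu (a := min x t) (b := min b t) (by rw [Real.dist_eq]; linarith)
  rw [Real.dist_eq] at h4
  rw [show ∀ a b c : ℝ, a - c - (b - c) = a - b by intros; ring]
  exact h4.le

lemma Conv_half_lt (ω : Path T) {b : ℝ} (hb : 0 ≤ b) :
    Conv T hT ω (fun u => if u < b then 1 else 0)
      (fun t => ev T hT ω (min b t) - ev T hT ω 0) :=
  Conv_half ω hb (fun _ h => h) (fun _ h => h.le) (fun _ _ h h' => h'.trans_lt h)

lemma Conv_half_le (ω : Path T) {b : ℝ} (hb : 0 ≤ b) :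
    Conv T hT ω (fun u => if u ≤ b then 1 else 0)
      (fun t => ev T hT ω (min b t) - ev T hT ω 0) :=
  Conv_half ω hb (fun _ h => h.le) (fun _ h => h) (fun _ _ h h' => h'.trans h)

lemma Conv_half_both (ω : Path T) {a b : ℝ} (ha : 0 ≤ a) (hb : 0 ≤ b) :
    Conv T hT ω (fun u => (if u ≤ a then 1 else 0) * (if u < b then 1 else 0))
      (fun t => ev T hT ω (min b (min a t)) - ev T hT ω 0) := by
  have := Conv_half (hT := hT) ω (b := min b a) (D := fun u => u ≤ a ∧ u < b) (le_min hb ha)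
    (fun u h => ⟨(h.trans_le (min_le_right _ _)).le, h.trans_le (min_le_left _ _)⟩)
    (fun u h => le_min h.2.le h.1) (fun u v h h' => ⟨h'.trans h.1, h'.trans_lt h.2⟩)
  refine this.congr (fun u _ => ?_) (fun t _ => by rw [min_assoc])
  by_cases h1 : u ≤ a <;> by_cases h2 : u < b <;> simp [h1, h2]

lemma Conv_phi (m : ℕ) (ω : Path T) :
    Conv T hT ω (fun u => phi T hT m u ω) (fun t => Sm T hT m t ω) := by
  obtain ⟨K, hK⟩ := sig_eventually (hT := hT) m ω
  have := Conv.sum (s := Finset.range K) (fun k _ =>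
    ((Conv_half_lt (hT := hT) ω (sig_nonneg (hT := hT) m (k+1) ω)).sub
    (Conv_half_lt ω (sig_nonneg (hT := hT) m k ω))).smul (ev T hT ω (sig T hT m k ω)))
  refine this.congr (fun u hu => phi_eq hK hu.2) (fun t ht => ?_)
  rw [Sm_eq hK ht.2]
  congr 1; funext k; ring

lemma Conv_le_phi (m : ℕ) (ω : Path T) {a : ℝ} (ha : 0 ≤ a) :
    Conv T hT ω (fun u => (if u ≤ a then 1 else 0) * phi T hT m u ω)
      (fun t => Sm T hT m (min a t) ω) := by
  obtain ⟨K, hK⟩ := sig_eventually (hT := hT) m ω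
  have := Conv.sum (s := Finset.range K) (fun k _ =>
    ((Conv_half_both (hT := hT) ω ha (sig_nonneg (hT := hT) m (k+1) ω)).sub
    (Conv_half_both ω ha (sig_nonneg (hT := hT) m k ω))).smul (ev T hT ω (sig T hT m k ω)))
  refine this.congr (fun u hu => ?_) (fun t ht => ?_)
  · rw [phi_eq hK hu.2, Finset.mul_sum]
    congr 1; funext k; ring
  · rw [Sm_eq hK ((min_le_right _ _).trans ht.2)]
    congr 1; funext k; ring

lemma strat_nonneg (H : SimpleStrategy T) (l : Fin (H.L+1)) (ω : Path T) : 0 ≤ H.τ l ω := by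
  induction l using Fin.induction with
  | zero => exact H.τ_nonneg ω
  | succ i ih => exact ih.trans (H.τ_mono i ω)

lemma strat_le (H : SimpleStrategy T) (l : Fin (H.L+1)) (ω : Path T) : H.τ l ω ≤ T := by
  induction l using Fin.reverseInduction with
  | last => exact H.τ_le ω
  | cast i ih => exact (H.τ_mono i ω).trans ih

/-- integrand of a simple strategy -/
def theta (H : SimpleStrategy T) (ω : Path T) (u : ℝ) : ℝ :=
  ∑ l : Fin H.L, H.coeff l ω * ((if u ≤ H.τ l.succ ω then 1 else 0)
    - (if u ≤ H.τ l.castSucc ω then 1 else 0))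

lemma Conv_integ (H : SimpleStrategy T) (ω : Path T) :
    Conv T hT ω (theta H ω) (fun t => integ T H (Sproc T hT) t ω) := by
  have := Conv.sum (s := Finset.univ) (fun (l : Fin H.L) _ =>
    ((Conv_half_le (hT := hT) ω (strat_nonneg H l.succ ω)).sub
    (Conv_half_le ω (strat_nonneg H l.castSucc ω))).smul (H.coeff l ω))
  refine this.congr (fun u hu => rfl) (fun t ht => ?_)
  unfold integ Sproc
  congr 1; funext k; ring

lemma Conv_integ_Sm (G : SimpleStrategy T) (m : ℕ) (ω : Path T) :
    Conv T hT ω (fun u => theta G ω u * phi T hT m u ω) (fun t => integ T G (Sm T hT m) t ω) := by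
  have := Conv.sum (s := Finset.univ) (fun (l : Fin G.L) _ =>
    ((Conv_le_phi (hT := hT) m ω (strat_nonneg G l.succ ω)).sub
    (Conv_le_phi m ω (strat_nonneg G l.castSucc ω))).smul (G.coeff l ω))
  refine this.congr (fun u hu => ?_) (fun t ht => rfl)
  unfold theta
  rw [Finset.sum_mul]
  congr 1; funext k; ring

end PathLevel

end Part1

section Part2

section Meas
variable {T : ℝ} {hT : 0 ≤ T}

lemma meas_path (hT : 0 ≤ T) {α : Type*} [MeasurableSpace α] {f : α → Path T}
    (h : ∀ t, Measurable fun a => f a t) : Measurable f := by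
  have : Nonempty (Set.Icc (0:ℝ) T) := ⟨t0 T hT⟩
  have hball : ∀ (g : Path T) (r : ℝ), MeasurableSet (f ⁻¹' (Metric.closedBall g r)) := by
    intro g r
    rcases lt_or_ge r 0 with hr | hr
    · rw [Metric.closedBall_eq_empty.2 hr]; simp
    · have : f ⁻¹' (Metric.closedBall g r) = ⋂ n, {a | dist (f a (TopologicalSpace.denseSeq _ n))
          (g (TopologicalSpace.denseSeq _ n)) ≤ r} := by
        ext a
        simp only [mem_preimage, Metric.mem_closedBall, mem_iInter, mem_ofPred_eq]
        rw [ContinuousMap.dist_le hr]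
        constructor
        · intro h n; exact h _
        · intro h x
          refine (TopologicalSpace.denseRange_denseSeq (Set.Icc (0:ℝ) T)).induction_on
            (p := fun x => dist (f a x) (g x) ≤ r) x ?_ h
          exact isClosed_le (by fun_prop) continuous_const
      rw [this]
      refine MeasurableSet.iInter fun n => measurableSet_le ((h _).dist measurable_const)
        measurable_const
  apply measurable_of_isOpen
  intro U hU
  have : U = ⋃ (n : ℕ) (q : ℚ) (_ : Metric.closedBall
      (TopologicalSpace.denseSeq (Path T) n) q ⊆ U),
      Metric.closedBall (TopologicalSpace.denseSeq (Path T) n) q := by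
    apply Subset.antisymm
    · intro x hx
      obtain ⟨ε, hε, hsub⟩ := Metric.isOpen_iff.1 hU x hx
      obtain ⟨n, hn⟩ := (TopologicalSpace.denseRange_denseSeq (Path T)).exists_dist_lt x
        (show 0 < ε/3 by positivity)
      obtain ⟨q, hq1, hq2⟩ := exists_rat_btwn (show ε/3 < ε/2 by linarith)
      simp only [mem_iUnion]
      refine ⟨n, q, ?_, ?_⟩
      · intro y hy
        apply hsub
        rw [Metric.mem_closedBall] at hy
        rw [Metric.mem_ball]
        calc dist y x ≤ dist y (TopologicalSpace.denseSeq (Path T) n) +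
              dist (TopologicalSpace.denseSeq (Path T) n) x := dist_triangle _ _ _
          _ < ε := by rw [dist_comm _ x]; linarith
      · rw [Metric.mem_closedBall]; linarith
    · intro x hx
      simp only [mem_iUnion] at hx
      obtain ⟨n, q, h1, h2⟩ := hx
      exact h1 h2
  rw [this]
  simp only [preimage_iUnion]
  exact MeasurableSet.iUnion fun n => MeasurableSet.iUnion fun q => MeasurableSet.iUnion fun _ =>
    hball _ _

lemma stop_joint : Continuous (fun x : Path T × Set.Icc (0:ℝ) T => stopPath T x.1 x.2) := by
  apply ContinuousMap.continuous_of_continuous_uncurry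
  show Continuous (fun y : (Path T × Set.Icc (0:ℝ) T) × Set.Icc (0:ℝ) T =>
    y.1.1 ⟨min y.1.2.1 y.2.1, _⟩)
  have h1 : Continuous (fun y : (Path T × Set.Icc (0:ℝ) T) × Set.Icc (0:ℝ) T => y.1.1) := by
    fun_prop
  have h2 : Continuous (fun y : (Path T × Set.Icc (0:ℝ) T) × Set.Icc (0:ℝ) T =>
    min y.1.2.1 y.2.1) := by fun_prop
  exact (continuous_eval (F := Path T)).comp (h1.prodMk (h2.subtype_mk _))

lemma stop_cont (s : Set.Icc (0:ℝ) T) : Continuous (fun ω : Path T => stopPath T ω s) :=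
  stop_joint.comp (continuous_id.prodMk continuous_const)

lemma stop_stop (ω : Path T) (s t : Set.Icc (0:ℝ) T) :
    stopPath T (stopPath T ω s) t = stopPath T ω (min s t) := by
  ext u
  simp only [stopPath, ContinuousMap.coe_mk]
  congr 1
  ext
  simp [min_assoc]

lemma stop_T (ω : Path T) (s : Set.Icc (0:ℝ) T) (hs : s.1 = T) : stopPath T ω s = ω := by
  ext u
  simp only [stopPath, ContinuousMap.coe_mk]
  congr 1
  ext
  simp [hs, u.2.2]

lemma Fraw_le (s : ℝ) : Fraw T s ≤ borel (Path T) := by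
  unfold Fraw
  refine iSup₂_le fun u _ => ?_
  rw [← measurable_iff_comap_le]
  exact (continuous_eval_const u : Continuous fun ω : Path T => ω u).borel_measurable

lemma Fraw_mono : Monotone (Fraw T) := by
  intro s t h
  unfold Fraw
  exact iSup₂_le fun u hu => le_iSup₂_of_le u (hu.trans h) le_rfl

lemma Fraw_eval {s : ℝ} {u : Set.Icc (0:ℝ) T} (h : u.1 ≤ s) :
    Measurable[Fraw T s] (fun ω : Path T => ω u) := by
  rw [measurable_iff_comap_le]
  exact le_iSup₂_of_le (f := fun (s' : Set.Icc (0:ℝ) T) (_ : (s' : ℝ) ≤ s) =>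
    MeasurableSpace.comap (fun ω : Path T => ω s') inferInstance) u h le_rfl

lemma Fraw_stop (hT : 0 ≤ T) (s : Set.Icc (0:ℝ) T) :
    Measurable[Fraw T s.1] (fun ω : Path T => stopPath T ω s) := by
  refine @meas_path T hT (Path T) (Fraw T s.1) _ fun u => ?_
  exact Fraw_eval (min_le_left _ _)

lemma Fraw_of_stop (hT : 0 ≤ T) {β : Type*} [MeasurableSpace β] {f : Path T → β}
    (hf : Measurable f) (s : Set.Icc (0:ℝ) T) (h : ∀ ω, f (stopPath T ω s) = f ω) :
    Measurable[Fraw T s.1] f := by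
  have : f = f ∘ (fun ω : Path T => stopPath T ω s) := by funext ω; exact (h ω).symm
  rw [this]
  exact hf.comp (Fraw_stop hT s)

lemma Fraw_mem_stop {s : Set.Icc (0:ℝ) T} {A : Set (Path T)} (hA : MeasurableSet[Fraw T s.1] A) :
    ∃ B : Set (Path T), MeasurableSet B ∧ A = (fun ω => stopPath T ω s) ⁻¹' B := by
  have hle : Fraw T s.1 ≤ MeasurableSpace.comap (fun ω : Path T => stopPath T ω s) (borel _) := by
    unfold Fraw
    refine iSup₂_le fun u hu => ?_
    rw [← measurable_iff_comap_le]
    have : (fun ω : Path T => ω u) = (fun ω : Path T => ω u) ∘ (fun ω => stopPath T ω s) := by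
      funext ω
      simp only [Function.comp, stopPath, ContinuousMap.coe_mk]
      congr 1
      ext
      simp [hu]
    rw [this]
    exact (continuous_eval_const u : Continuous fun ω : Path T => ω u).borel_measurable.comp
      (comap_measurable _)
  obtain ⟨B, hB, rfl⟩ := hle _ hA
  exact ⟨B, hB, rfl⟩

lemma sig_gap (m k : ℕ) (ω : Path T) : sig T hT m k ω ≤ T ∨ sig T hT m k ω = T + 1 := by
  cases k with
  | zero => left; simpa [sig] using hT
  | succ k =>
    set A : Set ℝ := {t : ℝ | sig T hT m k ω ≤ t ∧ t ≤ T ∧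
        (2:ℝ) ^ (-(m:ℤ)) ≤ |ev T hT ω t - ev T hT ω (sig T hT m k ω)|} with hA
    have hs : sig T hT m (k+1) ω = sInf (A ∪ {T+1}) := by rw [sig]
    have hb : BddBelow (A ∪ {T+1}) := by
      refine ⟨0, ?_⟩
      rintro x (hx | hx)
      · exact (sig_nonneg m k ω).trans hx.1
      · simp at hx; linarith
    have hc : IsClosed (A ∪ {T+1}) := by
      apply IsClosed.union _ isClosed_singleton
      apply IsClosed.inter isClosed_Ici
      apply IsClosed.inter isClosed_Iic
      exact isClosed_le continuous_const (((ev_cont ω).sub continuous_const).abs)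
    have := hc.csInf_mem ⟨T+1, Or.inr rfl⟩ hb
    rw [← hs] at this
    rcases this with h' | h'
    · exact Or.inl h'.2.1
    · exact Or.inr h'

lemma sig_meas (m k : ℕ) : Measurable (sig T hT m k) := by
  induction k with
  | zero => simp only [sig]; exact measurable_const
  | succ k ih =>
    have key : ∀ x ≤ T, MeasurableSet {ω | sig T hT m (k+1) ω ≤ x} := by
      intro x hx
      have hcl : IsClosed {y : Path T × ℝ | ∃ r : Set.Icc (0:ℝ) 1, (2:ℝ) ^ (-(m:ℤ)) ≤
          |ev T hT y.1 (y.2 + r.1 * (x - y.2)) - ev T hT y.1 y.2|} := by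
        have h1 : IsClosed {z : Set.Icc (0:ℝ) 1 × (Path T × ℝ) | (2:ℝ) ^ (-(m:ℤ)) ≤
          |ev T hT z.2.1 (z.2.2 + z.1.1 * (x - z.2.2)) - ev T hT z.2.1 z.2.2|} := by
          refine isClosed_le continuous_const (Continuous.abs (Continuous.sub ?_ ?_))
          · have a1 : Continuous (fun z : Set.Icc (0:ℝ) 1 × (Path T × ℝ) =>
              z.2.2 + z.1.1 * (x - z.2.2)) := by fun_prop
            exact (ev_joint (hT := hT)).comp ((continuous_fst.comp continuous_snd).prodMk a1)
          · exact (ev_joint (hT := hT)).comp ((continuous_fst.comp continuous_snd).prodMk (continuous_snd.comp continuous_snd))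
        have h2 := isClosedMap_snd_of_compactSpace _ h1
        convert h2 using 1
        ext y
        constructor
        · rintro ⟨r, hr⟩; exact ⟨(r, y), hr, rfl⟩
        · rintro ⟨⟨r, y'⟩, hr, rfl⟩; exact ⟨r, hr⟩
      have : {ω | sig T hT m (k+1) ω ≤ x} = {ω | sig T hT m k ω ≤ x} ∩
          (fun ω => (ω, sig T hT m k ω)) ⁻¹' {y : Path T × ℝ | ∃ r : Set.Icc (0:ℝ) 1,
          (2:ℝ) ^ (-(m:ℤ)) ≤ |ev T hT y.1 (y.2 + r.1 * (x - y.2)) - ev T hT y.1 y.2|} := by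
        ext ω
        simp only [mem_ofPred_eq, mem_inter_iff, mem_preimage]
        rw [sig_succ_le_iff m k ω hx]
        constructor
        · rintro ⟨u, h1, h2, h3⟩
          refine ⟨h1.trans h2, ?_⟩
          rcases (h1.trans h2).eq_or_lt with h | h
          · refine ⟨⟨0, by simp⟩, ?_⟩
            have : u = sig T hT m k ω := le_antisymm (by linarith) h1
            simpa [this] using h3
          · have hpos : 0 < x - sig T hT m k ω := by linarith
            refine ⟨⟨(u - sig T hT m k ω) / (x - sig T hT m k ω), by
              apply div_nonneg <;> linarith, by rw [div_le_one hpos]; linarith⟩, ?_⟩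
            simp only
            rw [div_mul_cancel₀ _ hpos.ne']
            simpa using h3
        · rintro ⟨h1, r, hr⟩
          refine ⟨_, ?_, ?_, hr⟩
          · nlinarith [r.2.1]
          · nlinarith [r.2.2]
      rw [this]
      exact (measurableSet_le ih measurable_const).inter
        ((measurable_id.prodMk ih) hcl.measurableSet)
    apply measurable_of_Iic
    intro x
    show MeasurableSet {ω | sig T hT m (k+1) ω ≤ x}
    rcases le_or_gt x T with h | h
    · exact key x h
    · rcases le_or_gt (T+1) x with h' | h'
      · convert MeasurableSet.univ
        exact eq_univ_of_forall fun ω => (sig_le m (k+1) ω).trans h'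
      · convert key T le_rfl using 1
        ext ω
        constructor
        · intro h1
          rcases sig_gap (hT := hT) m (k+1) ω with h2 | h2
          · exact h2
          · simp only [mem_ofPred_eq] at h1; linarith
        · intro h1; exact le_trans h1 h.le

lemma Sm_meas (m : ℕ) {α : Type*} [MeasurableSpace α] {f : α → Path T} {t : α → ℝ}
    (hf : Measurable f) (ht : Measurable t) (htT : ∀ a, t a ≤ T) :
    Measurable (fun a => Sm T hT m (t a) (f a)) := by
  refine measurable_of_tendsto_metrizable (f := fun K a => ∑ k ∈ Finset.range K,
    ev T hT (f a) (sig T hT m k (f a)) *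
    (ev T hT (f a) (min (sig T hT m (k + 1) (f a)) (t a))
      - ev T hT (f a) (min (sig T hT m k (f a)) (t a)))) (fun K => ?_) ?_
  · refine Finset.measurable_fun_sum _ fun k _ => ?_
    have h : ∀ k, Measurable fun a => sig T hT m k (f a) := fun k => (sig_meas m k).comp hf
    exact (meas_ev hf (h k)).mul ((meas_ev hf ((h _).min ht)).sub (meas_ev hf ((h _).min ht)))
  · rw [tendsto_pi_nhds]
    intro a
    obtain ⟨K, hK⟩ := sig_eventually (hT := hT) m (f a)
    refine tendsto_const_nhds.congr' ?_
    filter_upwards [eventually_ge_atTop K] with n hn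
    exact Sm_eq (fun k hk => hK k (hn.trans hk)) (htT a)

lemma phi_meas (m : ℕ) {u : ℝ} (hu : u ≤ T) : Measurable (fun ω => phi T hT m u ω) := by
  refine measurable_of_tendsto_metrizable (f := fun K ω => ∑ k ∈ Finset.range K,
    ev T hT ω (sig T hT m k ω) *
    ((if u < sig T hT m (k+1) ω then 1 else 0) - (if u < sig T hT m k ω then 1 else 0)))
     (fun K => ?_) ?_
  · refine Finset.measurable_fun_sum _ fun k _ => ?_
    have h : ∀ k, MeasurableSet {ω | u < sig T hT m k ω} :=
      fun k => measurableSet_lt measurable_const (sig_meas m k)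
    exact (meas_ev measurable_id (sig_meas m k)).mul
      ((Measurable.ite (h _) measurable_const measurable_const).sub
       (Measurable.ite (h _) measurable_const measurable_const))
  · rw [tendsto_pi_nhds]
    intro ω
    obtain ⟨K, hK⟩ := sig_eventually (hT := hT) m ω
    refine tendsto_const_nhds.congr' ?_
    filter_upwards [eventually_ge_atTop K] with n hn
    exact phi_eq (fun k hk => hK k (hn.trans hk)) hu

lemma SS_meas {α : Type*} [MeasurableSpace α] {f : α → Path T} {t : α → ℝ}
    (hf : Measurable f) (ht : Measurable t) (htT : ∀ a, t a ≤ T) :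
    Measurable (fun a => SS T hT (t a) (f a)) := by
  unfold SS
  exact Measurable.liminf fun m => Sm_meas m hf ht htT

lemma SS_stop (ω : Path T) (t : Set.Icc (0:ℝ) T) (u : ℝ) :
    SS T hT u (stopPath T ω t) = SS T hT (min t.1 u) ω := by
  unfold SS; simp only [Sm_stop]

lemma Sm_zero (m : ℕ) (ω : Path T) : Sm T hT m 0 ω = 0 := by
  unfold Sm
  simp [sig_nonneg (hT := hT) m _ ω]

lemma SS_zero (ω : Path T) : SS T hT 0 ω = 0 := by
  unfold SS; simp [Sm_zero]

lemma SS_cont {ω : Path T} (h : ω ∈ BigOmega T hT) :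
    Continuous fun t : Set.Icc (0:ℝ) T => SS T hT t.1 ω := by
  refine h.1.continuous (Frequently.of_forall fun m => ?_)
  exact (Sm_cont m ω).comp_continuous continuous_subtype_val fun t => t.2.2

lemma qvRaw_cont {ω : Path T} (h : ω ∈ BigOmega T hT) :
    Continuous fun t : Set.Icc (0:ℝ) T => qvRaw T hT ω t.1 := by
  unfold qvRaw
  exact ((((ev_cont ω).comp continuous_subtype_val).pow 2).sub continuous_const).sub
    (continuous_const.mul (SS_cont h))

lemma qv_apply {ω : Path T} (h : ω ∈ BigOmega T hT) (t : Set.Icc (0:ℝ) T) :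
    qv T hT ω t = qvRaw T hT ω t.1 := by
  unfold qv
  rw [dif_pos ⟨h, qvRaw_cont h⟩]
  rfl

lemma qv_of_not {ω : Path T} (h : ω ∉ BigOmega T hT) : qv T hT ω = 0 := by
  unfold qv
  rw [dif_neg (fun h' => h h'.1)]

lemma ev_mem (ω : Path T) {t : ℝ} (ht : t ∈ Set.Icc (0:ℝ) T) : ev T hT ω t = ω ⟨t, ht⟩ := by
  simp [ev, clamp, Set.projIcc_of_mem hT ht]

lemma ev_qv {ω : Path T} (h : ω ∈ BigOmega T hT) {t : ℝ} (ht : t ∈ Set.Icc (0:ℝ) T) :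
    ev T hT (qv T hT ω) t = qvRaw T hT ω t := by
  rw [ev_mem _ ht, qv_apply h]

lemma SSbar_psi {ω : Path T} (h : ω ∈ BigOmega T hT) {t : ℝ} (ht : t ∈ Set.Icc (0:ℝ) T) :
    SSbarProc T hT t (psiMap T hT ω) = SS T hT t ω := by
  unfold SSbarProc psiMap
  simp only [ev_qv h ht, qvRaw]
  ring

lemma qvRaw_stop (ω : Path T) (t : Set.Icc (0:ℝ) T) (u : ℝ) (hu : 0 ≤ u) :
    qvRaw T hT (stopPath T ω t) u = qvRaw T hT ω (min t.1 u) := by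
  unfold qvRaw
  rw [SS_stop, ev_stop, ev_stop, min_eq_right t.2.1]

lemma stop_mem {ω : Path T} (h : ω ∈ BigOmega T hT) (t : Set.Icc (0:ℝ) T) :
    stopPath T ω t ∈ BigOmega T hT := by
  have hm : ∀ u ∈ Set.Icc (0:ℝ) T, min t.1 u ∈ Set.Icc (0:ℝ) T := fun u hu =>
    ⟨le_min t.2.1 hu.1, (min_le_right _ _).trans hu.2⟩
  constructor
  · simp only [Sm_stop, SS_stop]
    exact h.1.comp (fun u : Set.Icc (0:ℝ) T => ⟨min t.1 u.1, hm u.1 u.2⟩)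
  · intro u hu v hv huv
    rw [qvRaw_stop _ _ _ hu.1, qvRaw_stop _ _ _ hv.1]
    exact h.2 (hm u hu) (hm v hv) (min_le_min_left _ huv)

lemma qv_stop {ω : Path T} (h : ω ∈ BigOmega T hT) (t : Set.Icc (0:ℝ) T) :
    qv T hT (stopPath T ω t) = stopPath T (qv T hT ω) t := by
  ext u
  rw [qv_apply (stop_mem h t), qvRaw_stop _ _ _ u.2.1]
  simp only [stopPath, ContinuousMap.coe_mk]
  rw [qv_apply h]

/-- joint stopping -/
def stopP (T : ℝ) (p : PathPair T) (t : Set.Icc (0:ℝ) T) : PathPair T :=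
  (stopPath T p.1 t, stopPath T p.2 t)

lemma psi_stop {ω : Path T} (h : ω ∈ BigOmega T hT) (t : Set.Icc (0:ℝ) T) :
    psiMap T hT (stopPath T ω t) = stopP T (psiMap T hT ω) t := by
  simp [psiMap, stopP, qv_stop h]

lemma stopP_joint : Continuous (fun x : PathPair T × Set.Icc (0:ℝ) T => stopP T x.1 x.2) := by
  unfold stopP
  exact (stop_joint.comp ((continuous_fst.comp continuous_fst).prodMk continuous_snd)).prodMk
    (stop_joint.comp ((continuous_snd.comp continuous_fst).prodMk continuous_snd))

lemma Omega_char (ω : Path T) [Nonempty (Set.Icc (0:ℝ) T)] : ω ∈ BigOmega T hT ↔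
    (∀ n : ℕ, ∃ M : ℕ, ∀ m ≥ M, ∀ m' ≥ M, ∀ i : ℕ,
      |Sm T hT m (TopologicalSpace.denseSeq (Set.Icc (0:ℝ) T) i).1 ω -
        Sm T hT m' (TopologicalSpace.denseSeq (Set.Icc (0:ℝ) T) i).1 ω| ≤ 1 / ((n:ℝ)+1)) ∧
    ∀ i i' : ℕ, qvRaw T hT ω (min (TopologicalSpace.denseSeq (Set.Icc (0:ℝ) T) i)
      (TopologicalSpace.denseSeq (Set.Icc (0:ℝ) T) i')).1 ≤
      qvRaw T hT ω (TopologicalSpace.denseSeq (Set.Icc (0:ℝ) T) i').1 := by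
  have hd := TopologicalSpace.denseRange_denseSeq (Set.Icc (0:ℝ) T)
  have hSmc : ∀ m, Continuous (fun t : Set.Icc (0:ℝ) T => Sm T hT m t.1 ω) := fun m =>
    (Sm_cont m ω).comp_continuous continuous_subtype_val fun t => t.2.2
  constructor
  · intro h
    refine ⟨fun n => ?_, fun i i' => h.2 (Subtype.coe_prop _) (Subtype.coe_prop _)
      (min_le_right _ _)⟩
    have := Metric.tendstoUniformly_iff.1 h.1 (1 / ((n:ℝ)+1) / 2) (by positivity)
    obtain ⟨M, hM⟩ := eventually_atTop.1 this
    refine ⟨M, fun m hm m' hm' i => ?_⟩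
    have h1 := hM m hm (TopologicalSpace.denseSeq (Set.Icc (0:ℝ) T) i)
    have h2 := hM m' hm' (TopologicalSpace.denseSeq (Set.Icc (0:ℝ) T) i)
    rw [Real.dist_eq, abs_lt] at h1 h2
    rw [abs_le]
    constructor <;> linarith [h1.1, h1.2, h2.1, h2.2]
  · rintro ⟨h1, h2⟩
    have h3 : ∀ n : ℕ, ∃ M : ℕ, ∀ m ≥ M, ∀ m' ≥ M, ∀ t : Set.Icc (0:ℝ) T,
      |Sm T hT m t.1 ω - Sm T hT m' t.1 ω| ≤ 1 / ((n:ℝ)+1) := by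
      intro n
      obtain ⟨M, hM⟩ := h1 n
      refine ⟨M, fun m hm m' hm' t => ?_⟩
      refine hd.induction_on (p := fun t : Set.Icc (0:ℝ) T =>
        |Sm T hT m t.1 ω - Sm T hT m' t.1 ω| ≤ 1 / ((n:ℝ)+1)) t ?_ (hM m hm m' hm')
      exact isClosed_le ((hSmc m).sub (hSmc m')).abs continuous_const
    have h4 : ∀ t : Set.Icc (0:ℝ) T, Tendsto (fun m => Sm T hT m t.1 ω) atTop
        (𝓝 (SS T hT t.1 ω)) := by
      intro t
      have : CauchySeq (fun m => Sm T hT m t.1 ω) := by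
        rw [Metric.cauchySeq_iff]
        intro ε hε
        obtain ⟨n, hn⟩ := exists_nat_one_div_lt hε
        obtain ⟨M, hM⟩ := h3 n
        exact ⟨M, fun m hm m' hm' => by rw [Real.dist_eq]; exact (hM m hm m' hm' t).trans_lt hn⟩
      obtain ⟨l, hl⟩ := cauchySeq_tendsto_of_complete this
      unfold SS
      rwa [hl.liminf_eq]
    have hU : TendstoUniformly (fun m (t : Set.Icc (0:ℝ) T) => Sm T hT m (t : ℝ) ω)
        (fun t => SS T hT (t : ℝ) ω) Filter.atTop := by
      rw [Metric.tendstoUniformly_iff]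
      intro ε hε
      obtain ⟨n, hn⟩ := exists_nat_one_div_lt hε
      obtain ⟨M, hM⟩ := h3 n
      filter_upwards [eventually_ge_atTop M] with m hm t
      rw [Real.dist_eq]
      have := le_of_tendsto (((h4 t).sub_const (Sm T hT m t.1 ω)).abs)
        ((eventually_ge_atTop M).mono fun m' hm' => hM m' hm' m hm t)
      exact this.trans_lt hn
    refine ⟨hU, ?_⟩
    have hSc : Continuous fun t : Set.Icc (0:ℝ) T => SS T hT t.1 ω :=
      hU.continuous (Frequently.of_forall hSmc)
    have hqc : Continuous fun t : Set.Icc (0:ℝ) T => qvRaw T hT ω t.1 := by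
      unfold qvRaw
      exact ((((ev_cont ω).comp continuous_subtype_val).pow 2).sub continuous_const).sub
        (continuous_const.mul hSc)
    intro s hs t ht hst
    have h5 : ∀ x : Set.Icc (0:ℝ) T × Set.Icc (0:ℝ) T,
        qvRaw T hT ω (min x.1 x.2).1 ≤ qvRaw T hT ω x.2.1 := by
      intro x
      refine (hd.prodMap hd).induction_on (p := fun x : Set.Icc (0:ℝ) T × Set.Icc (0:ℝ) T =>
        qvRaw T hT ω (min x.1 x.2).1 ≤ qvRaw T hT ω x.2.1) x ?_ fun y => h2 y.1 y.2
      exact isClosed_le (hqc.comp (continuous_fst.min continuous_snd)) (hqc.comp continuous_snd)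
    have := h5 (⟨s, hs⟩, ⟨t, ht⟩)
    rw [min_eq_left (by exact hst)] at this
    exact this

lemma Omega_meas : MeasurableSet (BigOmega T hT) := by
  have : Nonempty (Set.Icc (0:ℝ) T) := ⟨t0 T hT⟩
  have hSm : ∀ m (t : Set.Icc (0:ℝ) T), Measurable fun ω => Sm T hT m t.1 ω := fun m t =>
    Sm_meas m measurable_id measurable_const fun _ => t.2.2
  have hq : ∀ (t : Set.Icc (0:ℝ) T), Measurable fun ω => qvRaw T hT ω t.1 := fun t => by
    unfold qvRaw
    exact (((meas_ev measurable_id measurable_const).pow_const 2).sub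
      ((meas_ev measurable_id measurable_const).pow_const 2)).sub
      (measurable_const.mul (SS_meas measurable_id measurable_const fun _ => t.2.2))
  have : BigOmega T hT = {ω | (∀ n : ℕ, ∃ M : ℕ, ∀ m ≥ M, ∀ m' ≥ M, ∀ i : ℕ,
      |Sm T hT m (TopologicalSpace.denseSeq (Set.Icc (0:ℝ) T) i).1 ω -
        Sm T hT m' (TopologicalSpace.denseSeq (Set.Icc (0:ℝ) T) i).1 ω| ≤ 1 / ((n:ℝ)+1))} ∩
    {ω | ∀ i i' : ℕ, qvRaw T hT ω (min (TopologicalSpace.denseSeq (Set.Icc (0:ℝ) T) i)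
      (TopologicalSpace.denseSeq (Set.Icc (0:ℝ) T) i')).1 ≤
      qvRaw T hT ω (TopologicalSpace.denseSeq (Set.Icc (0:ℝ) T) i').1} := by
    ext ω; exact Omega_char ω
  rw [this]
  apply MeasurableSet.inter
  · simp only [ofPred_forall, ofPred_exists]
    refine MeasurableSet.iInter fun n => MeasurableSet.iUnion fun M => MeasurableSet.iInter fun m =>
      MeasurableSet.iInter fun _ => MeasurableSet.iInter fun m' => MeasurableSet.iInter fun _ =>
      MeasurableSet.iInter fun i => measurableSet_le ?_ measurable_const
    exact measurable_norm.comp ((hSm _ _).sub (hSm _ _))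
  · simp only [ofPred_forall]
    exact MeasurableSet.iInter fun i => MeasurableSet.iInter fun i' => measurableSet_le (hq _) (hq _)

lemma qv_meas : Measurable (qv T hT) := by
  refine meas_path hT fun t => ?_
  have : (fun ω => qv T hT ω t) = fun ω => if ω ∈ BigOmega T hT then qvRaw T hT ω t.1 else 0 := by
    funext ω
    split_ifs with h
    · exact qv_apply h t
    · rw [qv_of_not h]; rfl
  rw [this]
  refine Measurable.ite Omega_meas ?_ measurable_const
  unfold qvRaw
  exact (((meas_ev measurable_id measurable_const).pow_const 2).sub
      ((meas_ev measurable_id measurable_const).pow_const 2)).sub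
      (measurable_const.mul (SS_meas measurable_id measurable_const fun _ => t.2.2))

lemma psi_meas : Measurable (psiMap T hT) := measurable_id.prodMk qv_meas

lemma Xi_meas {Ξ : Set (Path T)} {Xibar : Set (PathPair T)} (hA : AssumptionA T hT Ξ Xibar) :
    MeasurableSet Ξ := by
  obtain ⟨K, hK, hX⟩ := hA.A1
  have h1 : MeasurableSet Xibar := by
    rw [hX]; exact MeasurableSet.iUnion fun n => (hK n).isClosed.measurableSet
  rw [hA.xi_eq]
  exact Omega_meas.inter (psi_meas h1)

end Meas

end Part2

section Part3

section Disc

lemma mle {α : Type*} {m : MeasurableSpace α} {f g : α → ℝ} (hf : Measurable f)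
    (hg : Measurable g) : MeasurableSet {x | f x ≤ g x} := measurableSet_le hf hg
lemma mlt {α : Type*} {m : MeasurableSpace α} {f g : α → ℝ} (hf : Measurable f)
    (hg : Measurable g) : MeasurableSet {x | f x < g x} := measurableSet_lt hf hg
lemma mind {α : Type*} {m : MeasurableSpace α} {p : α → Prop} [DecidablePred p] (h : MeasurableSet {x | p x}) :
    Measurable (fun x => if p x then (1:ℝ) else 0) :=
  Measurable.ite h measurable_const measurable_const

lemma mmul {α : Type*} {m : MeasurableSpace α} {f g : α → ℝ} (hf : Measurable f)
    (hg : Measurable g) : Measurable (fun x => f x * g x) := hf.mul hg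
lemma madd {α : Type*} {m : MeasurableSpace α} {f g : α → ℝ} (hf : Measurable f)
    (hg : Measurable g) : Measurable (fun x => f x + g x) := hf.add hg
lemma msub {α : Type*} {m : MeasurableSpace α} {f g : α → ℝ} (hf : Measurable f)
    (hg : Measurable g) : Measurable (fun x => f x - g x) := hf.sub hg
lemma mconst {α : Type*} {m : MeasurableSpace α} (c : ℝ) : Measurable (fun _ : α => c) :=
  measurable_const

lemma int_mul_zero {α : Type*} {m m0 : MeasurableSpace α} (hm : m ≤ m0) {μ : Measure α}
    [IsProbabilityMeasure μ] {Δ c : α → ℝ} (hΔ : Integrable Δ μ)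
    (h : ∀ A, MeasurableSet[m] A → ∫ x in A, Δ x ∂μ = 0) (hc : Measurable[m] c) {C : ℝ}
    (hC : ∀ x, |c x| ≤ C) : Integrable (fun x => c x * Δ x) μ ∧ ∫ x, c x * Δ x ∂μ = 0 := by
  have hi : Integrable (fun x => c x * Δ x) μ :=
    hΔ.bdd_mul (c := C) (hc.mono hm le_rfl).aestronglyMeasurable (Eventually.of_forall hC)
  refine ⟨hi, ?_⟩
  have h0 : (0 : α → ℝ) =ᵐ[μ] μ[Δ | m] := by
    refine ae_eq_condExp_of_forall_setIntegral_eq hm hΔ (fun s _ _ => ?_) (fun s hs _ => ?_) ?_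
    · exact (integrable_zero α ℝ μ).integrableOn
    · rw [h s hs]; simp
    · exact aestronglyMeasurable_zero
  have h1 := condExp_mul_of_stronglyMeasurable_left (μ := μ) (f := c) (g := Δ)
    hc.stronglyMeasurable hi hΔ
  rw [show (fun x => c x * Δ x) = c * Δ from rfl, ← integral_condExp hm]
  rw [integral_congr_ae (g := fun _ => 0)]
  · simp
  · filter_upwards [h0, h1] with x hx hx1
    rw [hx1]; simp [← hx]

lemma frozen (P : ℕ → Prop) (hP : ∀ i, P (i+1) → P i) (n : ℕ) :
    ∃ k ≤ n, (∀ i < n, P i ↔ i < k) := by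
  induction n with
  | zero => exact ⟨0, le_rfl, by simp⟩
  | succ n ih =>
    obtain ⟨k, hk, h⟩ := ih
    by_cases hn : P n
    · refine ⟨n+1, le_rfl, fun i hi => ⟨fun _ => hi, fun _ => ?_⟩⟩
      exact (antitone_nat_of_succ_le (f := P) hP) (Nat.lt_succ_iff.1 hi) hn
    · refine ⟨k, by omega, fun i hi => ?_⟩
      rcases Nat.lt_succ_iff_lt_or_eq.1 hi with h' | h'
      · exact h i h'
      · subst h'
        exact ⟨fun h => absurd h hn, fun h => by omega⟩

lemma frozen_sum {P : ℕ → Prop} [DecidablePred P] {n k : ℕ} (hk : k ≤ n) (h : ∀ i < n, P i ↔ i < k) (x : ℕ → ℝ) :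
    ∑ i ∈ Finset.range n, (if P i then (1:ℝ) else 0) * x i = ∑ i ∈ Finset.range k, x i := by
  have : ∑ i ∈ Finset.range n, (if P i then (1:ℝ) else 0) * x i
      = ∑ i ∈ Finset.range n, (if i < k then x i else 0) := by
    apply Finset.sum_congr rfl
    intro i hi
    by_cases h' : i < k
    · simp [h', (h i (Finset.mem_range.1 hi)).2 h']
    · simp [h', mt (h i (Finset.mem_range.1 hi)).1 h']
  rw [this, ← Finset.sum_filter]
  congr 1
  ext i; simp; omega

variable {α : Type*} {m0 : MeasurableSpace α} {μ : Measure α} [IsProbabilityMeasure μ]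

lemma doob_discrete {F : ℕ → MeasurableSpace α} (hF : ∀ i, F i ≤ m0) (hmono : Monotone F)
    {d : ℕ → α → ℝ} {B : ℝ} {n : ℕ} (hB : ∀ i < n, ∀ x, |d i x| ≤ B)
    (hd : ∀ i < n, Measurable[F (i+1)] (d i))
    (hz : ∀ i < n, ∀ A, MeasurableSet[F i] A → ∫ x in A, d i x ∂μ = 0) {a : ℝ} (ha : 0 < a) :
    a ^ 2 * μ.real {x | ∃ i ≤ n, a ≤ |∑ i' ∈ Finset.range i, d i' x|} ≤
      ∑ i ∈ Finset.range n, ∫ x, (d i x) ^ 2 ∂μ := by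
  set Y : ℕ → α → ℝ := fun k x => ∑ i ∈ Finset.range k, d i x with hY
  set P : ℕ → α → Prop := fun i x => ∀ i' ≤ i, |Y i' x| < a with hPdef
  have hPmono : ∀ x i, P (i+1) x → P i x := fun x i h i' hi' => h i' (by omega)
  have hYm : ∀ k ≤ n, Measurable[F k] (Y k) := by
    intro k hk
    refine @Finset.measurable_fun_sum _ _ _ _ _ _ (F k) _ _ fun i hi => ?_
    have := Finset.mem_range.1 hi
    exact (hd i (by omega)).mono (hmono (show i + 1 ≤ k by omega)) le_rfl
  have hPm : ∀ i ≤ n, MeasurableSet[F i] {x | P i x} := by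
    intro i hi
    simp only [hPdef, ofPred_forall]
    refine @MeasurableSet.iInter _ _ (F i) _ _ fun k => @MeasurableSet.iInter _ _ (F i) _ _ fun hk => ?_
    have h1 : Measurable[F i] (Y k) := (hYm k (by omega)).mono (hmono hk) le_rfl
    exact mlt (m := F i) (measurable_norm.comp h1) (mconst (m := F i) _)
  set e : ℕ → α → ℝ := fun i x => (if P i x then (1:ℝ) else 0) with he
  have hem : ∀ i ≤ n, Measurable[F i] (e i) := fun i hi =>
    mind (m := F i) (hPm i hi)
  have he1 : ∀ i x, |e i x| ≤ 1 := fun i x => by simp only [he]; split_ifs <;> simp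
  set Y' : ℕ → α → ℝ := fun k x => ∑ i ∈ Finset.range k, e i x * d i x with hY'
  have hY'm : ∀ k ≤ n, Measurable[F k] (Y' k) := by
    intro k hk
    refine @Finset.measurable_fun_sum _ _ _ _ _ _ (F k) _ _ fun i hi => ?_
    have := Finset.mem_range.1 hi
    exact mmul (m := F k) ((hem i (by omega)).mono (hmono (show i ≤ k by omega)) le_rfl)
      ((hd i (by omega)).mono (hmono (show i + 1 ≤ k by omega)) le_rfl)
  have hB0 : ∀ k ≤ n, ∀ x, |Y' k x| ≤ k * B := by
    intro k hk x
    refine (Finset.abs_sum_le_sum_abs _ _).trans ?_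
    calc _ ≤ ∑ i ∈ Finset.range k, B := by
          refine Finset.sum_le_sum fun i hi => ?_
          rw [abs_mul]
          have h1 := he1 i x
          have h2 := hB i (by have := Finset.mem_range.1 hi; omega) x
          have := abs_nonneg (d i x)
          have := abs_nonneg (e i x)
          nlinarith
      _ = k * B := by simp
  have bint : ∀ {f : α → ℝ} {C : ℝ}, Measurable f → (∀ x, |f x| ≤ C) → Integrable f μ :=
    fun hf hC => Integrable.of_bound hf.aestronglyMeasurable _ (Eventually.of_forall hC)
  have key : ∀ k ≤ n, ∫ x, (Y' k x)^2 ∂μ ≤ ∑ i ∈ Finset.range k, ∫ x, (d i x) ^ 2 ∂μ := by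
    intro k
    induction k with
    | zero => intro _; simp [hY']
    | succ k ih =>
      intro hk
      rw [Finset.sum_range_succ]
      have hdk : Integrable (d k) μ := bint ((hd k (by omega)).mono (hF _) le_rfl) (hB k (by omega))
      have hcm2 : Measurable[F k] (fun x => 2 * Y' k x * e k x) := by
        have q1 : Measurable[F k] (fun x => 2 * Y' k x) := mmul (m := F k) (mconst (m := F k) 2) (hY'm k (by omega))
        exact mmul (m := F k) q1 (hem k (by omega))
      have h1 := int_mul_zero (hF k) hdk (hz k (by omega)) (c := fun x => 2 * Y' k x * e k x)
        hcm2
        (C := 2 * (k * B)) (fun x => by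
          rw [abs_mul, abs_mul, abs_of_pos (two_pos : (0:ℝ) < 2)]
          have h1 := he1 k x
          have h2 := hB0 k (by omega) x
          have := abs_nonneg (Y' k x)
          have := abs_nonneg (e k x)
          nlinarith)
      have h2 : Integrable (fun x => (Y' k x)^2) μ :=
        bint (C := (k*B)^2) (((hY'm k (by omega)).mono (hF _) le_rfl).pow_const 2) (fun x => by
          rw [abs_pow]; gcongr; exact hB0 k (by omega) x)
      have h3 : Integrable (fun x => (d k x)^2) μ :=
        bint (C := B^2) (((hd k (by omega)).mono (hF _) le_rfl).pow_const 2) (fun x => by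
          rw [abs_pow]; gcongr; exact hB k (by omega) x)
      calc ∫ x, (Y' (k+1) x)^2 ∂μ
          ≤ ∫ x, ((Y' k x)^2 + 2 * Y' k x * e k x * d k x + (d k x)^2) ∂μ := by
            have h4 : Integrable (fun x => (Y' (k+1) x)^2) μ :=
              bint (C := ((k+1:ℕ)*B)^2) (((hY'm (k+1) (by omega)).mono (hF _) le_rfl).pow_const 2)
                (fun x => by
                  rw [abs_pow]; gcongr; exact hB0 (k+1) (by omega) x)
            refine integral_mono h4 ((h2.add h1.1).add h3) fun x => ?_
            simp only [hY', Finset.sum_range_succ]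
            have : (e k x)^2 ≤ 1 := by
              rw [← sq_abs]; nlinarith [he1 k x, abs_nonneg (e k x)]
            nlinarith [sq_nonneg (d k x)]
        _ = ∫ x, (Y' k x)^2 ∂μ + ∫ x, (d k x)^2 ∂μ := by
            have q1 : Integrable (fun x => (Y' k x)^2 + 2 * Y' k x * e k x * d k x) μ := h2.add h1.1
            rw [integral_add q1 h3, integral_add h2 h1.1, h1.2, add_zero]
        _ ≤ _ := by gcongr; exact ih (by omega)
  refine le_trans ?_ (key n le_rfl)
  have hint : Integrable (fun x => (Y' n x)^2) μ :=
        bint (C := (n*B)^2) (((hY'm n le_rfl).mono (hF _) le_rfl).pow_const 2) (fun x => by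
          rw [abs_pow]; gcongr; exact hB0 n le_rfl x)
  have hmk := mul_meas_ge_le_integral_of_nonneg (Eventually.of_forall fun x => sq_nonneg (Y' n x))
    hint (a^2)
  refine le_trans ?_ hmk
  refine mul_le_mul_of_nonneg_left (measureReal_mono ?_ (measure_ne_top _ _)) (sq_nonneg a)
  · rintro x ⟨i, hi, hai⟩
    obtain ⟨k, hkn, hk⟩ := frozen (fun i => P i x) (hPmono x) n
    have e1 : Y' n x = Y k x := frozen_sum hkn hk (fun i => d i x)
    show a^2 ≤ (Y' n x)^2
    rw [e1, ← sq_abs (Y k x)]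
    gcongr
    by_contra hc
    push Not at hc
    have hall : ∀ i' ≤ k, |Y i' x| < a := by
      intro i' hi'
      rcases hi'.lt_or_eq with h | h
      · exact (hk i' (by omega)).2 h i' le_rfl
      · rwa [h]
    have hik : k < i := by
      by_contra h; exact absurd (hall i (by omega)) (not_lt.2 hai)
    exact absurd ((hk k (by omega)).1 hall) (lt_irrefl k)

lemma weak_discrete {F : ℕ → MeasurableSpace α} (hF : ∀ i, F i ≤ m0) (hmono : Monotone F)
    {X c : ℕ → α → ℝ} {n : ℕ} {C N R lam ε : ℝ} (hC0 : 0 ≤ C) (hN : 0 ≤ N) (hR : 0 ≤ R)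
    (hlam : 0 ≤ lam) (hε : 0 ≤ ε)
    (hc : ∀ i < n, ∀ x, |c i x| ≤ C)
    (hcm : ∀ i < n, Measurable[F i] (c i)) (hXm : ∀ i ≤ n, Measurable[F i] (X i))
    (hXi : ∀ i ≤ n, Integrable (X i) μ)
    (hz : ∀ i < n, ∀ A, MeasurableSet[F i] A → ∫ x in A, (X (i+1) x - X i x) ∂μ = 0) :
    ∃ G : α → ℝ, Measurable G ∧ (∀ x, 0 ≤ G x) ∧ Integrable G μ ∧
      ∫ x, G x ∂μ ≤ lam + ε + C * (N + R) + C * ∫ x, max (|X n x| - R) 0 ∂μ ∧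
      (∀ x δ, 0 ≤ δ → (∀ i < n, |X (i+1) x - X i x| ≤ δ) → C * (N + R) - C * δ ≤ G x) ∧
      (∀ x, (∀ i ≤ n, -ε ≤ lam + ∑ i' ∈ Finset.range i, c i' x * (X (i'+1) x - X i' x) ∧
        |X i x| ≤ N) → lam + ∑ i' ∈ Finset.range n, c i' x * (X (i'+1) x - X i' x) + ε +
          C * (N + R) ≤ G x) := by
  set D : ℕ → α → ℝ := fun k x => lam + ∑ i ∈ Finset.range k, c i x * (X (i+1) x - X i x) with hD
  set P : ℕ → α → Prop := fun i x => ∀ i' ≤ i, -ε ≤ D i' x ∧ |X i' x| ≤ N with hPdef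
  have hPmono : ∀ x i, P (i+1) x → P i x := fun x i h i' hi' => h i' (by omega)
  have hΔm : ∀ i < n, ∀ k ≥ i + 1, Measurable[F k] (fun x => X (i+1) x - X i x) := fun i hi k hk =>
    msub (m := F k) ((hXm (i+1) (by omega)).mono (hmono hk) le_rfl)
      ((hXm i (by omega)).mono (hmono (show i ≤ k by omega)) le_rfl)
  have hDm : ∀ k ≤ n, Measurable[F k] (D k) := by
    intro k hk
    refine madd (m := F k) (mconst (m := F k) _)
      (@Finset.measurable_fun_sum _ _ _ _ _ _ (F k) _ _ fun i hi => ?_)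
    have := Finset.mem_range.1 hi
    exact mmul (m := F k) ((hcm i (by omega)).mono (hmono (show i ≤ k by omega)) le_rfl)
      (hΔm i (by omega) k (by omega))
  have hPm : ∀ i ≤ n, MeasurableSet[F i] {x | P i x} := by
    intro i hi
    simp only [hPdef, ofPred_forall]
    refine @MeasurableSet.iInter _ _ (F i) _ _ fun k => @MeasurableSet.iInter _ _ (F i) _ _ fun hk => ?_
    have h1 : Measurable[F i] (D k) := (hDm k (hk.trans hi)).mono (hmono hk) le_rfl
    have h2 : Measurable[F i] (X k) := (hXm k (hk.trans hi)).mono (hmono hk) le_rfl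
    exact @MeasurableSet.inter _ (F i) _ _
      (mle (m := F i) (mconst (m := F i) _) h1)
      (mle (m := F i) (measurable_norm.comp h2)
        (mconst (m := F i) _))
  set e : ℕ → α → ℝ := fun i x => (if P i x then (1:ℝ) else 0) with he
  have hem : ∀ i ≤ n, Measurable[F i] (e i) := fun i hi =>
    mind (m := F i) (hPm i hi)
  have he1 : ∀ i x, |e i x| ≤ 1 := fun i x => by simp only [he]; split_ifs <;> simp
  have he2 : ∀ i x, |1 - e i x| ≤ 1 := fun i x => by simp only [he]; split_ifs <;> simp
  set D' : ℕ → α → ℝ := fun k x => lam + ∑ i ∈ Finset.range k,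
    e i x * (c i x * (X (i+1) x - X i x)) with hD'
  set X' : ℕ → α → ℝ := fun k x => X 0 x + ∑ i ∈ Finset.range k,
    e i x * (X (i+1) x - X i x) with hX'
  have hX'm : ∀ k ≤ n, Measurable[F k] (X' k) := by
    intro k hk
    refine madd (m := F k) ((hXm 0 (by omega)).mono (hmono (show 0 ≤ k by omega)) le_rfl)
      (@Finset.measurable_fun_sum _ _ _ _ _ _ (F k) _ _ fun i hi => ?_)
    have := Finset.mem_range.1 hi
    exact mmul (m := F k) ((hem i (by omega)).mono (hmono (show i ≤ k by omega)) le_rfl)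
      (hΔm i (by omega) k (by omega))
  have hfr : ∀ x, ∃ k ≤ n, (∀ i < n, P i x ↔ i < k) ∧ D' n x = D k x ∧ X' n x = X k x ∧
      (∀ i ≤ n, k ≤ i → X' i x = X k x) := by
    intro x
    obtain ⟨k, hkn, hk⟩ := frozen (fun i => P i x) (hPmono x) n
    have aux : ∀ i ≤ n, k ≤ i → X' i x = X k x := by
      intro i hi hki
      simp only [hX']
      rw [frozen_sum (P := fun i => P i x) hki (fun i' hi' => hk i' (by omega))
        (fun i => X (i+1) x - X i x), Finset.sum_range_sub (fun i => X i x)]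
      ring
    refine ⟨k, hkn, hk, ?_, aux n le_rfl hkn, aux⟩
    simp only [hD', hD]
    rw [frozen_sum (P := fun i => P i x) hkn hk (fun i => c i x * (X (i+1) x - X i x))]
  set G : α → ℝ := fun x => D' n x + ε + C * (N + R) + C * max (|X' n x| - R) 0 with hG
  have hΔi : ∀ i < n, Integrable (fun x => X (i+1) x - X i x) μ := fun i hi =>
    (hXi (i+1) (by omega)).sub (hXi i (by omega))
  -- expectation of D'
  have hD'1 : ∀ i ∈ Finset.range n, Integrable (fun x => e i x * (c i x * (X (i+1) x - X i x))) μ ∧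
      ∫ x, e i x * (c i x * (X (i+1) x - X i x)) ∂μ = 0 := by
    intro i hi
    have hi := Finset.mem_range.1 hi
    have := int_mul_zero (hF i) (hΔi i hi) (hz i hi) (c := fun x => e i x * c i x)
      (mmul (m := F i) (hem i hi.le) (hcm i hi)) (C := C) (fun x => by
        rw [abs_mul]
        nlinarith [he1 i x, hc i hi x, abs_nonneg (e i x), abs_nonneg (c i x)])
    simpa only [mul_assoc] using this
  have hD'i : Integrable (D' n) μ :=
    (integrable_const lam).add (integrable_finsetSum _ fun i hi => (hD'1 i hi).1)
  have hD'E : ∫ x, D' n x ∂μ = lam := by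
    simp only [hD']
    rw [integral_add (integrable_const lam) (integrable_finsetSum _ fun i hi => (hD'1 i hi).1),
      integral_finsetSum _ (fun i hi => (hD'1 i hi).1),
      Finset.sum_eq_zero (fun i hi => (hD'1 i hi).2)]
    simp
  have hX'i : Integrable (X' n) μ := by
    refine (hXi 0 (by omega)).add (integrable_finsetSum _ fun i hi => ?_)
    have hi := Finset.mem_range.1 hi
    exact (int_mul_zero (hF i) (hΔi i hi) (hz i hi) (hem i hi.le) (he1 i)).1
  have hmaxi : ∀ {f : α → ℝ}, Integrable f μ → Integrable (fun x => max (|f x| - R) 0) μ :=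
    fun hf => (hf.abs.sub (integrable_const R)).sup (integrable_zero _ _ _)
  -- convexity
  set s : ℝ → ℝ := fun y => if R < y then 1 else if y < -R then -1 else 0 with hs
  have hsm : Measurable s := Measurable.ite measurableSet_Ioi measurable_const
    (Measurable.ite measurableSet_Iio measurable_const measurable_const)
  have hs1 : ∀ y, |s y| ≤ 1 := fun y => by simp only [hs]; split_ifs <;> simp
  have hsub : ∀ x y, max (|x| - R) 0 + s x * (y - x) ≤ max (|y| - R) 0 := by
    intro x y
    simp only [hs]
    split_ifs with h1 h2
    · rw [abs_of_pos (by linarith), max_eq_left (by linarith)]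
      refine le_trans ?_ (le_max_left _ _)
      linarith [le_abs_self y]
    · rw [abs_of_neg (by linarith), max_eq_left (by linarith)]
      refine le_trans ?_ (le_max_left _ _)
      linarith [neg_abs_le y]
    · rw [max_eq_right]
      · simp
      · have : |x| ≤ R := abs_le.2 ⟨by linarith, by linarith⟩
        linarith
  have hsz : ∀ i ∈ Finset.range n, Integrable (fun x => (s (X' i x) * (1 - e i x)) *
      (X (i+1) x - X i x)) μ ∧
      ∫ x, (s (X' i x) * (1 - e i x)) * (X (i+1) x - X i x) ∂μ = 0 := by
    intro i hi
    have hi := Finset.mem_range.1 hi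
    refine int_mul_zero (hF i) (hΔi i hi) (hz i hi) (c := fun x => s (X' i x) * (1 - e i x))
      (mmul (m := F i) (hsm.comp (hX'm i hi.le))
        (msub (m := F i) (mconst (m := F i) _) (hem i hi.le)))
      (C := 1) (fun x => by
        rw [abs_mul]
        nlinarith [he2 i x, hs1 (X' i x), abs_nonneg (s (X' i x)), abs_nonneg (1 - e i x)])
  have hconv : ∫ x, max (|X' n x| - R) 0 ∂μ ≤ ∫ x, max (|X n x| - R) 0 ∂μ := by
    have h1 : ∀ x, max (|X' n x| - R) 0 + ∑ i ∈ Finset.range n, (s (X' i x) * (1 - e i x)) *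
      (X (i+1) x - X i x) ≤ max (|X n x| - R) 0 := by
      intro x
      refine le_trans (le_of_eq ?_) (hsub (X' n x) (X n x))
      congr 1
      have h2 : X n x - X' n x = ∑ i ∈ Finset.range n, (1 - e i x) * (X (i+1) x - X i x) := by
        have : X n x = X 0 x + ∑ i ∈ Finset.range n, (X (i+1) x - X i x) := by
          rw [Finset.sum_range_sub (fun i => X i x)]; ring
        rw [this]
        simp only [hX', sub_mul, one_mul, Finset.sum_sub_distrib]
        ring
      rw [h2, Finset.mul_sum]
      apply Finset.sum_congr rfl
      intro i hi
      have hi := Finset.mem_range.1 hi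
      obtain ⟨k, hkn, hk, -, h3, h4⟩ := hfr x
      by_cases hp : P i x
      · simp [he, hp]
      · have : k ≤ i := not_lt.1 (mt (hk i hi).2 hp)
        rw [h3, h4 i hi.le this]; ring
    calc ∫ x, max (|X' n x| - R) 0 ∂μ = ∫ x, (max (|X' n x| - R) 0 + ∑ i ∈ Finset.range n,
          (s (X' i x) * (1 - e i x)) * (X (i+1) x - X i x)) ∂μ := by
          rw [integral_add (hmaxi hX'i) (integrable_finsetSum _ fun i hi => (hsz i hi).1),
            integral_finsetSum _ (fun i hi => (hsz i hi).1),
            Finset.sum_eq_zero (fun i hi => (hsz i hi).2), add_zero]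
      _ ≤ _ := integral_mono ((hmaxi hX'i).add (integrable_finsetSum _ fun i hi => (hsz i hi).1))
          (hmaxi (hXi n le_rfl)) h1
  have hlow : ∀ x, ∀ k ≤ n, (∀ i < n, P i x ↔ i < k) → ∀ δ ≥ 0,
      (∀ i < n, i + 1 = k → |X (i+1) x - X i x| ≤ δ) → -ε - C * δ ≤ D k x := by
    intro x k hkn hk δ hδ h
    rcases Nat.eq_zero_or_pos k with h0 | h0
    · subst h0; simp only [hD, Finset.range_zero, Finset.sum_empty]; nlinarith
    · obtain ⟨i, rfl⟩ : ∃ i, k = i + 1 := ⟨k - 1, by omega⟩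
      have h1 := ((hk i (by omega)).2 (by omega)) i le_rfl
      have h2 := h i (by omega) rfl
      have h3 := hc i (by omega) x
      have h4 : D (i+1) x = D i x + c i x * (X (i+1) x - X i x) := by
        simp only [hD, Finset.sum_range_succ]; ring
      have h5 : |c i x * (X (i+1) x - X i x)| ≤ C * δ := by
        rw [abs_mul]; gcongr
      linarith [(abs_le.1 h5).1, h1.1]
  refine ⟨G, ?_, ?_, ?_, ?_, ?_, ?_⟩
  · have h1 : Measurable (D' n) := by
      refine measurable_const.add (Finset.measurable_fun_sum _ fun i hi => ?_)
      have hi := Finset.mem_range.1 hi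
      exact ((hem i hi.le).mono (hF _) le_rfl).mul (((hcm i hi).mono (hF _) le_rfl).mul
        ((hΔm i hi (i+1) le_rfl).mono (hF _) le_rfl))
    have h2 : Measurable (X' n) := (hX'm n le_rfl).mono (hF _) le_rfl
    exact ((h1.add measurable_const).add measurable_const).add (measurable_const.mul
      (((measurable_norm.comp h2).sub measurable_const).max measurable_const))
  · intro x
    obtain ⟨k, hkn, hk, h1, h2, h3⟩ := hfr x
    have := hlow x k hkn hk (N + |X k x|) (by positivity) (fun i hi hik => by
      have hPi := ((hk i hi).2 (by omega)) i le_rfl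
      subst hik
      have := abs_sub (X (i+1) x) (X i x)
      linarith [hPi.2])
    simp only [hG, h1, h2]
    have h4 : |X k x| ≤ R + max (|X k x| - R) 0 := by linarith [le_max_left (|X k x| - R) 0]
    nlinarith
  · exact ((hD'i.add (integrable_const _)).add (integrable_const _)).add
      ((hmaxi hX'i).const_mul C)
  · simp only [hG]
    have q1 : Integrable (fun x => D' n x + ε) μ := hD'i.add (integrable_const _)
    have q2 : Integrable (fun x => D' n x + ε + C * (N + R)) μ := q1.add (integrable_const _)
    rw [integral_add q2 ((hmaxi hX'i).const_mul C), integral_add q1 (integrable_const _),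
      integral_add hD'i (integrable_const _), hD'E, integral_const_mul C (fun x => max (|X' n x| - R) 0)]
    simp only [integral_const, probReal_univ, one_smul]
    gcongr
  · intro x δ hδ h
    obtain ⟨k, hkn, hk, h1, h2, h3⟩ := hfr x
    have := hlow x k hkn hk δ hδ (fun i hi _ => h i hi)
    simp only [hG, h1]
    have : 0 ≤ C * max (|X' n x| - R) 0 := mul_nonneg hC0 (le_max_right _ _)
    linarith
  · intro x h
    obtain ⟨k, hkn, hk, h1, h2, h3⟩ := hfr x
    have hkk : k = n := by
      by_contra hne
      have := (hk k (by omega)).1 (fun i' hi' => h i' (by omega))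
      omega
    simp only [hG, h1, hkk]
    have : 0 ≤ C * max (|X' n x| - R) 0 := mul_nonneg hC0 (le_max_right _ _)
    simp only [hD]
    linarith

end Disc

end Part3

section Part4

section Weak
variable {T : ℝ} {hT : 0 ≤ T}

lemma mIic {α : Type*} {m : MeasurableSpace α} {f : α → ℝ}
    (h : ∀ x, MeasurableSet (f ⁻¹' Iic x)) : Measurable f := measurable_of_Iic h

lemma Fplus_le {q u : ℝ} (hq : q < u) (hu : u ≤ T) : Fplus T q ≤ Fraw T u := by
  have := iInf₂_le (f := fun (s : ℝ) (_ : q < s) => Fraw T (min s T)) u hq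
  simpa [Fplus, min_eq_left hu] using this

lemma Fplus_le_borel (q : ℝ) : Fplus T q ≤ borel (Path T) := by
  have := iInf₂_le (f := fun (s : ℝ) (_ : q < s) => Fraw T (min s T)) (q+1) (by linarith)
  exact this.trans (Fraw_le _)

lemma lt_union {τ : Path T → ℝ} (h0 : ∀ ω, 0 ≤ τ ω) (A : Set (Path T)) (u : ℝ) :
    A ∩ {ω | τ ω < u} = ⋃ (q : ℚ) (_ : (0:ℝ) ≤ q ∧ (q:ℝ) < u), (A ∩ {ω | τ ω ≤ q}) := by
  ext ω
  simp only [Set.mem_inter_iff, mem_ofPred_eq, Set.mem_iUnion, exists_prop]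
  constructor
  · rintro ⟨h1, h2⟩
    obtain ⟨q, hq1, hq2⟩ := exists_rat_btwn h2
    exact ⟨q, ⟨(h0 ω).trans hq1.le, hq2⟩, h1, hq1.le⟩
  · rintro ⟨q, ⟨_, h2⟩, h1, h3⟩
    exact ⟨h1, h3.trans_lt h2⟩

lemma inter_lt_meas {τ : Path T → ℝ} (h0 : ∀ ω, 0 ≤ τ ω) {A : Set (Path T)}
    (hA : ∀ t ∈ Set.Icc (0:ℝ) T, MeasurableSet[Fplus T t] (A ∩ {ω | τ ω ≤ t}))
    {u : ℝ} (hu : u ∈ Set.Icc 0 T) : MeasurableSet[Fraw T u] (A ∩ {ω | τ ω < u}) := by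
  rw [lt_union h0]
  refine @MeasurableSet.iUnion _ _ (Fraw T u) _ _ fun q => @MeasurableSet.iUnion _ _ (Fraw T u) _ _
    fun hq => ?_
  exact Fplus_le hq.2 hu.2 _ (hA q ⟨hq.1, hq.2.le.trans hu.2⟩)

lemma lt_meas {τ : Path T → ℝ} (h0 : ∀ ω, 0 ≤ τ ω) (hτ : IsStopPlus T τ)
    {u : ℝ} (hu : u ∈ Set.Icc 0 T) : MeasurableSet[Fraw T u] {ω | τ ω < u} := by
  have := inter_lt_meas h0 (A := Set.univ) (fun t ht => by rw [Set.univ_inter]; exact hτ t ht) hu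
  rwa [Set.univ_inter] at this

lemma theta_meas (H : SimpleStrategy T) {u : ℝ} (hu : u ∈ Set.Icc 0 T) :
    Measurable[Fraw T u] (fun ω => theta H ω u) := by
  unfold theta
  refine @Finset.measurable_fun_sum _ _ _ _ _ _ (Fraw T u) _ _ fun l _ => ?_
  have h0 := strat_nonneg H
  have e : (fun ω => H.coeff l ω * ((if u ≤ H.τ l.succ ω then (1:ℝ) else 0)
    - (if u ≤ H.τ l.castSucc ω then 1 else 0))) =
    fun ω => (if H.τ l.castSucc ω < u then H.coeff l ω else 0) *
      (1 - if H.τ l.succ ω < u then (1:ℝ) else 0) := by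
    funext ω
    have := H.τ_mono l ω
    by_cases h1 : H.τ l.castSucc ω < u <;> by_cases h2 : H.τ l.succ ω < u
    · simp [h1, h2, not_le.2 h1, not_le.2 h2]
    · simp [h1, h2, not_le.2 h1, not_lt.1 h2]
    · exact absurd (this.trans_lt h2) h1
    · simp [h1, h2, not_lt.1 h1, not_lt.1 h2]
  rw [e]
  refine mmul (m := Fraw T u) ?_ (msub (m := Fraw T u) (mconst (m := Fraw T u) 1)
    (mind (m := Fraw T u) (lt_meas (h0 _) (SimpleStrategy.τ_stop H _) hu)))
  intro B hB
  have hs := lt_meas (h0 l.castSucc) (SimpleStrategy.τ_stop H _) hu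
  have e2 : (fun ω => if H.τ l.castSucc ω < u then H.coeff l ω else 0) ⁻¹' B =
    (H.coeff l ⁻¹' B ∩ {ω | H.τ l.castSucc ω < u}) ∪
      ({ω | H.τ l.castSucc ω < u}ᶜ ∩ {ω | (0:ℝ) ∈ B}) := by
    ext ω
    by_cases h : H.τ l.castSucc ω < u <;> simp [h]
  rw [e2]
  exact @MeasurableSet.union _ (Fraw T u) _ _
    (inter_lt_meas (h0 _) (fun t ht => H.coeff_meas l B hB t ht) hu)
    (@MeasurableSet.inter _ (Fraw T u) _ _ (@MeasurableSet.compl _ _ (Fraw T u) hs)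
      (@MeasurableSet.const _ (Fraw T u) _))

lemma theta_bdd (H : SimpleStrategy T) : ∃ C : ℝ, 0 ≤ C ∧ ∀ ω u, |theta H ω u| ≤ C := by
  choose C hC using H.coeff_bdd
  refine ⟨∑ l, |C l|, by positivity, fun ω u => ?_⟩
  refine (Finset.abs_sum_le_sum_abs _ _).trans (Finset.sum_le_sum fun l _ => ?_)
  rw [abs_mul]
  have h1 := (hC l ω).trans (le_abs_self _)
  have h2 : |(if u ≤ H.τ l.succ ω then (1:ℝ) else 0) - (if u ≤ H.τ l.castSucc ω then 1 else 0)| ≤ 1 := by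
    split_ifs <;> simp
  nlinarith [abs_nonneg (H.coeff l ω)]

lemma tau_borel (H : SimpleStrategy T) (l) : Measurable (H.τ l) := by
  refine measurable_of_Iic fun x => ?_
  by_cases hx : x ∈ Set.Icc 0 T
  · exact BorelSpace.measurable_eq (α := Path T) ▸ Fplus_le_borel x _ (SimpleStrategy.τ_stop H l x hx)
  · by_cases h0 : x < 0
    · convert MeasurableSet.empty
      ext ω; simpa using h0.trans_le (strat_nonneg H l ω)
    · convert MeasurableSet.univ
      ext ω
      have : T < x := by by_contra h; exact hx ⟨not_lt.1 h0, not_lt.1 h⟩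
      simpa using (strat_le H l ω).trans this.le

lemma coeff_borel (hT : 0 ≤ T) (H : SimpleStrategy T) (l) : Measurable (H.coeff l) := by
  intro B hB
  have := Fplus_le_borel T _ (H.coeff_meas l B hB T ⟨hT, le_rfl⟩)
  rw [show H.coeff l ⁻¹' B ∩ {ω | H.τ l.castSucc ω ≤ T} = H.coeff l ⁻¹' B from
    Set.inter_eq_left.2 fun ω _ => strat_le H _ ω] at this
  exact BorelSpace.measurable_eq (α := Path T) ▸ this

lemma integ_borel (H : SimpleStrategy T) {X : ℝ → Path T → ℝ}
    (hX : ∀ s : Path T → ℝ, Measurable s → (∀ ω, s ω ≤ T) → Measurable fun ω => X (s ω) ω)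
    (hT : 0 ≤ T) {s : Path T → ℝ} (hs : Measurable s) :
    Measurable fun ω => integ T H X (s ω) ω := by
  unfold integ
  refine Finset.measurable_fun_sum _ fun l _ => (coeff_borel hT H l).mul ((hX _ ?_ ?_).sub (hX _ ?_ ?_))
  · exact (tau_borel H _).min hs
  · exact fun ω => (min_le_left _ _).trans (strat_le H _ ω)
  · exact (tau_borel H _).min hs
  · exact fun ω => (min_le_left _ _).trans (strat_le H _ ω)

lemma genInteg_borel (HG : SimpleStrategy T × SimpleStrategy T) {s : Path T → ℝ}
    (hs : Measurable s) : Measurable fun ω => genInteg T hT HG (s ω) ω :=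
  (integ_borel HG.1 (fun _ hs _ => meas_ev measurable_id hs) hT hs).add
    (integ_borel HG.2 (fun _ hs h => SS_meas measurable_id hs h) hT hs)

lemma ev_min_clamp (ω : Path T) (τ : ℝ) {g : ℝ} (hg : g ∈ Set.Icc 0 T) :
    ev T hT ω (min τ g) = ev T hT ω (min g (clamp T hT τ).1) := by
  unfold ev
  congr 1
  unfold clamp
  apply Subtype.ext
  simp only [Set.coe_projIcc]
  rcases hg with ⟨h1, h2⟩
  rcases le_total τ 0 with h | h
  · rw [min_eq_left (h.trans h1), min_eq_right (h.trans hT), max_eq_left h]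
    simp [h1, hT]
  · rw [max_eq_right (le_min hT h), max_eq_right (le_min hT (le_min h1 (le_min hT h)))]
    rcases le_total τ T with h' | h'
    · rw [min_eq_right h', min_comm τ]
      exact max_eq_right (le_min hT (le_min h1 h))
    · rw [min_eq_left h', min_eq_left h2, min_eq_right (h2.trans h')]
      exact max_eq_right (le_min hT h1)

lemma stopped_clamp_meas {τ : Path T → ℝ} (hτ : IsStopRaw T τ) {u : ℝ} (hu : u ∈ Set.Icc 0 T) :
    Measurable[Fraw T u] (fun ω => min u (clamp T hT (τ ω)).1) := by
  refine mIic (m := Fraw T u) fun x => ?_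
  have e : (fun ω => min u (clamp T hT (τ ω)).1) ⁻¹' Iic x =
      if u ≤ x then Set.univ else if x < 0 then ∅ else {ω | τ ω ≤ x} := by
    ext ω
    simp only [Set.mem_preimage, Set.mem_Iic, clamp, Set.coe_projIcc]
    split_ifs with h1 h2
    · simp [h1]
    · simp only [Set.mem_empty_iff_false, iff_false, not_le]
      exact h2.trans_le (le_min hu.1 (le_max_left _ _))
    · have h3 : ¬ T ≤ x := fun h => h1 (hu.2.trans h)
      simp [h1, h3, not_lt.1 h2]
  rw [e]
  split_ifs with h1 h2
  · exact @MeasurableSet.univ _ (Fraw T u)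
  · exact @MeasurableSet.empty _ (Fraw T u)
  · exact Fraw_mono (not_le.1 h1).le _ (hτ x ⟨not_lt.1 h2, (not_le.1 h1).le.trans hu.2⟩)

lemma clamp_borel {τ : Path T → ℝ} (hτ : IsStopRaw T τ) :
    Measurable (fun ω => (clamp T hT (τ ω)).1) := by
  have h := stopped_clamp_meas (hT := hT) hτ (u := T) ⟨hT, le_rfl⟩
  have := h.mono (Fraw_le T) le_rfl
  rw [← BorelSpace.measurable_eq (α := Path T)] at this
  suffices e : (fun ω => (clamp T hT (τ ω)).1) = fun ω => min T (clamp T hT (τ ω)).1 by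
    rw [e]; exact this
  funext ω
  exact (min_eq_right (clamp T hT (τ ω)).2.2).symm

lemma stopped_meas {τ : Path T → ℝ} (hτ : IsStopRaw T τ) {u : ℝ} (hu : u ∈ Set.Icc 0 T) :
    Measurable[Fraw T u] (fun ω => Sproc T hT (min (τ ω) u) ω) := by
  have h1 := stopped_clamp_meas (hT := hT) hτ hu
  have h2 := Fraw_stop hT ⟨u, hu⟩
  have h3 := @meas_ev T hT (Path T) (Fraw T u) _ _ h2 h1
  suffices e : (fun ω => Sproc T hT (min (τ ω) u) ω) =
      fun ω => ev T hT (stopPath T ω ⟨u, hu⟩) (min u (clamp T hT (τ ω)).1) by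
    rw [e]; exact h3
  funext ω
  show ev T hT ω (min (τ ω) u) = _
  rw [ev_stop, ev_min_clamp _ _ hu]
  simp
end Weak

end Part4

section Part5

section Weak2
variable {T : ℝ} {hT : 0 ≤ T}

lemma Idis_partial (ω : Path T) (j : ℕ) (θ : ℝ → ℝ) (τ : ℝ) {k : ℕ} (hk : k ≤ 2^j) :
    ∑ i ∈ Finset.range k, θ (gr T j i) *
      (Sproc T hT (min τ (gr T j (i+1))) ω - Sproc T hT (min τ (gr T j i)) ω) =
    Idis T hT ω j θ (min (clamp T hT τ).1 (gr T j k)) := by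
  unfold Idis
  have hsub : Finset.range k ⊆ Finset.range (2^j) := by
    intro i; simp only [Finset.mem_range]; omega
  rw [← Finset.sum_subset hsub]
  · refine Finset.sum_congr rfl fun i hi => ?_
    have hi := Finset.mem_range.1 hi
    unfold Sproc
    rw [ev_min_clamp _ _ (gr_mem hT (show i + 1 ≤ 2^j by omega)),
      ev_min_clamp _ _ (gr_mem hT (show i ≤ 2^j by omega)), min_comm (clamp T hT τ).1, ← min_assoc,
      ← min_assoc, min_eq_left (gr_mono hT j (show i+1 ≤ k by omega)),
      min_eq_left (gr_mono hT j (show i ≤ k by omega))]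
  · intro i hi hi'
    simp only [Finset.mem_range, not_lt] at hi hi'
    rw [min_eq_right ((min_le_right _ _).trans (gr_mono hT j (show k ≤ i+1 by omega))),
      min_eq_right ((min_le_right _ _).trans (gr_mono hT j hi'))]
    simp

lemma integ_Sm_unif {ω : Path T} (h : ω ∈ BigOmega T hT) (G : SimpleStrategy T) {ε : ℝ}
    (hε : 0 < ε) : ∀ᶠ m in atTop, ∀ t ∈ Set.Icc 0 T,
      |integ T G (Sm T hT m) t ω - integ T G (SS T hT) t ω| ≤ ε := by
  set B := ∑ l, |G.coeff l ω| with hB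
  have hB0 : 0 ≤ B := by positivity
  have h1 := Metric.tendstoUniformly_iff.1 h.1 (ε / (2 * B + 1)) (by positivity)
  filter_upwards [h1] with m hm t ht
  have key : ∀ l, |Sm T hT m (min (G.τ l ω) t) ω - SS T hT (min (G.τ l ω) t) ω| ≤ ε / (2*B+1) := by
    intro l
    have := hm ⟨min (G.τ l ω) t, le_min (strat_nonneg G l ω) ht.1, (min_le_right _ _).trans ht.2⟩
    rw [Real.dist_eq, abs_sub_comm] at this
    exact this.le
  unfold integ
  rw [← Finset.sum_sub_distrib]
  refine (Finset.abs_sum_le_sum_abs _ _).trans ?_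
  calc _ ≤ ∑ l, |G.coeff l ω| * (2 * (ε / (2*B+1))) := by
        refine Finset.sum_le_sum fun l _ => ?_
        rw [← mul_sub, abs_mul]
        refine mul_le_mul_of_nonneg_left ?_ (abs_nonneg _)
        have h1 := abs_le.1 (key l.succ)
        have h2 := abs_le.1 (key l.castSucc)
        rw [abs_le]; constructor <;> linarith
    _ = B * (2 * (ε / (2*B+1))) := by rw [← Finset.sum_mul]
    _ = ε * ((2 * B) / (2 * B + 1)) := by ring
    _ ≤ ε * 1 := by
        gcongr; rw [div_le_one (by positivity)]; linarith
    _ = ε := mul_one _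

lemma small_incr (ω : Path T) (τ : ℝ) {δ : ℝ} (hδ : 0 < δ) : ∀ᶠ j in atTop, ∀ i < 2^j,
    |Sproc T hT (min τ (gr T j (i+1))) ω - Sproc T hT (min τ (gr T j i)) ω| ≤ δ := by
  obtain ⟨η, hη, hu⟩ := Metric.uniformContinuous_iff.1 (ev_unif (hT := hT) ω) δ hδ
  filter_upwards [(mesh_tendsto (T := T)).eventually_lt_const hη] with j hj i _
  refine (hu ?_).le
  rw [Real.dist_eq]
  have h1 := gr_mono hT j (Nat.le_succ i)
  have h2 := gr_succ (T := T) j i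
  have h3 : |min τ (gr T j (i+1)) - min τ (gr T j i)| ≤ |gr T j (i+1) - gr T j i| := by
    refine (abs_min_sub_min_le_max _ _ _ _).trans ?_
    simp
  refine h3.trans_lt ?_
  rw [h2, add_sub_cancel_left, abs_of_nonneg (by positivity)]
  exact hj

lemma excess_tendsto {α : Type*} [MeasurableSpace α] {μ : Measure α} {X : α → ℝ}
    (hX : Integrable X μ) : Tendsto (fun R : ℕ => ∫ x, max (|X x| - R) 0 ∂μ) atTop (𝓝 0) := by
  have := tendsto_integral_of_dominated_convergence (μ := μ)
    (F := fun (R : ℕ) x => max (|X x| - R) 0) (f := fun _ => 0) (fun x => |X x|) ?_ hX.abs ?_ ?_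
  · simpa using this
  · intro R
    exact (hX.aestronglyMeasurable.norm.sub aestronglyMeasurable_const).sup aestronglyMeasurable_const
  · intro R
    refine Eventually.of_forall fun x => ?_
    rw [Real.norm_eq_abs, abs_of_nonneg (le_max_right _ _)]
    exact max_le (by linarith [Nat.cast_nonneg (α := ℝ) R]) (abs_nonneg _)
  · refine Eventually.of_forall fun x => ?_
    refine tendsto_const_nhds.congr' ?_
    obtain ⟨R0, hR0⟩ := exists_nat_ge |X x|
    filter_upwards [eventually_ge_atTop R0] with R hR
    have : (R0:ℝ) ≤ R := by exact_mod_cast hR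
    exact (max_eq_right (by linarith)).symm

def trunc (N x : ℝ) : ℝ := max (-N) (min x N)

lemma trunc_abs {N : ℝ} (hN : 0 ≤ N) (x : ℝ) : |trunc N x| ≤ N := by
  unfold trunc
  exact abs_le.2 ⟨le_max_left _ _, max_le (by linarith) (min_le_right _ _)⟩
lemma trunc_eq {N x : ℝ} (h : |x| ≤ N) : trunc N x = x := by
  unfold trunc
  rw [min_eq_left (abs_le.1 h).2, max_eq_right (abs_le.1 h).1]

lemma weak_stopped {Ξ : Set (Path T)} (hΞ : Ξ ⊆ BigOmega T hT) {Q : Measure (Path T)}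
    [IsProbabilityMeasure Q] {τ : Path T → ℝ} (hτ : IsStopRaw T τ)
    (hM : IsMart T Q (fun t ω => Sproc T hT (min (τ ω) t) ω)) (H G : SimpleStrategy T) {lam : ℝ}
    (hlam : 0 ≤ lam) (hadm : ∀ t ∈ Set.Icc (0:ℝ) T, ∀ ω ∈ Ξ, 0 ≤ lam + genInteg T hT (H, G) t ω)
    {N : ℝ} (hN : 0 ≤ N) :
    ∫⁻ ω, (Ξ ∩ {ω | ‖ω‖ ≤ N}).indicator (fun ω => ENNReal.ofReal
      (lam + genInteg T hT (H, G) (clamp T hT (τ ω)).1 ω)) ω ∂Q ≤ ENNReal.ofReal lam := by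
  set g : Path T → ℝ≥0∞ := (Ξ ∩ {ω | ‖ω‖ ≤ N}).indicator (fun ω => ENNReal.ofReal
      (lam + genInteg T hT (H, G) (clamp T hT (τ ω)).1 ω)) with hg
  obtain ⟨CH, hCH0, hCH⟩ := theta_bdd H
  obtain ⟨CG, hCG0, hCG⟩ := theta_bdd G
  set C := CH + CG * N with hC
  have hC0 : 0 ≤ C := by positivity
  set XT : Path T → ℝ := fun ω => Sproc T hT (min (τ ω) T) ω with hXT
  have hXTi : Integrable XT Q := hM.1 T ⟨hT, le_rfl⟩
  -- main estimate
  have main : ∀ ε > 0, ∀ R ≥ 0, ∫⁻ ω, g ω ∂Q ≤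
      ENNReal.ofReal (lam + ε + C * ∫ x, max (|XT x| - R) 0 ∂Q) := by
    intro ε hε R hR
    have hexc : 0 ≤ ∫ x, max (|XT x| - R) 0 ∂Q := integral_nonneg fun x => le_max_right _ _
    have hex : ∀ m j : ℕ, ∃ F : Path T → ℝ, Measurable F ∧ (∀ x, 0 ≤ F x) ∧ Integrable F Q ∧
      ∫ x, F x ∂Q ≤ lam + ε + C * (N + R) + C * ∫ x, max (|XT x| - R) 0 ∂Q ∧
      (∀ x δ, 0 ≤ δ → (∀ i < 2^j, |Sproc T hT (min (τ x) (gr T j (i+1))) x -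
        Sproc T hT (min (τ x) (gr T j i)) x| ≤ δ) → C * (N + R) - C * δ ≤ F x) ∧
      (∀ x, (∀ i ≤ 2^j, -ε ≤ lam + Idis T hT x j (fun u => theta H x u + theta G x u *
          trunc N (phi T hT m u x)) (min (clamp T hT (τ x)).1 (gr T j i)) ∧
        |Sproc T hT (min (τ x) (gr T j i)) x| ≤ N) →
          lam + Idis T hT x j (fun u => theta H x u + theta G x u *
          trunc N (phi T hT m u x)) (clamp T hT (τ x)).1 + ε + C * (N + R) ≤ F x) := by
      intro m j
      have hmem : ∀ i ≤ 2^j, gr T j i ∈ Set.Icc 0 T := fun i hi => gr_mem hT hi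
      obtain ⟨F, h1, h2, h3, h4, h5, h6⟩ := weak_discrete (μ := Q) (n := 2^j)
        (F := fun i => Fraw T (gr T j i))
        (X := fun i ω => Sproc T hT (min (τ ω) (gr T j i)) ω)
        (c := fun i ω => theta H ω (gr T j i) + theta G ω (gr T j i) *
          trunc N (phi T hT m (gr T j i) ω)) (C := C) (N := N) (R := R) (lam := lam) (ε := ε)
        (fun i => (Fraw_le _).trans_eq (BorelSpace.measurable_eq (α := Path T)).symm)
        (fun a b h => Fraw_mono (gr_mono hT j h)) hC0 hN hR hlam hε.le
        (fun i hi ω => by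
          refine (abs_add_le _ _).trans (add_le_add (hCH _ _) ?_)
          rw [abs_mul]
          exact mul_le_mul (hCG _ _) (trunc_abs hN _) (abs_nonneg _) hCG0)
        (fun i hi => by
          have hi := hmem i hi.le
          refine madd (m := Fraw T (gr T j i)) (theta_meas H hi)
            (mmul (m := Fraw T (gr T j i)) (theta_meas G hi) ?_)
          have : Measurable[Fraw T (gr T j i)] (fun ω => phi T hT m (gr T j i) ω) :=
            Fraw_of_stop hT (phi_meas m hi.2) ⟨_, hi⟩ (fun ω => phi_stop m ω _ le_rfl)
          have ht : Measurable (trunc N) :=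
            measurable_const.max (measurable_id.min measurable_const)
          exact ht.comp this)
        (fun i hi => stopped_meas hτ (hmem i hi))
        (fun i hi => hM.1 _ (hmem i hi))
        (fun i hi A hA => by
          have hA' : MeasurableSet A := by
            have := Fraw_le _ _ hA
            rwa [← BorelSpace.measurable_eq (α := Path T)] at this
          rw [integral_sub (hM.1 _ (hmem (i+1) (by omega))).integrableOn
            (hM.1 _ (hmem i hi.le)).integrableOn,
            hM.2 _ _ (hmem i hi.le) (hmem (i+1) (by omega)) (gr_mono hT j (Nat.le_succ i)) A hA, sub_self])
      refine ⟨F, h1, h2, h3, ?_, h5, ?_⟩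
      · have e : gr T j (2^j) = T := gr_last j
        simpa only [e] using h4
      · intro x hx
        have := h6 x (fun i hi => by
          rw [Idis_partial x j (fun u => theta H x u + theta G x u *
          trunc N (phi T hT m u x)) (τ x) hi]
          exact hx i hi)
        rw [Idis_partial x j (fun u => theta H x u + theta G x u *
          trunc N (phi T hT m u x)) (τ x) le_rfl, gr_last, min_eq_left (clamp T hT (τ x)).2.2] at this
        exact this
    choose F hFm hF0 hFi hFE hFa hFb using hex
    set K := C * (N + R) with hK
    have hK0 : 0 ≤ K := by positivity
    -- pointwise bound
    have hpt : ∀ ω, ENNReal.ofReal K + g ω ≤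
        liminf (fun m => liminf (fun j => ENNReal.ofReal (F m j ω)) atTop) atTop := by
      intro ω
      have hbase : ∀ m, ENNReal.ofReal K ≤ liminf (fun j => ENNReal.ofReal (F m j ω)) atTop := by
        intro m
        refine ENNReal.le_of_forall_pos_le_add fun δ hδ _ => ?_
        have hδ' : (0:ℝ) < δ / (C + 1) := by positivity
        have h1 : ENNReal.ofReal (K - δ) ≤ liminf (fun j => ENNReal.ofReal (F m j ω)) atTop := by
          refine le_liminf_of_le (by isBoundedDefault) ?_
          filter_upwards [small_incr (hT := hT) ω (τ ω) hδ'] with j hj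
          refine ENNReal.ofReal_le_ofReal (le_trans ?_ (hFa m j ω _ hδ'.le hj))
          have : C * (δ / (C+1)) ≤ δ := by
            rw [← mul_div_assoc, div_le_iff₀ (by positivity)]
            nlinarith [δ.2]
          linarith
        calc ENNReal.ofReal K ≤ ENNReal.ofReal ((K - δ) + δ) := by simp
          _ ≤ ENNReal.ofReal (K - δ) + ENNReal.ofReal δ := ENNReal.ofReal_add_le
          _ ≤ _ := by rw [ENNReal.ofReal_coe_nnreal]; gcongr
      by_cases hω : ω ∈ Ξ ∩ {ω | ‖ω‖ ≤ N}
      · rw [hg, Set.indicator_of_mem hω]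
        have hwΩ := hΞ hω.1
        set t := (clamp T hT (τ ω)).1 with ht
        have htm : t ∈ Set.Icc 0 T := (clamp T hT (τ ω)).2
        refine le_liminf_of_le (by isBoundedDefault) ?_
        filter_upwards [integ_Sm_unif hwΩ G (half_pos hε)] with m hm
        refine le_liminf_of_le (by isBoundedDefault) ?_
        obtain ⟨j0, hj0⟩ := ((Conv_integ (hT := hT) H ω).add (Conv_integ_Sm G m ω)) (ε/2) (half_pos hε)
        filter_upwards [eventually_ge_atTop j0] with j hj
        have hcl : ∀ s ∈ Set.Icc (0:ℝ) T, |Idis T hT ω j (fun u => theta H ω u + theta G ω u *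
            trunc N (phi T hT m u ω)) s - genInteg T hT (H, G) s ω| ≤ ε := by
          intro s hs
          have e : Idis T hT ω j (fun u => theta H ω u + theta G ω u *
            trunc N (phi T hT m u ω)) s = Idis T hT ω j (fun u => theta H ω u + theta G ω u *
            phi T hT m u ω) s := by
            unfold Idis
            refine Finset.sum_congr rfl fun i hi => ?_
            simp only
            rw [trunc_eq ((phi_abs_le m ω (gr_mem hT (Finset.mem_range.1 hi).le)).trans hω.2)]
          rw [e]
          have h1 := abs_le.1 (hj0 j hj s hs)
          have h2 := abs_le.1 (hm s hs)
          unfold genInteg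
          rw [abs_le]; constructor <;> linarith
        rw [← ENNReal.ofReal_add hK0 (hadm t htm ω hω.1)]
        refine ENNReal.ofReal_le_ofReal ?_
        have := hFb m j ω (fun i hi => ⟨?_, (ev_abs_le ω _).trans hω.2⟩)
        · have h1 := abs_le.1 (hcl t htm)
          linarith
        · have hs : min t (gr T j i) ∈ Set.Icc 0 T :=
            ⟨le_min htm.1 (gr_mem hT hi).1, (min_le_left _ _).trans htm.2⟩
          have h1 := abs_le.1 (hcl _ hs)
          have h2 := hadm _ hs ω hω.1
          linarith
      · rw [hg, Set.indicator_of_notMem hω, add_zero]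
        exact le_liminf_of_le (by isBoundedDefault) (Eventually.of_forall hbase)
    have hfat : ENNReal.ofReal K + ∫⁻ ω, g ω ∂Q ≤
        ENNReal.ofReal (lam + ε + K + C * ∫ x, max (|XT x| - R) 0 ∂Q) := by
      calc ENNReal.ofReal K + ∫⁻ ω, g ω ∂Q = ∫⁻ ω, (ENNReal.ofReal K + g ω) ∂Q := by
            rw [lintegral_add_left measurable_const]; simp
        _ ≤ ∫⁻ ω, liminf (fun m => liminf (fun j => ENNReal.ofReal (F m j ω)) atTop) atTop ∂Q :=
            lintegral_mono hpt
        _ ≤ liminf (fun m => ∫⁻ ω, liminf (fun j => ENNReal.ofReal (F m j ω)) atTop ∂Q) atTop :=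
            lintegral_liminf_le fun m => Measurable.liminf fun j => (hFm m j).ennreal_ofReal
        _ ≤ liminf (fun m => liminf (fun j => ∫⁻ ω, ENNReal.ofReal (F m j ω) ∂Q) atTop) atTop := by
            refine liminf_le_liminf (Eventually.of_forall fun m => ?_)
            exact lintegral_liminf_le fun j => (hFm m j).ennreal_ofReal
        _ ≤ liminf (fun m : ℕ => liminf (fun j : ℕ => ENNReal.ofReal (lam + ε + K + C * ∫ x, max (|XT x| - R) 0 ∂Q)) atTop) atTop := by
            refine liminf_le_liminf (Eventually.of_forall fun m => ?_)
            refine liminf_le_liminf (Eventually.of_forall fun j => ?_)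
            rw [← ofReal_integral_eq_lintegral_ofReal (hFi m j) (Eventually.of_forall (hF0 m j))]
            exact ENNReal.ofReal_le_ofReal (hFE m j)
        _ = _ := by simp
    have e : lam + ε + K + C * ∫ x, max (|XT x| - R) 0 ∂Q = K + (lam + ε + C * ∫ x, max (|XT x| - R) 0 ∂Q) := by ring
    rw [e, ENNReal.ofReal_add hK0 (by positivity)] at hfat
    exact (ENNReal.add_le_add_iff_left ENNReal.ofReal_ne_top).1 hfat
  have hlim : Tendsto (fun R : ℕ => ENNReal.ofReal (lam + 1 / ((R:ℝ) + 1) +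
      C * ∫ x, max (|XT x| - R) 0 ∂Q)) atTop (𝓝 (ENNReal.ofReal (lam + 0 + C * 0))) := by
    refine (ENNReal.continuous_ofReal.tendsto _).comp ?_
    exact (tendsto_const_nhds.add tendsto_one_div_add_atTop_nhds_zero_nat).add
      ((excess_tendsto hXTi).const_mul C)
  have := ge_of_tendsto' hlim fun R => main (1 / ((R:ℝ)+1)) (by positivity) R (by positivity)
  simpa using this
end Weak2

end Part5

section Part6

section Weak3
variable {T : ℝ} {hT : 0 ≤ T}

lemma genInteg_zero (HG : SimpleStrategy T × SimpleStrategy T) (ω : Path T) :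
    genInteg T hT HG 0 ω = 0 := by
  unfold genInteg integ
  simp [min_eq_right (strat_nonneg _ _ _)]

lemma weak_T {Ξ : Set (Path T)} {Xibar : Set (PathPair T)} (hA : AssumptionA T hT Ξ Xibar)
    {Q : Measure (Path T)} (hQ : Q ∈ MSet T hT Ξ) (HG : SimpleStrategy T × SimpleStrategy T)
    {lam : ℝ} (hlam : 0 ≤ lam)
    (hadm : ∀ t ∈ Set.Icc (0:ℝ) T, ∀ ω ∈ Ξ, 0 ≤ lam + genInteg T hT HG t ω) :
    ∫⁻ ω, ENNReal.ofReal (lam + genInteg T hT HG T ω) ∂Q ≤ ENNReal.ofReal lam := by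
  obtain ⟨hP, ⟨τ, hτ, hτa, hM⟩, hQΞ⟩ := hQ
  have hΞ : Ξ ⊆ BigOmega T hT := by rw [hA.xi_eq]; exact fun ω h => h.1
  have hΞm := Xi_meas hA
  have hae : ∀ᵐ ω ∂Q, ω ∈ Ξ := by
    rw [← prob_compl_eq_zero_iff hΞm] at hQΞ
    exact hQΞ
  set f : ℕ → Path T → ℝ≥0∞ := fun m => (Ξ ∩ {ω | ‖ω‖ ≤ (m:ℝ)}).indicator (fun ω => ENNReal.ofReal
      (lam + genInteg T hT HG (clamp T hT (τ m ω)).1 ω)) with hf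
  have hfm : ∀ m, Measurable (f m) := by
    intro m
    refine Measurable.indicator ?_ (hΞm.inter (measurableSet_le measurable_norm measurable_const))
    exact (measurable_const.add (genInteg_borel HG (clamp_borel (hτ m)))).ennreal_ofReal
  calc ∫⁻ ω, ENNReal.ofReal (lam + genInteg T hT HG T ω) ∂Q
      ≤ ∫⁻ ω, liminf (fun m => f m ω) atTop ∂Q := by
        refine lintegral_mono_ae ?_
        filter_upwards [hae, hτa] with ω hω hτω
        refine le_liminf_of_le (by isBoundedDefault) ?_
        obtain ⟨n0, hn0⟩ := exists_nat_ge ‖ω‖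
        filter_upwards [hτω.2.eventually_ge_atTop T, eventually_ge_atTop n0] with m hm hm'
        have h1 : (n0:ℝ) ≤ m := by exact_mod_cast hm'
        rw [hf]
        simp only
        rw [Set.indicator_of_mem (show ω ∈ Ξ ∩ {ω | ‖ω‖ ≤ (m:ℝ)} from ⟨hω, hn0.trans h1⟩)]
        have : (clamp T hT (τ m ω)).1 = T := by
          simp [clamp, Set.coe_projIcc, hm, hT]
        rw [this]
    _ ≤ liminf (fun m => ∫⁻ ω, f m ω ∂Q) atTop := lintegral_liminf_le hfm
    _ ≤ liminf (fun _ : ℕ => ENNReal.ofReal lam) atTop := by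
        refine liminf_le_liminf (Eventually.of_forall fun m => ?_)
        exact weak_stopped hΞ (hτ m) (hM m) HG.1 HG.2 hlam hadm (Nat.cast_nonneg m)
    _ = _ := by simp

lemma weak_duality {Ξ : Set (Path T)} {Xibar : Set (PathPair T)} (hA : AssumptionA T hT Ξ Xibar)
    (ξ : Path T → ℝ≥0∞) {lam : ℝ} (h : lam ∈ PhiGenSet T hT Ξ (fun ω => (ξ ω : EReal))) :
    (supMart T hT Ξ ξ : EReal) ≤ lam := by
  obtain ⟨H, hadm, hsup⟩ := h
  have hlam : 0 ≤ lam := by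
    obtain ⟨ω, hω⟩ := hA.xi_nonempty
    have := hadm 0 0 ⟨le_rfl, hT⟩ ω hω
    rwa [genInteg_zero, add_zero] at this
  have hpt : ∀ ω ∈ Ξ, ξ ω ≤ liminf (fun n => ENNReal.ofReal (lam + genInteg T hT (H n) T ω)) atTop := by
    intro ω hω
    refine le_of_forall_lt fun c hc => ?_
    obtain ⟨r, hr, hcr, hrξ⟩ : ∃ r : ℝ, 0 ≤ r ∧ c < ENNReal.ofReal r ∧ ENNReal.ofReal r < ξ ω := by
      obtain ⟨d, hd1, hd2⟩ := exists_between hc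
      refine ⟨d.toReal, ENNReal.toReal_nonneg, ?_⟩
      rw [ENNReal.ofReal_toReal (hd2.trans_le le_top).ne]
      exact ⟨hd1, hd2⟩
    refine hcr.trans_le ?_
    have h1 : ((r:ℝ):EReal) < (lam : EReal) + liminf (fun n =>
        ((genInteg T hT (H n) T ω : ℝ) : EReal)) atTop := by
      refine lt_of_lt_of_le ?_ (hsup ω hω)
      have : ((ENNReal.ofReal r : ℝ≥0∞) : EReal) < ((ξ ω : ℝ≥0∞) : EReal) := by exact_mod_cast hrξ
      rwa [EReal.coe_ennreal_ofReal, max_eq_left hr] at this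
    have h2 : ((r - lam : ℝ) : EReal) < liminf (fun n =>
        ((genInteg T hT (H n) T ω : ℝ) : EReal)) atTop := by
      rw [EReal.coe_sub]
      refine EReal.sub_lt_of_lt_add ?_
      rwa [add_comm]
    refine le_liminf_of_le (by isBoundedDefault) ?_
    filter_upwards [eventually_lt_of_lt_liminf h2] with n hn
    have : r - lam < genInteg T hT (H n) T ω := by exact_mod_cast hn
    exact ENNReal.ofReal_le_ofReal (by linarith)
  have : supMart T hT Ξ ξ ≤ ENNReal.ofReal lam := by
    refine iSup₂_le fun Q hQ => ?_
    have hP := hQ.1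
    have hae : ∀ᵐ ω ∂Q, ω ∈ Ξ := by
      have := hQ.2.2
      rw [← prob_compl_eq_zero_iff (Xi_meas hA)] at this
      exact this
    calc ∫⁻ ω, ξ ω ∂Q ≤ ∫⁻ ω, liminf (fun n => ENNReal.ofReal (lam + genInteg T hT (H n) T ω)) atTop ∂Q :=
          lintegral_mono_ae (hae.mono hpt)
      _ ≤ liminf (fun n => ∫⁻ ω, ENNReal.ofReal (lam + genInteg T hT (H n) T ω) ∂Q) atTop :=
          lintegral_liminf_le fun n =>
            (measurable_const.add (genInteg_borel (H n) measurable_const)).ennreal_ofReal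
      _ ≤ liminf (fun _ : ℕ => ENNReal.ofReal lam) atTop := by
          refine liminf_le_liminf (Eventually.of_forall fun n => ?_)
          exact weak_T hA hQ (H n) hlam (hadm n)
      _ = _ := by simp
  calc (supMart T hT Ξ ξ : EReal) ≤ ((ENNReal.ofReal lam : ℝ≥0∞) : EReal) := by exact_mod_cast this
    _ = lam := by rw [EReal.coe_ennreal_ofReal, max_eq_left hlam]
end Weak3

end Part6

section Part7

theorem usc_approx {K : Type*} [MetricSpace K] {η : K → ℝ} {C : ℝ} (hb : ∀ x, |η x| ≤ C)
    (hu : UpperSemicontinuous η) :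
    ∃ f : ℕ → K → ℝ, (∀ n, Continuous (f n)) ∧ (∀ n x, η x ≤ f n x) ∧ (∀ n x, |f n x| ≤ C) ∧
      ∀ x, Tendsto (fun n => f n x) atTop (𝓝 (η x)) := by
  have hbd : ∀ (n : ℕ) (x : K), BddAbove (range fun y => η y - n * dist x y) := by
    intro n x
    refine ⟨C, ?_⟩
    rintro _ ⟨y, rfl⟩
    have := (abs_le.1 (hb y)).2
    have h2 : 0 ≤ (n:ℝ) * dist x y := by positivity
    simp only
    linarith
  have hge : ∀ (n : ℕ) (x : K), η x ≤ ⨆ y, (η y - n * dist x y) := by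
    intro n x
    have := le_ciSup (hbd n x) x
    simpa using this
  have hle : ∀ (n : ℕ) (x : K), (⨆ y, (η y - n * dist x y)) ≤ C := by
    intro n x
    have : Nonempty K := ⟨x⟩
    refine ciSup_le fun y => ?_
    have := (abs_le.1 (hb y)).2
    have h2 : 0 ≤ (n:ℝ) * dist x y := by positivity
    linarith
  refine ⟨fun n x => ⨆ y, (η y - n * dist x y), ?_, hge, ?_, ?_⟩
  · intro n
    have : LipschitzWith (n : NNReal) (fun x => ⨆ y, (η y - n * dist x y)) := by
      refine LipschitzWith.of_le_add_mul _ fun x x' => ?_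
      have : Nonempty K := ⟨x⟩
      refine ciSup_le fun y => ?_
      have h1 := le_ciSup (hbd n x') y
      have h2 := dist_triangle x' x y
      have h3 : (n:ℝ) * dist x' y ≤ n * dist x' x + n * dist x y := by
        rw [← mul_add]; gcongr
      rw [dist_comm x' x] at h3
      push_cast
      linarith
    exact this.continuous
  · intro n x
    exact abs_le.2 ⟨(abs_le.1 (hb x)).1.trans (hge n x), hle n x⟩
  · intro x
    refine tendsto_order.2 ⟨fun a ha => Eventually.of_forall fun n => ha.trans_le (hge n x), ?_⟩
    intro a ha
    obtain ⟨b, hb1, hb2⟩ := exists_between ha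
    obtain ⟨δ, hδ, hδ'⟩ := Metric.eventually_nhds_iff.1 (hu x b hb1)
    obtain ⟨N, hN⟩ := exists_nat_gt ((C - b) / δ)
    filter_upwards [eventually_ge_atTop N] with n hn
    refine lt_of_le_of_lt ?_ hb2
    have : Nonempty K := ⟨x⟩
    refine ciSup_le fun y => ?_
    by_cases hy : dist y x < δ
    · have := hδ' hy
      have h2 : 0 ≤ (n:ℝ) * dist x y := by positivity
      linarith
    · push Not at hy
      rw [dist_comm] at hy
      have h1 : (C - b) < N * δ := (div_lt_iff₀ hδ).1 hN
      have h2 : (N:ℝ) * δ ≤ n * dist x y := by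
        have : (N:ℝ) ≤ n := by exact_mod_cast hn
        gcongr
      have := (abs_le.1 (hb y)).2
      linarith

open CompactlySupported in
theorem riesz_compact {K : Type*} [MetricSpace K] [CompactSpace K] [MeasurableSpace K]
    [BorelSpace K] (L : C(K, ℝ) →ₗ[ℝ] ℝ) (hpos : ∀ f : C(K, ℝ), (∀ x, 0 ≤ f x) → 0 ≤ L f)
    (h1 : L 1 = 1) :
    ∃ Q : Measure K, IsProbabilityMeasure Q ∧ ∀ f : C(K, ℝ), ∫ x, f x ∂Q = L f := by
  let Λ0 : C_c(K, ℝ) →ₗ[ℝ] ℝ :=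
    { toFun := fun f => L f.toContinuousMap
      map_add' := fun f g => by
        rw [← map_add]; rfl
      map_smul' := fun c f => by
        rw [RingHom.id_apply, ← map_smul]; rfl }
  let Λ : C_c(K, ℝ) →ₚ[ℝ] ℝ := PositiveLinearMap.mk₀ Λ0 (fun f hf => hpos _ (fun x => hf x))
  have hI : ∀ f : C(K, ℝ), ∫ x, f x ∂(RealRMK.rieszMeasure Λ) = L f := fun f =>
    RealRMK.integral_rieszMeasure Λ (CompactlySupportedContinuousMap.continuousMapEquiv f)
  refine ⟨RealRMK.rieszMeasure Λ, ⟨?_⟩, hI⟩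
  have := hI 1
  rw [h1] at this
  simp only [ContinuousMap.one_apply, integral_const, smul_eq_mul, mul_one] at this
  rw [measureReal_def] at this
  exact (ENNReal.toReal_eq_one_iff _).1 this

theorem hb_measure {K : Type*} [MetricSpace K] [CompactSpace K] [MeasurableSpace K]
    [BorelSpace K] (V : Submodule ℝ C(K, ℝ)) (x0 : K) (hV : ∀ v ∈ V, v x0 = 0)
    {η : K → ℝ} {C : ℝ} (hb : ∀ x, |η x| ≤ C) (hu : UpperSemicontinuous η) (lam : ℝ)
    (hlam : ∀ v ∈ V, ¬ ∀ x, η x ≤ lam + v x) :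
    ∃ Q : Measure K, IsProbabilityMeasure Q ∧ (∀ v ∈ V, ∫ x, v x ∂Q = 0) ∧
      lam ≤ ∫ x, η x ∂Q := by
  let A : C(K, ℝ) × ℝ → Set ℝ := fun z => {l | ∃ v ∈ V, ∀ x, z.1 x + z.2 * η x ≤ l + v x}
  have hAbd : ∀ z, BddBelow (A z) := by
    intro z
    refine ⟨z.1 x0 + z.2 * η x0, ?_⟩
    rintro l ⟨v, hv, h⟩
    have := h x0
    rw [hV v hv] at this
    linarith
  have hAne : ∀ z, (A z).Nonempty := by
    intro z
    refine ⟨‖z.1‖ + |z.2| * C, 0, V.zero_mem, fun x => ?_⟩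
    have h1 := (abs_le.1 (z.1.norm_coe_le_norm x)).2
    have h2 : z.2 * η x ≤ |z.2| * C :=
      (le_abs_self _).trans (by rw [abs_mul]; gcongr; exact hb x)
    simp only [ContinuousMap.zero_apply]
    linarith
  let p : C(K, ℝ) × ℝ → ℝ := fun z => sInf (A z)
  have hple : ∀ z l, l ∈ A z → p z ≤ l := fun z l h => csInf_le (hAbd z) h
  have hhom1 : ∀ c : ℝ, 0 < c → ∀ z, p (c • z) ≤ c * p z := by
    intro c hc z
    rw [← div_le_iff₀' hc]
    refine le_csInf (hAne z) ?_
    rintro l ⟨v, hv, h⟩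
    rw [div_le_iff₀' hc]
    refine hple _ _ ⟨c • v, V.smul_mem c hv, fun x => ?_⟩
    have := mul_le_mul_of_nonneg_left (h x) hc.le
    simp only [Prod.smul_fst, Prod.smul_snd, ContinuousMap.smul_apply, smul_eq_mul]
    linarith
  have hhom : ∀ c : ℝ, 0 < c → ∀ z, p (c • z) = c * p z := by
    intro c hc z
    refine le_antisymm (hhom1 c hc z) ?_
    have := hhom1 c⁻¹ (inv_pos.2 hc) (c • z)
    rw [smul_smul, inv_mul_cancel₀ hc.ne', one_smul] at this
    rwa [← le_inv_mul_iff₀ hc] 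
  have hadd : ∀ z w, p (z + w) ≤ p z + p w := by
    intro z w
    rw [← sub_le_iff_le_add]
    refine le_csInf (hAne z) ?_
    rintro l ⟨v, hv, h⟩
    rw [sub_le_comm]
    refine le_csInf (hAne w) ?_
    rintro l' ⟨v', hv', h'⟩
    rw [sub_le_iff_le_add]
    refine hple _ _ ⟨v + v', V.add_mem hv hv', fun x => ?_⟩
    have := h x
    have := h' x
    simp only [Prod.fst_add, Prod.snd_add, ContinuousMap.add_apply]
    linarith
  have hp0 : 0 ≤ p 0 := by
    refine le_csInf (hAne 0) ?_
    rintro l ⟨v, hv, h⟩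
    have := h x0
    rw [hV v hv] at this
    simpa using this
  let e : C(K, ℝ) × ℝ := (0, 1)
  let f0 : (C(K, ℝ) × ℝ) →ₗ.[ℝ] ℝ := LinearPMap.mkSpanSingleton' e (p e) (fun c hc => by
    have : c = 0 := by simpa [e] using congrArg Prod.snd hc
    simp [this])
  obtain ⟨L, hL, hLp⟩ := exists_extension_of_le_sublinear f0 p hhom hadd (by
    rintro ⟨x, hx⟩
    obtain ⟨c, rfl⟩ := Submodule.mem_span_singleton.1 (by
      simpa [f0, LinearPMap.domain_mkSpanSingleton] using hx)
    have : f0 ⟨c • e, hx⟩ = c • p e := LinearPMap.mkSpanSingleton'_apply _ _ _ _ _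
    rw [this, smul_eq_mul]
    simp only
    rcases lt_trichotomy c 0 with h | h | h
    · have h1 := hhom (-c) (by linarith) e
      have h2 := hadd (c • e) ((-c) • e)
      rw [← add_smul, add_neg_cancel, zero_smul] at h2
      linarith
    · subst h; simpa using hp0
    · exact (hhom c h e).ge)
  have hLe : L e = p e := by
    have hm : e ∈ f0.domain := by
      simp [f0, LinearPMap.domain_mkSpanSingleton, Submodule.mem_span_singleton_self]
    have := hL ⟨e, hm⟩
    rw [this]
    exact LinearPMap.mkSpanSingleton'_apply_self _ _ _ _
  have hlamL : lam ≤ L e := by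
    rw [hLe]
    refine le_csInf (hAne e) ?_
    rintro l ⟨v, hv, h⟩
    by_contra! hl
    refine hlam v hv fun x => ?_
    have := h x
    simp [e] at this
    linarith
  let L' : C(K, ℝ) →ₗ[ℝ] ℝ := L.comp (LinearMap.inl ℝ _ _)
  have hL' : ∀ f, L' f = L (f, 0) := fun f => rfl
  have hneg : ∀ f : C(K, ℝ), L' (-f) = - L' f := fun f => map_neg _ _
  have hup : ∀ (f : C(K, ℝ)) (l : ℝ) (v : C(K, ℝ)), v ∈ V → (∀ x, f x ≤ l + v x) → L' f ≤ l := by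
    intro f l v hv h
    refine (hLp (f, 0)).trans (hple _ _ ⟨v, hv, fun x => ?_⟩)
    simpa using h x
  have hLv : ∀ v ∈ V, L' v = 0 := by
    intro v hv
    have h1 := hup v 0 v hv (fun x => by simp)
    have h2 := hup (-v) 0 (-v) (V.neg_mem hv) (fun x => by simp)
    rw [hneg] at h2
    linarith
  have hLpos : ∀ f : C(K, ℝ), (∀ x, 0 ≤ f x) → 0 ≤ L' f := by
    intro f hf
    have h2 := hup (-f) 0 0 V.zero_mem (fun x => by simpa using hf x)
    rw [hneg] at h2
    linarith
  have hL1 : L' 1 = 1 := by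
    have h1 := hup 1 1 0 V.zero_mem (fun x => by simp)
    have h2 := hup (-1) (-1) 0 V.zero_mem (fun x => by simp)
    rw [hneg] at h2
    linarith
  obtain ⟨Q, hQ, hQI⟩ := riesz_compact L' hLpos hL1
  refine ⟨Q, hQ, fun v hv => by rw [hQI, hLv v hv], hlamL.trans ?_⟩
  obtain ⟨f, hfc, hfη, hfC, hft⟩ := usc_approx hb hu
  have hlim : Tendsto (fun n => ∫ x, f n x ∂Q) atTop (𝓝 (∫ x, η x ∂Q)) := by
    refine tendsto_integral_of_dominated_convergence (fun _ => C)
      (fun n => (hfc n).aestronglyMeasurable) (integrable_const _)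
      (fun n => Eventually.of_forall fun x => hfC n x) (Eventually.of_forall hft)
  refine ge_of_tendsto' hlim fun n => ?_
  have := hQI ⟨f n, hfc n⟩
  simp only [ContinuousMap.coe_mk] at this
  rw [this]
  have h3 : L (-⟨f n, hfc n⟩, 1) ≤ 0 := by
    refine (hLp _).trans (hple _ _ ⟨0, V.zero_mem, fun x => ?_⟩)
    have := hfη n x
    simp
    linarith
  have h4 : ((-⟨f n, hfc n⟩, 1) : C(K, ℝ) × ℝ) = e - (⟨f n, hfc n⟩, 0) := by
    ext <;> simp [e]
  rw [h4, map_sub] at h3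
  rw [hL']
  linarith

end Part7

section Part8

variable {T : ℝ} {hT : 0 ≤ T}

open scoped BoundedContinuousFunction

/-- elementary trading gains on the enlarged space on the grid of level `j` -/
def vI (T : ℝ) (hT : 0 ≤ T) (j : ℕ) (h g : ℕ → (PathPair T →ᵇ ℝ)) (p : PathPair T) : ℝ :=
  ∑ i ∈ Finset.range (2^j),
    (h i (stopP T p (clamp T hT (gr T j i))) *
        (SbarProc T hT (gr T j (i+1)) p - SbarProc T hT (gr T j i) p) +
      g i (stopP T p (clamp T hT (gr T j i))) *
        (SSbarProc T hT (gr T j (i+1)) p - SSbarProc T hT (gr T j i) p))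

lemma Sbar_cont (t : ℝ) : Continuous (SbarProc T hT t) :=
  (ev_cont' t).comp continuous_fst

lemma SSbar_cont (t : ℝ) : Continuous (SSbarProc T hT t) := by
  unfold SSbarProc
  exact ((((((ev_cont' t).comp continuous_fst).pow 2).sub
    (((ev_cont' 0).comp continuous_fst).pow 2)).sub ((ev_cont' t).comp continuous_snd)).div_const 2)

lemma stopP_cont (t : Set.Icc (0:ℝ) T) : Continuous (fun p => stopP T p t) :=
  stopP_joint.comp (continuous_id.prodMk continuous_const)

lemma vI_cont (j : ℕ) (h g : ℕ → (PathPair T →ᵇ ℝ)) : Continuous (vI T hT j h g) := by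
  unfold vI
  refine continuous_finsetSum _ fun i _ => ?_
  exact (((h i).continuous.comp (stopP_cont _)).mul ((Sbar_cont _).sub (Sbar_cont _))).add
    (((g i).continuous.comp (stopP_cont _)).mul ((SSbar_cont _).sub (SSbar_cont _)))

lemma vI_add (j : ℕ) (h g h' g' : ℕ → (PathPair T →ᵇ ℝ)) (p : PathPair T) :
    vI T hT j (h + h') (g + g') p = vI T hT j h g p + vI T hT j h' g' p := by
  unfold vI
  rw [← Finset.sum_add_distrib]
  refine Finset.sum_congr rfl fun i _ => ?_
  simp only [Pi.add_apply, BoundedContinuousFunction.coe_add]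
  ring

lemma vI_smul (j : ℕ) (c : ℝ) (h g : ℕ → (PathPair T →ᵇ ℝ)) (p : PathPair T) :
    vI T hT j (c • h) (c • g) p = c * vI T hT j h g p := by
  unfold vI
  rw [Finset.mul_sum]
  refine Finset.sum_congr rfl fun i _ => ?_
  simp only [Pi.smul_apply, BoundedContinuousFunction.coe_smul, smul_eq_mul]
  ring

lemma vI_zero (j : ℕ) (p : PathPair T) : vI T hT j 0 0 p = 0 := by
  unfold vI
  simp

lemma sum_range_two_mul (f : ℕ → ℝ) (n : ℕ) :
    ∑ i ∈ Finset.range (n * 2), f i = ∑ i ∈ Finset.range n, (f (2*i) + f (2*i+1)) := by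
  induction n with
  | zero => simp
  | succ n ih =>
    rw [add_mul, one_mul, Finset.sum_range_succ, Finset.sum_range_succ, ih,
      Finset.sum_range_succ _ n, mul_comm n 2]
    ring

lemma stopP_stopP (p : PathPair T) (s t : Set.Icc (0:ℝ) T) :
    stopP T (stopP T p s) t = stopP T p (min s t) := by
  simp [stopP, stop_stop]

lemma gr_two (j i : ℕ) : gr T (j+1) (2*i) = gr T j i := by
  unfold gr; push_cast; rw [pow_succ]; field_simp

lemma clamp_mono : Monotone (clamp T hT) := monotone_projIcc hT

lemma vI_refine (j : ℕ) (h g : ℕ → (PathPair T →ᵇ ℝ)) :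
    ∃ h' g', ∀ p, vI T hT (j+1) h' g' p = vI T hT j h g p := by
  let R : (ℕ → (PathPair T →ᵇ ℝ)) → ℕ → (PathPair T →ᵇ ℝ) := fun h i =>
    (h (i/2)).compContinuous ⟨_, stopP_cont (clamp T hT (gr T j (i/2)))⟩
  refine ⟨R h, R g, fun p => ?_⟩
  unfold vI
  rw [pow_succ, sum_range_two_mul]
  refine Finset.sum_congr rfl fun i _ => ?_
  have hm : Monotone (gr T (j+1)) := gr_mono hT (j+1)
  have e1 : ∀ h : ℕ → (PathPair T →ᵇ ℝ), R h (2*i) (stopP T p (clamp T hT (gr T (j+1) (2*i)))) =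
      h i (stopP T p (clamp T hT (gr T j i))) := by
    intro h
    have : 2 * i / 2 = i := by omega
    simp only [R, BoundedContinuousFunction.compContinuous_apply, ContinuousMap.coe_mk, this, gr_two,
      stopP_stopP, min_self]
  have e2 : ∀ h : ℕ → (PathPair T →ᵇ ℝ),
      R h (2*i+1) (stopP T p (clamp T hT (gr T (j+1) (2*i+1)))) =
      h i (stopP T p (clamp T hT (gr T j i))) := by
    intro h
    have : (2 * i + 1) / 2 = i := by omega
    simp only [R, BoundedContinuousFunction.compContinuous_apply, ContinuousMap.coe_mk, this,
      stopP_stopP]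
    rw [min_eq_right]
    rw [← gr_two]
    exact clamp_mono (hm (by omega))
  have e3 : gr T (j+1) (2*i+1+1) = gr T j (i+1) := gr_two j (i+1)
  rw [e1, e1, e2, e2, e3, gr_two]
  ring

lemma vI_refine_le {j j' : ℕ} (hj : j ≤ j') (h g : ℕ → (PathPair T →ᵇ ℝ)) :
    ∃ h' g', ∀ p, vI T hT j' h' g' p = vI T hT j h g p := by
  induction j', hj using Nat.le_induction with
  | base => exact ⟨h, g, fun _ => rfl⟩
  | succ n hn ih =>
    obtain ⟨h1, g1, e1⟩ := ih
    obtain ⟨h2, g2, e2⟩ := vI_refine (hT := hT) n h1 g1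
    exact ⟨h2, g2, fun p => (e2 p).trans (e1 p)⟩

/-- the submodule of gains on a set `K` -/
def VK (T : ℝ) (hT : 0 ≤ T) (K : Set (PathPair T)) : Submodule ℝ C(K, ℝ) where
  carrier := {v | ∃ j h g, ∀ x : K, v x = vI T hT j h g x.1}
  zero_mem' := ⟨0, 0, 0, fun x => by rw [vI_zero]; rfl⟩
  add_mem' := by
    rintro v v' ⟨j, h, g, e⟩ ⟨j', h', g', e'⟩
    obtain ⟨h1, g1, e1⟩ := vI_refine_le (hT := hT) (le_max_left j j') h g
    obtain ⟨h2, g2, e2⟩ := vI_refine_le (hT := hT) (le_max_right j j') h' g'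
    refine ⟨max j j', h1 + h2, g1 + g2, fun x => ?_⟩
    rw [vI_add, e1, e2, ← e, ← e']; rfl
  smul_mem' := by
    rintro c v ⟨j, h, g, e⟩
    refine ⟨j, c • h, c • g, fun x => ?_⟩
    rw [vI_smul, ← e]; rfl

lemma SSbar_stop (p : PathPair T) (t : Set.Icc (0:ℝ) T) {u : ℝ} :
    SSbarProc T hT u (stopP T p t) = SSbarProc T hT (min t.1 u) p := by
  simp only [SSbarProc, stopP, ev_stop, min_eq_right t.2.1]

lemma Sbar_stop (p : PathPair T) (t : Set.Icc (0:ℝ) T) {u : ℝ} :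
    SbarProc T hT u (stopP T p t) = SbarProc T hT (min t.1 u) p := by
  simp only [SbarProc, stopP, ev_stop]

lemma clamp_val {t : ℝ} (ht : t ∈ Set.Icc (0:ℝ) T) : (clamp T hT t).1 = t := by
  simp [clamp, Set.projIcc_of_mem hT ht]

lemma vI_stop (j : ℕ) (h g : ℕ → (PathPair T →ᵇ ℝ)) (p : PathPair T) (t : Set.Icc (0:ℝ) T) :
    vI T hT j h g (stopP T p t) = ∑ i ∈ Finset.range (2^j),
    (h i (stopP T p (clamp T hT (gr T j i))) *
        (SbarProc T hT (min (gr T j (i+1)) t.1) p - SbarProc T hT (min (gr T j i) t.1) p) +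
      g i (stopP T p (clamp T hT (gr T j i))) *
        (SSbarProc T hT (min (gr T j (i+1)) t.1) p - SSbarProc T hT (min (gr T j i) t.1) p)) := by
  unfold vI
  refine Finset.sum_congr rfl fun i hi => ?_
  have hi' : i < 2^j := Finset.mem_range.1 hi
  have hg : gr T j i ∈ Set.Icc 0 T := gr_mem hT hi'.le
  simp only [SSbar_stop, Sbar_stop, stopP_stopP, min_comm t.1]
  by_cases hc : gr T j i ≤ t.1
  · have : min t (clamp T hT (gr T j i)) = clamp T hT (gr T j i) := by
      apply min_eq_right
      show (clamp T hT (gr T j i)).1 ≤ t.1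
      rwa [clamp_val hg]
    rw [this]
  · push Not at hc
    have h2 : gr T j i ≤ gr T j (i+1) := gr_mono hT j (Nat.le_succ i)
    rw [min_eq_right hc.le, min_eq_right (hc.le.trans h2)]
    simp

lemma vI_stop0 (j : ℕ) (h g : ℕ → (PathPair T →ᵇ ℝ)) (p : PathPair T) :
    vI T hT j h g (stopP T p (t0 T hT)) = 0 := by
  rw [vI_stop]
  refine Finset.sum_eq_zero fun i hi => ?_
  have hi' : i < 2^j := Finset.mem_range.1 hi
  have hg : gr T j i ∈ Set.Icc 0 T := gr_mem hT hi'.le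
  have h2 : gr T j i ≤ gr T j (i+1) := gr_mono hT j (Nat.le_succ i)
  have : (t0 T hT).1 = 0 := rfl
  rw [this, min_eq_right hg.1, min_eq_right (hg.1.trans h2)]
  simp

/-- from test functions to sets -/
lemma set_int_zero {α E : Type*} [MeasurableSpace α] [PseudoEMetricSpace E] [MeasurableSpace E]
    [BorelSpace E] {μ : Measure α} {π : α → E} (hπ : Measurable π) {Y : α → ℝ}
    (hY : Integrable Y μ) (hz : ∀ h : E →ᵇ ℝ, ∫ x, h (π x) * Y x ∂μ = 0)
    {B : Set E} (hB : MeasurableSet B) : ∫ x in π ⁻¹' B, Y x ∂μ = 0 := by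
  have htot : ∫ x, Y x ∂μ = 0 := by
    have := hz 1
    simpa using this
  induction B, hB using MeasurableSpace.induction_on_inter
      (s := {F : Set E | IsClosed F}) (h_eq := (BorelSpace.measurable_eq).trans
        borel_eq_generateFrom_isClosed) with
  | h_inter =>
    intro A hA B hB _
    exact IsClosed.inter hA hB
  | empty => simp
  | basic F hF =>
    have hF : IsClosed F := hF
    rw [← integral_indicator (hπ hF.measurableSet)]
    have hlim : Tendsto (fun n => ∫ x, (hF.apprSeq n (π x) : ℝ) * Y x ∂μ) atTop
        (𝓝 (∫ x, (π ⁻¹' F).indicator Y x ∂μ)) := by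
      refine tendsto_integral_of_dominated_convergence (fun x => |Y x|) (fun n => ?_) hY.abs
        (fun n => Eventually.of_forall fun x => ?_) (Eventually.of_forall fun x => ?_)
      · refine AEStronglyMeasurable.mul ?_ hY.aestronglyMeasurable
        exact (((NNReal.continuous_coe.comp (hF.apprSeq n).continuous).measurable).comp
          hπ).aestronglyMeasurable
      · rw [Real.norm_eq_abs, abs_mul]
        have h1 : |((hF.apprSeq n (π x) : NNReal) : ℝ)| ≤ 1 := by
          rw [abs_of_nonneg (NNReal.coe_nonneg _)]
          exact_mod_cast HasOuterApproxClosed.apprSeq_apply_le_one hF n (π x)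
        calc _ ≤ 1 * |Y x| := by gcongr
          _ = _ := one_mul _
      · have h1 := (tendsto_pi_nhds.1 (HasOuterApproxClosed.tendsto_apprSeq hF)) (π x) 
        have h2 : Tendsto (fun n => ((hF.apprSeq n (π x) : NNReal) : ℝ)) atTop
            (𝓝 (((F.indicator (fun _ => (1:NNReal)) (π x) : NNReal) : ℝ))) := by
          exact (NNReal.tendsto_coe.2 h1)
        have h3 := h2.mul_const (Y x)
        convert h3 using 2
        by_cases hx : π x ∈ F
        · simp [Set.indicator, hx]
        · simp [Set.indicator, hx]
    refine tendsto_nhds_unique hlim ?_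
    have : ∀ n, ∫ x, (hF.apprSeq n (π x) : ℝ) * Y x ∂μ = 0 := by
      intro n
      have := hz (BoundedContinuousFunction.ofNormedAddCommGroup (fun e => (hF.apprSeq n e : ℝ))
        (NNReal.continuous_coe.comp (hF.apprSeq n).continuous) 1 (fun e => by
          rw [Real.norm_eq_abs, abs_of_nonneg (NNReal.coe_nonneg _)]
          exact_mod_cast HasOuterApproxClosed.apprSeq_apply_le_one hF n e))
      exact this
    simp only [this]
    exact tendsto_const_nhds
  | compl A hA ih =>
    rw [preimage_compl, setIntegral_compl (hπ hA) hY, ih, htot, sub_zero]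
  | iUnion f hd hm ih =>
    rw [preimage_iUnion, integral_iUnion (fun i => hπ (hm i)) (fun i k hik =>
      (hd hik).preimage π) hY.integrableOn]
    simp [ih]

end Part8

section Part9

variable {T : ℝ} {hT : 0 ≤ T}

open scoped BoundedContinuousFunction

lemma cont_integrable {K : Type*} [TopologicalSpace K] [CompactSpace K] [MeasurableSpace K]
    [OpensMeasurableSpace K] {μ : Measure K} [IsFiniteMeasure μ] {f : K → ℝ} (hf : Continuous f) :
    Integrable f μ := by
  have := (BoundedContinuousFunction.mkOfCompact (⟨f, hf⟩ : C(K, ℝ))).integrable μ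
  exact this

lemma Sbar_joint : Continuous (fun x : ℝ × PathPair T => SbarProc T hT x.1 x.2) := by
  unfold SbarProc
  exact ev_joint.comp ((continuous_fst.comp continuous_snd).prodMk continuous_fst)

lemma SSbar_joint : Continuous (fun x : ℝ × PathPair T => SSbarProc T hT x.1 x.2) := by
  unfold SSbarProc
  have h1 : Continuous (fun x : ℝ × PathPair T => ev T hT x.2.1 x.1) :=
    ev_joint.comp ((continuous_fst.comp continuous_snd).prodMk continuous_fst)
  have h2 : Continuous (fun x : ℝ × PathPair T => ev T hT x.2.2 x.1) :=
    ev_joint.comp ((continuous_snd.comp continuous_snd).prodMk continuous_fst)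
  have h3 : Continuous (fun x : ℝ × PathPair T => ev T hT x.2.1 0) :=
    ev_joint.comp ((continuous_fst.comp continuous_snd).prodMk continuous_const)
  exact (((h1.pow 2).sub (h3.pow 2)).sub h2).div_const 2

/-- dyadic floor approximation -/
lemma gr_floor (hT : 0 ≤ T) {s : ℝ} (hs : s ∈ Set.Icc 0 T) (n : ℕ) :
    ⌊s * 2^n / T⌋₊ ≤ 2^n ∧ |gr T n ⌊s * 2^n / T⌋₊ - s| ≤ T / 2^n := by
  rcases hT.eq_or_lt with h0 | hpos
  · have : s = 0 := le_antisymm (hs.2.trans h0.symm.le) hs.1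
    subst h0
    simp [this, gr]
  · have hnn : 0 ≤ s * 2^n / T := div_nonneg (mul_nonneg hs.1 (by positivity)) hT
    have h1 := Nat.floor_le hnn
    have h2 := (Nat.lt_floor_add_one (s * 2^n / T)).le
    constructor
    · have : s * 2^n / T ≤ ((2^n : ℕ) : ℝ) := by
        rw [div_le_iff₀ hpos]; push_cast
        have := hs.2
        nlinarith [show (0:ℝ) < 2^n by positivity]
      have h3 := h1.trans this
      exact_mod_cast h3
    · unfold gr
      set k : ℝ := ((⌊s * 2^n / T⌋₊ : ℕ) : ℝ)
      rw [le_div_iff₀ hpos] at h1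
      rw [div_le_iff₀ hpos] at h2
      have hp : (0:ℝ) < 2^n := by positivity
      have : T * k / 2^n - s = (T * k - s * 2^n) / 2^n := by field_simp
      rw [this, abs_div, abs_of_pos hp]
      gcongr
      rw [abs_le]
      constructor <;> nlinarith

lemma gr_floor_tendsto (hT : 0 ≤ T) {s : ℝ} (hs : s ∈ Set.Icc 0 T) :
    Tendsto (fun n : ℕ => gr T n ⌊s * 2^n / T⌋₊) atTop (𝓝 s) := by
  rw [tendsto_iff_dist_tendsto_zero]
  have : Tendsto (fun n : ℕ => T / (2:ℝ)^n) atTop (𝓝 0) := by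
    have := (tendsto_pow_atTop_nhds_zero_of_lt_one (r := (1/2:ℝ)) (by norm_num)
      (by norm_num)).const_mul T
    simpa [div_eq_mul_inv] using this
  refine squeeze_zero (fun _ => dist_nonneg) (fun n => ?_) this
  rw [Real.dist_eq]
  exact (gr_floor hT hs n).2

section meas

variable {K : Set (PathPair T)} [CompactSpace K] {Q : Measure K} [IsProbabilityMeasure Q]

lemma mart_step (hQ : ∀ v ∈ VK T hT K, ∫ x, v x ∂Q = 0) {X : ℝ → PathPair T → ℝ}
    (hX : X = SbarProc T hT ∨ X = SSbarProc T hT) {j i : ℕ} (hi : i < 2^j) (h : PathPair T →ᵇ ℝ) :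
    ∫ x : K, h (stopP T x.1 (clamp T hT (gr T j i))) * (X (gr T j (i+1)) x.1 - X (gr T j i) x.1) ∂Q
      = 0 := by
  rcases hX with rfl | rfl
  · have := hQ ⟨fun x => vI T hT j (Pi.single i h) 0 x.1, (vI_cont _ _ _).comp
      continuous_subtype_val⟩ ⟨j, Pi.single i h, 0, fun x => rfl⟩
    refine Eq.trans ?_ this
    refine integral_congr_ae (Eventually.of_forall fun x => ?_)
    simp only [ContinuousMap.coe_mk, vI]
    rw [Finset.sum_eq_single i]
    · simp
    · intro b _ hb
      simp [Pi.single_eq_of_ne hb]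
    · intro h'; exact absurd (Finset.mem_range.2 hi) h'
  · have := hQ ⟨fun x => vI T hT j 0 (Pi.single i h) x.1, (vI_cont _ _ _).comp
      continuous_subtype_val⟩ ⟨j, 0, Pi.single i h, fun x => rfl⟩
    refine Eq.trans ?_ this
    refine integral_congr_ae (Eventually.of_forall fun x => ?_)
    simp only [ContinuousMap.coe_mk, vI]
    rw [Finset.sum_eq_single i]
    · simp
    · intro b _ hb
      simp [Pi.single_eq_of_ne hb]
    · intro h'; exact absurd (Finset.mem_range.2 hi) h'

lemma X_joint {X : ℝ → PathPair T → ℝ} (hX : X = SbarProc T hT ∨ X = SSbarProc T hT) :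
    Continuous (fun x : ℝ × PathPair T => X x.1 x.2) := by
  rcases hX with rfl | rfl
  · exact Sbar_joint
  · exact SSbar_joint

lemma X_cont {X : ℝ → PathPair T → ℝ} (hX : X = SbarProc T hT ∨ X = SSbarProc T hT) (t : ℝ) :
    Continuous (fun x : K => X t x.1) :=
  (X_joint hX).comp (continuous_const.prodMk continuous_subtype_val)

lemma mart_grid (hQ : ∀ v ∈ VK T hT K, ∫ x, v x ∂Q = 0) {X : ℝ → PathPair T → ℝ}
    (hX : X = SbarProc T hT ∨ X = SSbarProc T hT) {j i k : ℕ} (hik : i ≤ k) (hk : k ≤ 2^j)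
    (h : PathPair T →ᵇ ℝ) :
    ∫ x : K, h (stopP T x.1 (clamp T hT (gr T j i))) * (X (gr T j k) x.1 - X (gr T j i) x.1) ∂Q
      = 0 := by
  induction k, hik using Nat.le_induction with
  | base => simp
  | succ k hik ih =>
    have h1 := ih (by omega)
    have h2 := mart_step hQ hX (show k < 2^j by omega)
      (h.compContinuous ⟨_, stopP_cont (clamp T hT (gr T j i))⟩)
    simp only [BoundedContinuousFunction.compContinuous_apply, ContinuousMap.coe_mk,
      stopP_stopP, min_eq_right (clamp_mono (hT := hT) (gr_mono hT j hik))] at h2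
    have hc : Continuous (fun x : K => h (stopP T x.1 (clamp T hT (gr T j i)))) :=
      h.continuous.comp ((stopP_cont _).comp continuous_subtype_val)
    have h3 := congrArg₂ (· + ·) h1 h2
    simp only [add_zero] at h3
    rw [← integral_add] at h3
    · refine Eq.trans (integral_congr_ae (Eventually.of_forall fun x => ?_)) h3
      simp only
      ring
    · exact cont_integrable (hc.mul ((X_cont hX _).sub (X_cont hX _)))
    · exact cont_integrable (hc.mul ((X_cont hX _).sub (X_cont hX _)))

lemma mart_real (hQ : ∀ v ∈ VK T hT K, ∫ x, v x ∂Q = 0) {X : ℝ → PathPair T → ℝ}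
    (hX : X = SbarProc T hT ∨ X = SSbarProc T hT) {s t : ℝ} (hs : s ∈ Set.Icc 0 T)
    (ht : t ∈ Set.Icc 0 T) (hst : s ≤ t) (h : PathPair T →ᵇ ℝ) :
    ∫ x : K, h (stopP T x.1 (clamp T hT s)) * (X t x.1 - X s x.1) ∂Q = 0 := by
  have hc : Continuous (Function.uncurry (fun (u : ℝ × ℝ) (x : K) =>
      h (stopP T x.1 (clamp T hT u.1)) * (X u.2 x.1 - X u.1 x.1))) := by
    have e1 : Continuous (fun z : (ℝ × ℝ) × K => stopP T z.2.1 (clamp T hT z.1.1)) :=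
      stopP_joint.comp ((continuous_subtype_val.comp continuous_snd).prodMk
        ((continuous_clamp (hT := hT)).comp (continuous_fst.comp continuous_fst)))
    have e2 : Continuous (fun z : (ℝ × ℝ) × K => X z.1.2 z.2.1) :=
      (X_joint hX).comp ((continuous_snd.comp continuous_fst).prodMk
        (continuous_subtype_val.comp continuous_snd))
    have e3 : Continuous (fun z : (ℝ × ℝ) × K => X z.1.1 z.2.1) :=
      (X_joint hX).comp ((continuous_fst.comp continuous_fst).prodMk
        (continuous_subtype_val.comp continuous_snd))
    exact (h.continuous.comp e1).mul (e2.sub e3)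
  have hci := continuous_parametric_integral_of_continuous (μ := Q) hc isCompact_univ
  simp only [Measure.restrict_univ] at hci
  have hl : Tendsto (fun n : ℕ => (gr T n ⌊s * 2^n / T⌋₊, gr T n ⌊t * 2^n / T⌋₊)) atTop
      (𝓝 (s, t)) := (gr_floor_tendsto hT hs).prodMk_nhds (gr_floor_tendsto hT ht)
  have h1 := (hci.tendsto (s, t)).comp hl
  refine tendsto_nhds_unique h1 ?_
  refine tendsto_const_nhds.congr fun n => ?_
  simp only [Function.comp]
  refine (mart_grid hQ hX (Nat.floor_mono ?_) (gr_floor hT ht n).1 h).symm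
  gcongr

lemma mart_set (hQ : ∀ v ∈ VK T hT K, ∫ x, v x ∂Q = 0) {X : ℝ → PathPair T → ℝ}
    (hX : X = SbarProc T hT ∨ X = SSbarProc T hT) {s t : ℝ} (hs : s ∈ Set.Icc 0 T)
    (ht : t ∈ Set.Icc 0 T) (hst : s ≤ t) {B : Set (PathPair T)} (hB : MeasurableSet B) :
    ∫ x in (fun x : K => stopP T x.1 (clamp T hT s)) ⁻¹' B, (X t x.1 - X s x.1) ∂Q = 0 := by
  refine set_int_zero (E := PathPair T) ?_ (cont_integrable ((X_cont hX _).sub (X_cont hX _)))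
    (fun h => mart_real hQ hX hs ht hst h) hB
  exact ((stopP_cont _).comp continuous_subtype_val).measurable

lemma law_mart (hQ : ∀ v ∈ VK T hT K, ∫ x, v x ∂Q = 0) :
    IsLocalMart T (Q.map (fun x : K => x.1.1)) (Sproc T hT) := by
  have hπ : Continuous (fun x : K => x.1.1) := continuous_fst.comp continuous_subtype_val
  refine ⟨fun m _ => T + m, fun m t _ => ?_, ?_, fun m => ⟨fun t ht => ?_, ?_⟩⟩
  · exact @MeasurableSet.const _ (Fraw T t) _
  · refine Eventually.of_forall fun ω => ⟨?_, ?_⟩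
    · intro a b hab
      have : (a:ℝ) ≤ b := by exact_mod_cast hab
      simpa using this
    · exact tendsto_atTop_add_const_left _ _ tendsto_natCast_atTop_atTop
  · have h0 : min (T + (m:ℝ)) t = t := min_eq_right (by have := ht.2; linarith [m.cast_nonneg (α := ℝ)])
    simp only [h0]
    have hm : Measurable (Sproc T hT t) := (ev_cont' t).measurable
    rw [integrable_map_measure hm.aestronglyMeasurable hπ.measurable.aemeasurable]
    exact cont_integrable ((ev_cont' t).comp hπ)
  · intro s t hs ht hst A hA
    have h0 : ∀ t ∈ Set.Icc (0:ℝ) T, min (T + (m:ℝ)) t = t := fun t ht =>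
      min_eq_right (by have := ht.2; linarith [m.cast_nonneg (α := ℝ)])
    simp only [h0 t ht, h0 s hs]
    have hm : ∀ t, Measurable (Sproc T hT t) := fun t => (ev_cont' t).measurable
    have hs' : (clamp T hT s).1 = s := clamp_val hs
    have hA' : MeasurableSet A := Fraw_le s A hA
    rw [setIntegral_map hA' (hm t).aestronglyMeasurable hπ.measurable.aemeasurable,
      setIntegral_map hA' (hm s).aestronglyMeasurable hπ.measurable.aemeasurable]
    rw [← hs'] at hA
    obtain ⟨B, hB, rfl⟩ := Fraw_mem_stop hA
    have := mart_set hQ (X := SbarProc T hT) (Or.inl rfl) hs ht hst (B := B ×ˢ univ)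
      (hB.prod MeasurableSet.univ)
    have he : (fun x : K => stopP T x.1 (clamp T hT s)) ⁻¹' (B ×ˢ univ) =
        (fun x : K => x.1.1) ⁻¹' ((fun ω => stopPath T ω (clamp T hT s)) ⁻¹' B) := by
      ext x; simp [stopP]
    rw [he, integral_sub] at this
    · exact sub_eq_zero.1 this
    · exact (cont_integrable (X_cont (Or.inl rfl) _)).integrableOn
    · exact (cont_integrable (X_cont (Or.inl rfl) _)).integrableOn

end meas

end Part9

section Part10

variable {T : ℝ} {hT : 0 ≤ T}

section meas

variable {K : Set (PathPair T)} [CompactSpace K] {Q : Measure K} [IsProbabilityMeasure Q]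

lemma dist_eq_sq (a b c d φ : ℝ) (a0 : ℝ) :
    φ * (b - a) - ((b^2 - a0^2 - d)/2 - (a^2 - a0^2 - c)/2) =
      (φ - a) * (b - a) + (1/2) * ((d - c) - (b-a)^2) := by ring

lemma d_sq_le {ε φ a b c d w : ℝ} (h1 : |φ - a| ≤ ε) (h2 : 0 ≤ d - c) (h3 : d - c ≤ w)
    (h4 : (b-a)^2 ≤ w) :
    ((φ - a) * (b - a) + (1/2) * ((d - c) - (b-a)^2))^2 ≤
      (2 * ε^2) * (b-a)^2 + w * ((d - c) + (b-a)^2) := by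
  have e1 : (φ - a)^2 ≤ ε^2 := by
    rw [← sq_abs (φ - a)]; gcongr
  have e2 : ((φ - a) * (b - a))^2 ≤ ε^2 * (b-a)^2 := by
    rw [mul_pow]; gcongr
  set D := d - c
  set q := (b-a)^2
  have hq : 0 ≤ q := sq_nonneg _
  have e3 : (D - q)^2 ≤ 2 * (w * (D + q)) := by nlinarith
  nlinarith [sq_nonneg ((φ - a) * (b - a) - (1/2) * (D - q))]

lemma grid_bound (hQ : ∀ v ∈ VK T hT K, ∫ x, v x ∂Q = 0)
    (hV : ∀ p ∈ K, p.2 (t0 T hT) = 0 ∧ Monotone p.2) {M w : ℝ}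
    (hS : ∀ x : K, ‖x.1.1‖ ≤ M) (hVb : ∀ x : K, ‖x.1.2‖ ≤ M) (m j : ℕ)
    (hw : ∀ x : K, ∀ i < 2^j,
      ev T hT x.1.2 (gr T j (i+1)) - ev T hT x.1.2 (gr T j i) ≤ w ∧
      (ev T hT x.1.1 (gr T j (i+1)) - ev T hT x.1.1 (gr T j i))^2 ≤ w) {a : ℝ} (ha : 0 < a)
    (hw0 : 0 ≤ w) :
    a ^ 2 * Q.real {x : K | ∃ i ≤ 2^j, a ≤ |Idis T hT x.1.1 j (fun u => phi T hT m u x.1.1)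
      (gr T j i) - SSbarProc T hT (gr T j i) x.1|} ≤
      (2 * ((2:ℝ)^(-(m:ℤ)))^2 + 2 * w) * M := by
  set F : ℕ → MeasurableSpace K := fun i => MeasurableSpace.comap
    (fun x : K => stopP T x.1 (clamp T hT (gr T j i))) inferInstance with hF
  set φ : ℕ → K → ℝ := fun i x => phi T hT m (gr T j i) x.1.1 with hφ
  set S : ℕ → K → ℝ := fun i x => ev T hT x.1.1 (gr T j i) with hSd
  set V : ℕ → K → ℝ := fun i x => ev T hT x.1.2 (gr T j i) with hVd
  set Z : ℕ → K → ℝ := fun i x => SSbarProc T hT (gr T j i) x.1 with hZd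
  set d : ℕ → K → ℝ := fun i x => φ i x * (S (i+1) x - S i x) - (Z (i+1) x - Z i x) with hdd
  have hstopc : ∀ t, Continuous (fun x : K => stopP T x.1 t) := fun t =>
    (stopP_cont t).comp continuous_subtype_val
  have hFle : ∀ i, F i ≤ (Subtype.instMeasurableSpace : MeasurableSpace K) := fun i => (hstopc _).measurable.comap_le
  have hmeasF : ∀ (i : ℕ) (f : PathPair T → ℝ), Measurable f →
      (∀ p, f (stopP T p (clamp T hT (gr T j i))) = f p) → Measurable[F i] (fun x : K => f x.1) := by
    intro i f hf he
    have : (fun x : K => f x.1) = f ∘ (fun x : K => stopP T x.1 (clamp T hT (gr T j i))) := by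
      funext x; exact (he x.1).symm
    rw [this]
    exact hf.comp (comap_measurable _)
  have hFmono : Monotone F := by
    intro i k hik
    have h1 : min (clamp T hT (gr T j k)) (clamp T hT (gr T j i)) = clamp T hT (gr T j i) :=
      min_eq_right (clamp_mono (hT := hT) (gr_mono hT j hik))
    have h2 : (fun x : K => stopP T x.1 (clamp T hT (gr T j i))) =
        (fun p => stopP T p (clamp T hT (gr T j i))) ∘
        (fun x : K => stopP T x.1 (clamp T hT (gr T j k))) := by
      funext x; simp [stopP_stopP, h1]
    simp only [hF]
    rw [h2, ← MeasurableSpace.comap_comp]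
    exact MeasurableSpace.comap_mono (stopP_cont _).measurable.comap_le
  have hg : ∀ i ≤ 2^j, gr T j i ∈ Set.Icc 0 T := fun i hi => gr_mem hT hi
  have hcv : ∀ i ≤ 2^j, (clamp T hT (gr T j i)).1 = gr T j i := fun i hi => clamp_val (hg i hi)
  have hSF : ∀ i k, k ≤ i → i ≤ 2^j → Measurable[F i] (S k) := by
    intro i k hk hi
    refine hmeasF i (SbarProc T hT (gr T j k)) (Sbar_cont _).measurable fun p => ?_
    rw [Sbar_stop, hcv i hi, min_eq_right (gr_mono hT j hk)]
  have hZF : ∀ i k, k ≤ i → i ≤ 2^j → Measurable[F i] (Z k) := by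
    intro i k hk hi
    refine hmeasF i (SSbarProc T hT (gr T j k)) (SSbar_cont _).measurable fun p => ?_
    rw [SSbar_stop, hcv i hi, min_eq_right (gr_mono hT j hk)]
  have hφF : ∀ i k, k ≤ i → i ≤ 2^j → Measurable[F i] (φ k) := by
    intro i k hk hi
    refine hmeasF i (fun p => phi T hT m (gr T j k) p.1)
      ((phi_meas m (hg k (hk.trans hi)).2).comp measurable_fst) fun p => ?_
    simp only [stopP]
    rw [phi_stop]
    rw [hcv i hi]; exact gr_mono hT j hk
  have hSb : ∀ i x, |S i x| ≤ M := fun i x => (ev_abs_le _ _).trans (hS x)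
  have hVb' : ∀ i x, |V i x| ≤ M := fun i x => (ev_abs_le _ _).trans (hVb x)
  have hφb : ∀ i ≤ 2^j, ∀ x, |φ i x| ≤ M := fun i hi x => (phi_abs_le _ _ (hg i hi)).trans (hS x)
  have hSc : ∀ i, Continuous (S i) := fun i => (Sbar_cont (hT := hT) _).comp continuous_subtype_val
  have hVc : ∀ i, Continuous (V i) := fun i =>
    ((ev_cont' (hT := hT) _).comp continuous_snd).comp continuous_subtype_val
  have hZc : ∀ i, Continuous (Z i) := fun i => (SSbar_cont (hT := hT) _).comp continuous_subtype_val
  have hset : ∀ (X : ℝ → PathPair T → ℝ), (X = SbarProc T hT ∨ X = SSbarProc T hT) →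
      ∀ i < 2^j, ∀ A, MeasurableSet[F i] A →
      ∫ x in A, (X (gr T j (i+1)) x.1 - X (gr T j i) x.1) ∂Q = 0 := by
    rintro X hX i hi A ⟨B, hB, rfl⟩
    exact mart_set hQ hX (hg i hi.le) (hg (i+1) hi) (gr_mono hT j (Nat.le_succ i)) hB
  have hd : ∀ i x, d i x = (φ i x - S i x) * (S (i+1) x - S i x) +
      (1/2) * ((V (i+1) x - V i x) - (S (i+1) x - S i x)^2) := by
    intro i x
    simp only [hdd, hZd, SSbarProc]
    exact dist_eq_sq _ _ _ _ _ _
  have hVm : ∀ i < 2^j, ∀ x, 0 ≤ V (i+1) x - V i x := by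
    intro i hi x
    have := (hV x.1 x.2).2 (clamp_mono (hT := hT) (gr_mono hT j (Nat.le_succ i)))
    exact sub_nonneg.2 this
  have hΔS : ∀ i, Integrable (fun x => S (i+1) x - S i x) Q := fun i =>
    cont_integrable ((hSc _).sub (hSc _))
  have hΔZ : ∀ i, Integrable (fun x => Z (i+1) x - Z i x) Q := fun i =>
    cont_integrable ((hZc _).sub (hZc _))
  have hsq : ∀ i, Integrable (fun x => (S (i+1) x - S i x)^2) Q := fun i =>
    cont_integrable (((hSc _).sub (hSc _)).pow 2)
  have hΔV : ∀ i, Integrable (fun x => V (i+1) x - V i x) Q := fun i =>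
    cont_integrable ((hVc _).sub (hVc _))
  have hSS : ∀ i, Integrable (fun x => S i x * (S (i+1) x - S i x)) Q := fun i =>
    cont_integrable ((hSc _).mul ((hSc _).sub (hSc _)))
  have hVS : ∀ i, Integrable (fun x => (V (i+1) x - V i x) + (S (i+1) x - S i x)^2) Q := fun i =>
    (hΔV i).add (hsq i)
  have hEq : ∀ i < 2^j, ∫ x, (S (i+1) x - S i x)^2 ∂Q = ∫ x, (V (i+1) x - V i x) ∂Q := by
    intro i hi
    have h1 := (int_mul_zero (hFle i) (hΔS i) (hset _ (Or.inl rfl) i hi) (hSF i i le_rfl hi.le)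
      (hSb i)).2
    have h2 := hset _ (Or.inr rfl) i hi univ (@MeasurableSet.univ _ (F i))
    rw [Measure.restrict_univ] at h2
    have h3 : ∫ x, ((S (i+1) x - S i x)^2 - (V (i+1) x - V i x)) ∂Q = 0 := by
      have h4 : ∫ x, ((Z (i+1) x - Z i x) - S i x * (S (i+1) x - S i x)) ∂Q = 0 := by
        rw [integral_sub (hΔZ i) (hSS i), h1]
        simp only [hZd]
        rw [h2, sub_zero]
      have h5 : ∫ x, 2 * ((Z (i+1) x - Z i x) - S i x * (S (i+1) x - S i x)) ∂Q = 0 := by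
        rw [integral_const_mul, h4, mul_zero]
      refine Eq.trans (integral_congr_ae (Eventually.of_forall fun x => ?_)) h5
      simp only [hZd, SSbarProc, hSd, hVd]
      ring
    rw [integral_sub (hsq i) (hΔV i)] at h3
    exact sub_eq_zero.1 h3
  have hdm : ∀ i < 2^j, Measurable[F (i+1)] (d i) := by
    intro i hi
    exact msub (m := F (i+1)) (mmul (m := F (i+1)) (hφF _ _ (Nat.le_succ i) hi)
      (msub (m := F (i+1)) (hSF _ _ le_rfl hi) (hSF _ _ (Nat.le_succ i) hi)))
      (msub (m := F (i+1)) (hZF _ _ le_rfl hi) (hZF _ _ (Nat.le_succ i) hi))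
  have hsqb : ∀ i < 2^j, ∀ x, (d i x)^2 ≤
      (2 * ((2:ℝ)^(-(m:ℤ)))^2) * (S (i+1) x - S i x)^2 +
        w * ((V (i+1) x - V i x) + (S (i+1) x - S i x)^2) := by
    intro i hi x
    rw [hd]
    exact d_sq_le (phi_close m x.1.1 (hg i hi.le)) (hVm i hi x) (hw x i hi).1 (hw x i hi).2
  have hdb : ∀ i < 2^j, ∀ x, |d i x| ≤ M * (M + M) + ((M^2 + M^2 + M)/2 + (M^2 + M^2 + M)/2) := by
    intro i hi x
    have hZb : ∀ i, |Z i x| ≤ (M^2 + M^2 + M)/2 := by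
      intro i
      simp only [hZd, SSbarProc]
      rw [abs_div, abs_two]
      gcongr
      have e1 : |ev T hT x.1.1 (gr T j i)^2| ≤ M^2 := by
        rw [abs_pow]; gcongr; exact hSb i x
      have e2 : |ev T hT x.1.1 0^2| ≤ M^2 := by
        rw [abs_pow]; gcongr; exact (ev_abs_le _ _).trans (hS x)
      have e3 := hVb' i x
      calc _ ≤ |ev T hT x.1.1 (gr T j i)^2 - ev T hT x.1.1 0^2| + |ev T hT x.1.2 (gr T j i)| :=
            abs_sub _ _
        _ ≤ (|ev T hT x.1.1 (gr T j i)^2| + |ev T hT x.1.1 0^2|) + |ev T hT x.1.2 (gr T j i)| := by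
            gcongr; exact abs_sub _ _
        _ ≤ _ := by gcongr
    have hM : 0 ≤ M := (norm_nonneg _).trans (hS x)
    calc |d i x| ≤ |φ i x * (S (i+1) x - S i x)| + |Z (i+1) x - Z i x| := abs_sub _ _
      _ ≤ M * (M + M) + ((M^2 + M^2 + M)/2 + (M^2 + M^2 + M)/2) := by
        gcongr
        · rw [abs_mul]
          gcongr
          · exact hφb i hi.le x
          · exact (abs_sub _ _).trans (add_le_add (hSb _ _) (hSb _ _))
        · exact (abs_sub _ _).trans (add_le_add (hZb _) (hZb _))
  have hdz : ∀ i < 2^j, ∀ A, MeasurableSet[F i] A → ∫ x in A, d i x ∂Q = 0 := by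
    intro i hi A hA
    have h2 := hset _ (Or.inr rfl) i hi A hA
    have hA' : MeasurableSet A := hFle i A hA
    have hc : Measurable[F i] (A.indicator (φ i)) :=
      @Measurable.indicator K ℝ A (φ i) (F i) _ _ (hφF i i le_rfl hi.le) hA
    have h1 := int_mul_zero (hFle i) (hΔS i) (hset _ (Or.inl rfl) i hi) hc (C := M) (fun x => by
      by_cases hx : x ∈ A
      · simpa [hx] using hφb i hi.le x
      · simpa [hx] using (norm_nonneg _).trans (hS x))
    have hφi := int_mul_zero (hFle i) (hΔS i) (hset _ (Or.inl rfl) i hi) (hφF i i le_rfl hi.le)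
      (hφb i hi.le)
    simp only [hdd]
    rw [integral_sub hφi.1.integrableOn (hΔZ i).integrableOn]
    simp only [hZd]
    rw [h2, sub_zero, ← integral_indicator hA', ← h1.2]
    refine integral_congr_ae (Eventually.of_forall fun x => ?_)
    by_cases hx : x ∈ A <;> simp [hx]
  have key := doob_discrete (μ := Q) hFle hFmono hdb hdm hdz ha
  have hev : {x : K | ∃ i ≤ 2^j, a ≤ |Idis T hT x.1.1 j (fun u => phi T hT m u x.1.1)
      (gr T j i) - SSbarProc T hT (gr T j i) x.1|} =
      {x | ∃ i ≤ 2^j, a ≤ |∑ i' ∈ Finset.range i, d i' x|} := by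
    ext x
    have : ∀ i ≤ 2^j, ∑ i' ∈ Finset.range i, d i' x = Idis T hT x.1.1 j
        (fun u => phi T hT m u x.1.1) (gr T j i) - SSbarProc T hT (gr T j i) x.1 := by
      intro i hi
      simp only [hdd]
      rw [Finset.sum_sub_distrib, Finset.sum_range_sub (fun i => Z i x)]
      have hZ0 : Z 0 x = 0 := by
        simp only [hZd, SSbarProc, gr_zero]
        have h0 : ev T hT x.1.2 0 = 0 := by
          have := (hV x.1 x.2).1
          rw [ev_mem _ ⟨le_rfl, hT⟩]; exact this
        rw [h0]; ring
      rw [hZ0, sub_zero]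
      congr 1
      have h1 := Idis_partial (hT := hT) x.1.1 j (fun u => phi T hT m u x.1.1) T hi
      have h2 : (clamp T hT T).1 = T := clamp_val ⟨hT, le_rfl⟩
      rw [h2, min_eq_right (hg i hi).2] at h1
      rw [← h1]
      refine Finset.sum_congr rfl fun i' hi' => ?_
      have := Finset.mem_range.1 hi'
      rw [min_eq_right (hg (i'+1) (by omega)).2, min_eq_right (hg i' (by omega)).2]
      rfl
    constructor
    · rintro ⟨i, hi, h⟩
      exact ⟨i, hi, by rwa [this i hi]⟩
    · rintro ⟨i, hi, h⟩
      exact ⟨i, hi, by rwa [this i hi] at h⟩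
  rw [hev]
  refine key.trans ?_
  have hbi : ∀ i < 2^j, ∫ x, (d i x)^2 ∂Q ≤
      (2 * ((2:ℝ)^(-(m:ℤ)))^2 + 2 * w) * ∫ x, (V (i+1) x - V i x) ∂Q := by
    intro i hi
    calc _ ≤ ∫ x, ((2 * ((2:ℝ)^(-(m:ℤ)))^2) * (S (i+1) x - S i x)^2 +
        w * ((V (i+1) x - V i x) + (S (i+1) x - S i x)^2)) ∂Q := by
          refine integral_mono_of_nonneg (Eventually.of_forall fun x => sq_nonneg _) ?_
            (Eventually.of_forall fun x => hsqb i hi x)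
          exact ((hsq i).const_mul _).add ((hVS i).const_mul _)
      _ = _ := by
          rw [integral_add ((hsq i).const_mul _) ((hVS i).const_mul _),
            integral_const_mul, integral_const_mul, integral_add (hΔV i) (hsq i), hEq i hi]
          ring
  refine (Finset.sum_le_sum fun i hi => hbi i (Finset.mem_range.1 hi)).trans ?_
  rw [← Finset.mul_sum, ← integral_finsetSum _ (fun i _ => hΔV i)]
  have hc0 : 0 ≤ 2 * ((2:ℝ)^(-(m:ℤ)))^2 + 2 * w := by positivity
  refine mul_le_mul_of_nonneg_left ?_ hc0
  calc _ ≤ ∫ x : K, M ∂Q := by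
        refine integral_mono (integrable_finsetSum _ (fun i _ => hΔV i)) (integrable_const _) ?_
        intro x
        simp only
        rw [Finset.sum_range_sub (fun i => V i x)]
        have h0 : V 0 x = 0 := by
          have := (hV x.1 x.2).1
          simp only [hVd, gr_zero]
          rw [ev_mem _ ⟨le_rfl, hT⟩]; exact this
        rw [h0, sub_zero]
        exact (abs_le.1 (hVb' _ x)).2
    _ = M := by simp

end meas

end Part10

section Part11

variable {T : ℝ} {hT : 0 ≤ T}

lemma det_conv {p : PathPair T} (hV : p.2 (t0 T hT) = 0 ∧ Monotone p.2)
    (h : ∀ᶠ m : ℕ in atTop, ∀ t ∈ Set.Icc 0 T,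
      |Sm T hT m t p.1 - SSbarProc T hT t p| ≤ (3/4:ℝ)^m) :
    p.1 ∈ BigOmega T hT ∧ psiMap T hT p.1 = p := by
  have hr : Tendsto (fun m : ℕ => (3/4:ℝ)^m) atTop (𝓝 0) :=
    tendsto_pow_atTop_nhds_zero_of_lt_one (by norm_num) (by norm_num)
  have hSS : ∀ t ∈ Set.Icc 0 T, SS T hT t p.1 = SSbarProc T hT t p := by
    intro t ht
    unfold SS
    refine Tendsto.liminf_eq ?_
    rw [tendsto_iff_dist_tendsto_zero]
    refine squeeze_zero' (Eventually.of_forall fun _ => dist_nonneg) ?_ hr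
    filter_upwards [h] with m hm
    rw [Real.dist_eq]
    exact hm t ht
  have hq : ∀ t ∈ Set.Icc 0 T, qvRaw T hT p.1 t = ev T hT p.2 t := by
    intro t ht
    unfold qvRaw
    rw [hSS t ht]
    unfold SSbarProc
    ring
  have hΩ : p.1 ∈ BigOmega T hT := by
    refine ⟨?_, ?_⟩
    · rw [Metric.tendstoUniformly_iff]
      intro ε hε
      filter_upwards [h, hr.eventually (gt_mem_nhds hε)] with m hm hm2 t
      rw [hSS t t.2, dist_comm, Real.dist_eq]
      exact (hm t t.2).trans_lt hm2
    · intro s hs t ht hst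
      rw [hq s hs, hq t ht]
      exact hV.2 (clamp_mono (hT := hT) hst)
  refine ⟨hΩ, ?_⟩
  refine Prod.ext rfl ?_
  ext t
  change qv T hT p.1 t = p.2 t
  rw [qv_apply hΩ, hq t t.2, ev_mem _ t.2]

section meas

variable {K : Set (PathPair T)} [CompactSpace K] {Q : Measure K} [IsProbabilityMeasure Q]

lemma grid_w (hT : 0 ≤ T) (K : Set (PathPair T)) [CompactSpace K] {δ : ℝ} (hδ : 0 < δ) :
    ∃ j0, ∀ j ≥ j0, ∀ x : K, ∀ i < 2^j,
      ev T hT x.1.2 (gr T j (i+1)) - ev T hT x.1.2 (gr T j i) ≤ δ ∧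
      (ev T hT x.1.1 (gr T j (i+1)) - ev T hT x.1.1 (gr T j i))^2 ≤ δ := by
  have hc1 : Continuous (fun y : K × Set.Icc (0:ℝ) T => y.1.1.1 y.2) :=
    (continuous_eval (F := Path T)).comp
      ((continuous_fst.comp (continuous_subtype_val.comp continuous_fst)).prodMk continuous_snd)
  have hc2 : Continuous (fun y : K × Set.Icc (0:ℝ) T => y.1.1.2 y.2) :=
    (continuous_eval (F := Path T)).comp
      ((continuous_snd.comp (continuous_subtype_val.comp continuous_fst)).prodMk continuous_snd)
  have hu1 := Metric.uniformContinuous_iff.1 (CompactSpace.uniformContinuous_of_continuous hc1)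
  have hu2 := Metric.uniformContinuous_iff.1 (CompactSpace.uniformContinuous_of_continuous hc2)
  have hη : 0 < min δ 1 := lt_min hδ one_pos
  obtain ⟨d1, hd1, h1⟩ := hu1 _ hη
  obtain ⟨d2, hd2, h2⟩ := hu2 _ hη
  obtain ⟨j0, hj0⟩ := eventually_atTop.1 ((mesh_tendsto (T := T)).eventually
    (gt_mem_nhds (lt_min hd1 hd2)))
  refine ⟨j0, fun j hj x i hi => ?_⟩
  have hd : dist (x, clamp T hT (gr T j (i+1))) (x, clamp T hT (gr T j i)) < min d1 d2 := by
    rw [Prod.dist_eq, dist_self, Subtype.dist_eq, clamp_val (gr_mem hT hi),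
      clamp_val (gr_mem hT hi.le), gr_succ, Real.dist_eq, add_sub_cancel_left, max_lt_iff]
    refine ⟨lt_min hd1 hd2, ?_⟩
    rw [abs_of_nonneg (by positivity)]
    exact hj0 j hj
  have e1 := h1 (hd.trans_le (min_le_left _ _))
  have e2 := h2 (hd.trans_le (min_le_right _ _))
  rw [Real.dist_eq] at e1 e2
  constructor
  · exact ((le_abs_self _).trans e2.le).trans (min_le_left _ _)
  · change (x.1.1 (clamp T hT (gr T j (i+1))) - x.1.1 (clamp T hT (gr T j i)))^2 ≤ δ
    rw [← sq_abs]
    have a1 := e1.le.trans (min_le_left δ 1)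
    have a2 := e1.le.trans (min_le_right δ 1)
    nlinarith [abs_nonneg (x.1.1 (clamp T hT (gr T j (i+1))) - x.1.1 (clamp T hT (gr T j i)))]

lemma Em_bound (hQ : ∀ v ∈ VK T hT K, ∫ x, v x ∂Q = 0)
    (hV : ∀ p ∈ K, p.2 (t0 T hT) = 0 ∧ Monotone p.2) {M : ℝ} (hM : 0 ≤ M)
    (hS : ∀ x : K, ‖x.1.1‖ ≤ M) (hVb : ∀ x : K, ‖x.1.2‖ ≤ M) (m : ℕ) {a : ℝ} (ha : 0 < a) :
    Q {x : K | ∃ t ∈ Set.Icc 0 T, a < |Sm T hT m t x.1.1 - SSbarProc T hT t x.1|} ≤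
      ENNReal.ofReal (2 * ((2:ℝ)^(-(m:ℤ)))^2 * M / a^2) := by
  set E : ℕ → Set K := fun j => {x : K | ∃ i ≤ 2^j, a ≤ |Idis T hT x.1.1 j
    (fun u => phi T hT m u x.1.1) (gr T j i) - SSbarProc T hT (gr T j i) x.1|} with hE
  set G : ℕ → Set K := fun N => ⋂ j ≥ N, E j with hG
  have hsub : {x : K | ∃ t ∈ Set.Icc 0 T, a < |Sm T hT m t x.1.1 - SSbarProc T hT t x.1|} ⊆
      ⋃ N, G N := by
    rintro x ⟨t, ht, hx⟩
    set D : ℝ → ℝ := fun t => |Sm T hT m t x.1.1 - SSbarProc T hT t x.1| with hD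
    have hDc : ContinuousOn D (Set.Iic T) := by
      refine ((Sm_cont m x.1.1).sub ?_).abs
      exact (SSbar_joint.comp (continuous_id.prodMk continuous_const)).continuousOn
    set ε := (D t - a)/2 with hε
    have hε0 : 0 < ε := by
      have : a < D t := hx
      linarith
    obtain ⟨j0, hj0⟩ := Conv_phi m x.1.1 (hT := hT) ε hε0
    have hgr : Tendsto (fun n : ℕ => gr T n ⌊t * 2^n / T⌋₊) atTop (𝓝[Set.Iic T] t) := by
      refine tendsto_nhdsWithin_iff.2 ⟨gr_floor_tendsto hT ht, Eventually.of_forall fun n => ?_⟩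
      exact (gr_mem hT (gr_floor hT ht n).1).2
    have hev : ∀ᶠ n : ℕ in atTop, a + ε < D (gr T n ⌊t * 2^n / T⌋₊) :=
      ((hDc t ht.2).tendsto.comp hgr).eventually (lt_mem_nhds (by linarith))
    obtain ⟨n0, hn0⟩ := eventually_atTop.1 hev
    refine mem_iUnion.2 ⟨max j0 n0, mem_iInter₂.2 fun j hj => ?_⟩
    have g1 := (gr_floor hT ht j).1
    refine ⟨_, g1, ?_⟩
    have h1 := hj0 j ((le_max_left _ _).trans hj) _ (gr_mem hT g1)
    have h2 := hn0 j ((le_max_right _ _).trans hj)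
    simp only [hD] at h2
    set u := gr T j ⌊t * 2^j / T⌋₊
    have h3 := abs_sub_le (Sm T hT m u x.1.1) (Idis T hT x.1.1 j (fun u => phi T hT m u x.1.1) u)
      (SSbarProc T hT u x.1)
    rw [abs_sub_comm] at h1
    simp only at h1
    linarith
  have hGmono : Monotone G := by
    intro N N' h
    exact biInter_subset_biInter_left fun j (hj : N' ≤ j) => h.trans hj
  refine (measure_mono hsub).trans ?_
  rw [hGmono.measure_iUnion]
  refine iSup_le fun N => ?_
  rw [← ofReal_measureReal]
  refine ENNReal.ofReal_le_ofReal ?_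
  refine le_of_forall_pos_le_add fun ε hε => ?_
  set δ := ε * a^2 / (2 * (M + 1)) with hδ
  have hδ0 : 0 < δ := by positivity
  obtain ⟨j0, hj0⟩ := grid_w hT K hδ0
  have hb := grid_bound hQ hV hS hVb m (max N j0) (hj0 _ (le_max_right _ _)) ha hδ0.le
  have hle : Q.real (G N) ≤ Q.real (E (max N j0)) :=
    measureReal_mono (biInter_subset_of_mem (show max N j0 ≥ N from le_max_left _ _))
  refine hle.trans ?_
  rw [← sub_le_iff_le_add, le_div_iff₀ (by positivity)]
  have h2 : 2 * δ * M ≤ ε * a^2 := by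
    rw [hδ]
    have : 2 * (ε * a ^ 2 / (2 * (M + 1))) * M = ε * a^2 * (M / (M+1)) := by field_simp
    rw [this]
    have h3 : M / (M+1) ≤ 1 := (div_le_one (by linarith)).2 (by linarith)
    have h4 : 0 ≤ ε * a^2 := by positivity
    nlinarith
  have hb' : a^2 * Q.real (E (max N j0)) ≤ (2 * ((2:ℝ)^(-(m:ℤ)))^2 + 2 * δ) * M := hb
  nlinarith

lemma as_psi (hQ : ∀ v ∈ VK T hT K, ∫ x, v x ∂Q = 0)
    (hV : ∀ p ∈ K, p.2 (t0 T hT) = 0 ∧ Monotone p.2) :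
    ∀ᵐ x ∂Q, x.1.1 ∈ BigOmega T hT ∧ psiMap T hT x.1.1 = x.1 := by
  obtain ⟨M, hM⟩ := (isCompact_range (f := fun x : K => x.1)
    continuous_subtype_val).isBounded.exists_norm_le
  have hM1 : ∀ x : K, ‖x.1.1‖ ≤ max M 0 := fun x =>
    ((norm_fst_le x.1).trans (hM _ ⟨x, rfl⟩)).trans (le_max_left _ _)
  have hM2 : ∀ x : K, ‖x.1.2‖ ≤ max M 0 := fun x =>
    ((norm_snd_le x.1).trans (hM _ ⟨x, rfl⟩)).trans (le_max_left _ _)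
  set s : ℕ → Set K := fun m => {x : K | ∃ t ∈ Set.Icc 0 T,
    (3/4:ℝ)^m < |Sm T hT m t x.1.1 - SSbarProc T hT t x.1|} with hs
  have hb : ∀ m, Q (s m) ≤ ENNReal.ofReal (2 * max M 0 * (4/9:ℝ)^m) := by
    intro m
    refine (Em_bound hQ hV (le_max_right M 0) hM1 hM2 m (a := (3/4:ℝ)^m) (by positivity)).trans_eq ?_
    congr 1
    have h1 : ((2:ℝ)^(-(m:ℤ)))^2 = (1/4:ℝ)^m := by
      rw [zpow_neg, zpow_natCast, inv_pow, ← pow_mul, mul_comm, pow_mul, one_div, inv_pow]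
      norm_num
    have h2 : (1/4:ℝ)^m = (4/9:ℝ)^m * ((3/4:ℝ)^m)^2 := by
      rw [← pow_mul, mul_comm m 2, pow_mul, ← mul_pow]; norm_num
    rw [h1, h2]
    field_simp
  have hsum : ∑' m, Q (s m) ≠ ⊤ := by
    refine ne_top_of_le_ne_top ?_ (ENNReal.tsum_le_tsum hb)
    exact ((summable_geometric_of_lt_one (by norm_num) (by norm_num)).mul_left _).tsum_ofReal_ne_top
  filter_upwards [ae_eventually_notMem hsum] with x hx
  refine det_conv (hV x.1 x.2) ?_
  filter_upwards [hx] with m hm t ht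
  by_contra hcon
  exact hm ⟨t, ht, not_le.1 hcon⟩

end meas

end Part11

section Part12

variable {T : ℝ} {hT : 0 ≤ T}

open scoped BoundedContinuousFunction

lemma hedge_K {Ξ : Set (Path T)} {Xibar : Set (PathPair T)} (hA : AssumptionA T hT Ξ Xibar)
    {ξ : Path T → ℝ≥0∞} {η : PathPair T → ℝ} {C : ℝ} (hb : ∀ p, |η p| ≤ C)
    (hu : UpperSemicontinuous η) (h0 : ∀ p, 0 ≤ η p)
    (hη : ∀ ω, ENNReal.ofReal (η (psiMap T hT ω)) ≤ ξ ω)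
    {K : Set (PathPair T)} (hK : IsCompact K) (hKX : K ⊆ Xibar) {p0 : PathPair T}
    (hp0 : stopP T p0 (t0 T hT) ∈ K) {lam : ℝ}
    (hlam : supMart T hT Ξ ξ < ENNReal.ofReal lam) :
    ∃ j h g, ∀ p ∈ K, η p ≤ lam + vI T hT j h g p := by
  by_contra hcon
  have : CompactSpace K := isCompact_iff_compactSpace.1 hK
  have hnot : ∀ v ∈ VK T hT K, ¬ ∀ x : K, η x.1 ≤ lam + v x := by
    rintro v ⟨j, h, g, e⟩ hx
    exact hcon ⟨j, h, g, fun p hp => by have := hx ⟨p, hp⟩; rwa [e] at this⟩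
  obtain ⟨Q, hQp, hQ, hle⟩ := hb_measure (VK T hT K) (⟨_, hp0⟩ : K)
    (by rintro v ⟨j, h, g, e⟩; rw [e]; exact vI_stop0 j h g p0)
    (η := fun x : K => η x.1) (C := C) (fun x => hb x.1) (hu.comp continuous_subtype_val) lam hnot
  have hV : ∀ p ∈ K, p.2 (t0 T hT) = 0 ∧ Monotone p.2 := fun p hp => hA.A2 p (hKX hp)
  have hπ : Measurable (fun x : K => x.1.1) :=
    (continuous_fst.comp continuous_subtype_val).measurable
  have has := as_psi hQ hV
  set P : Measure (Path T) := Q.map (fun x : K => x.1.1) with hP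
  have hPp : IsProbabilityMeasure P := Measure.isProbabilityMeasure_map hπ.aemeasurable
  have hPΞ : P Ξ = 1 := by
    rw [hP, Measure.map_apply hπ (Xi_meas hA)]
    refine Eq.trans (measure_congr ?_) (measure_univ (μ := Q))
    refine eventuallyEq_univ.2 ?_
    filter_upwards [has] with x hx
    rw [mem_preimage, hA.xi_eq]
    refine ⟨hx.1, ?_⟩
    have h2 : psiMap T hT x.1.1 ∈ Xibar := by rw [hx.2]; exact hKX x.2
    exact h2
  have hPM : P ∈ MSet T hT Ξ := ⟨hPp, law_mart hQ, hPΞ⟩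
  have hηm : Measurable η := hu.measurable
  have h1 : ENNReal.ofReal lam ≤ supMart T hT Ξ ξ := by
    calc ENNReal.ofReal lam ≤ ENNReal.ofReal (∫ x : K, η x.1 ∂Q) := ENNReal.ofReal_le_ofReal hle
      _ = ∫⁻ x : K, ENNReal.ofReal (η x.1) ∂Q := by
          refine MeasureTheory.ofReal_integral_eq_lintegral_ofReal ?_
            (Eventually.of_forall fun x => h0 x.1)
          exact Integrable.of_bound (hηm.comp measurable_subtype_coe).aestronglyMeasurable C
            (Eventually.of_forall fun x => hb x.1)
      _ = ∫⁻ x : K, ENNReal.ofReal (η (psiMap T hT x.1.1)) ∂Q := by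
          refine lintegral_congr_ae ?_
          filter_upwards [has] with x hx
          rw [hx.2]
      _ = ∫⁻ ω, ENNReal.ofReal (η (psiMap T hT ω)) ∂P := by
          exact (lintegral_map (f := fun ω => ENNReal.ofReal (η (psiMap T hT ω)))
            (hηm.comp psi_meas).ennreal_ofReal hπ).symm
      _ ≤ ∫⁻ ω, ξ ω ∂P := lintegral_mono hη
      _ ≤ _ := le_iSup₂_of_le P hPM le_rfl
  exact absurd hlam (not_lt.2 h1)

lemma compact_exhaust {Ξ : Set (Path T)} {Xibar : Set (PathPair T)}
    (hA : AssumptionA T hT Ξ Xibar) :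
    ∃ (K : ℕ → Set (PathPair T)) (p0 : PathPair T), (∀ n, IsCompact (K n)) ∧ Monotone K ∧
      (∀ n, K n ⊆ Xibar) ∧ (∀ n, ∀ p ∈ K n, ∀ t, stopP T p t ∈ K n) ∧
      (∀ n, stopP T p0 (t0 T hT) ∈ K n) ∧ (∀ p ∈ Xibar, ∃ n, p ∈ K n) := by
  obtain ⟨K, hK, hX⟩ := hA.A1
  obtain ⟨p0, hp0⟩ := hA.xibar_nonempty
  set L : ℕ → Set (PathPair T) := fun n => (⋃ i ∈ Finset.range (n+1), K i) ∪ {p0} with hL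
  have hLm : Monotone L := by
    intro a b hab
    refine union_subset_union_left _ ?_
    refine iUnion₂_subset fun i hi => ?_
    have : i ∈ Finset.range (b+1) := by simp at hi ⊢; omega
    exact subset_iUnion₂_of_subset i this subset_rfl
  have hLc : ∀ n, IsCompact (L n) := fun n =>
    ((Finset.range (n+1)).isCompact_biUnion fun i _ => hK i).union isCompact_singleton
  have hLX : ∀ n, L n ⊆ Xibar := by
    intro n
    refine union_subset (iUnion₂_subset fun i _ => ?_) (by simpa using hp0)
    rw [hX]; exact subset_iUnion K i
  refine ⟨fun n => (fun x : PathPair T × Set.Icc (0:ℝ) T => stopP T x.1 x.2) ''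
    (L n ×ˢ univ), p0, fun n => ?_, ?_, ?_, ?_, ?_, ?_⟩
  · exact ((hLc n).prod isCompact_univ).image stopP_joint
  · intro a b hab
    exact image_mono (prod_mono (hLm hab) subset_rfl)
  · rintro n _ ⟨⟨p, t⟩, ⟨hp, -⟩, rfl⟩
    exact hA.A3 p (hLX n hp) t
  · rintro n _ ⟨⟨p, s⟩, ⟨hp, -⟩, rfl⟩ t
    exact ⟨(p, min s t), ⟨hp, mem_univ _⟩, (stopP_stopP p s t).symm⟩
  · intro n
    exact ⟨(p0, t0 T hT), ⟨Or.inr rfl, mem_univ _⟩, rfl⟩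
  · intro p hp
    rw [hX] at hp
    obtain ⟨n, hn⟩ := mem_iUnion.1 hp
    refine ⟨n, (p, ⟨T, hT, le_rfl⟩), ⟨Or.inl ?_, mem_univ _⟩, ?_⟩
    · exact mem_iUnion₂.2 ⟨n, by simp, hn⟩
    · change (stopPath T p.1 _, stopPath T p.2 _) = p
      rw [stop_T _ _ rfl, stop_T _ _ rfl]

end Part12

section Part13

variable {T : ℝ} {hT : 0 ≤ T}

open scoped BoundedContinuousFunction

lemma le_Fplus {t : ℝ} (ht : t ≤ T) : Fraw T t ≤ Fplus T t :=
  le_iInf₂ fun _ hs => Fraw_mono (le_min hs.le ht)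

lemma Fplus_mono : Monotone (Fplus T) := by
  intro a b hab
  exact le_iInf₂ fun s hs => iInf₂_le s (hab.trans_lt hs)

lemma stop_of_lt {τ : Path T → ℝ} (hτT : ∀ ω, τ ω ≤ T)
    (h : ∀ u ∈ Set.Icc 0 T, MeasurableSet[Fraw T u] {ω | τ ω < u}) : IsStopPlus T τ := by
  intro t ht
  rcases ht.2.eq_or_lt with h1 | h1
  · have : {ω | τ ω ≤ t} = univ := by
      ext ω; simp only [mem_ofPred_eq, mem_univ, iff_true]; rw [h1]; exact hτT ω
    rw [this]
    exact @MeasurableSet.univ _ (Fplus T t)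
  · refine MeasurableSpace.measurableSet_iInf.2 fun s => MeasurableSpace.measurableSet_iInf.2
      fun hs => ?_
    have hm : t < min s T := lt_min hs h1
    have : {ω | τ ω ≤ t} = ⋂ (q : ℚ) (_ : t < q ∧ (q:ℝ) < min s T), {ω | τ ω < q} := by
      ext ω
      simp only [mem_ofPred_eq, mem_iInter]
      constructor
      · intro h q hq
        exact h.trans_lt hq.1
      · intro h
        by_contra hc
        obtain ⟨q, hq1, hq2⟩ := exists_rat_btwn (lt_min (not_le.1 hc) hm)
        have := h q ⟨hq1, hq2.trans_le (min_le_right _ _)⟩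
        exact absurd (hq2.trans_le (min_le_left _ _)) (not_lt.2 this.le)
    rw [this]
    refine @MeasurableSet.iInter _ _ (Fraw T (min s T)) _ _ fun q =>
      @MeasurableSet.iInter _ _ (Fraw T (min s T)) _ _ fun hq => ?_
    exact Fraw_mono hq.2.le _ (h q ⟨ht.1.trans hq.1.le, hq.2.le.trans (min_le_right _ _)⟩)

lemma exists_strat (hT : 0 ≤ T) {τ : Path T → ℝ} (hτ0 : ∀ ω, 0 ≤ τ ω) (hτT : ∀ ω, τ ω ≤ T)
    (hτ : IsStopPlus T τ) (j : ℕ) (c : ℕ → Path T → ℝ) (hcb : ∀ i, ∃ C : ℝ, ∀ ω, |c i ω| ≤ C)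
    (hcm : ∀ i < 2^j, Measurable[Fraw T (gr T j i)] (c i)) :
    ∃ H : SimpleStrategy T, ∀ X t ω, integ T H X t ω = ∑ i ∈ Finset.range (2^j), c i ω *
      (X (min (gr T j (i+1)) (min (τ ω) t)) ω - X (min (gr T j i) (min (τ ω) t)) ω) := by
  refine ⟨{
    L := 2^j
    τ := fun l ω => min (gr T j l.1) (τ ω)
    coeff := fun l ω => (if gr T j l.1 < τ ω then 1 else 0) * c l.1 ω
    τ_nonneg := fun ω => le_min (by simp [gr_zero]) (hτ0 ω)
    τ_mono := fun l ω => min_le_min_right _ (gr_mono hT j (by simp))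
    τ_le := fun ω => (min_le_right _ _).trans (hτT ω)
    τ_stop := ?_
    coeff_bdd := ?_
    coeff_meas := ?_ }, ?_⟩
  · intro l t ht
    have : {ω | min (gr T j l.1) (τ ω) ≤ t} = {ω | gr T j l.1 ≤ t} ∪ {ω | τ ω ≤ t} := by
      ext ω; simp
    rw [this]
    exact @MeasurableSet.union _ (Fplus T t) _ _ (@MeasurableSet.const _ (Fplus T t) _) (hτ t ht)
  · intro l
    obtain ⟨C, hC⟩ := hcb l.1
    refine ⟨C, fun ω => ?_⟩
    split_ifs
    · simpa using hC ω
    · simpa using (abs_nonneg _).trans (hC ω)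
  · intro l B hB t ht
    have hl : l.1 < 2^j := l.2
    simp only [Fin.val_castSucc]
    rcases le_or_gt (gr T j l.1) t with h1 | h1
    · have e : {ω | min (gr T j l.1) (τ ω) ≤ t} = univ := by
        ext ω; simp [h1]
      rw [e, inter_univ]
      have hgm := gr_mem hT hl.le
      have m1 : MeasurableSet[Fplus T t] {ω | gr T j l.1 < τ ω} := by
        have := Fplus_mono h1 _ (hτ _ hgm)
        have e2 : {ω | gr T j l.1 < τ ω} = {ω | τ ω ≤ gr T j l.1}ᶜ := by ext ω; simp
        rw [e2]
        exact @MeasurableSet.compl _ _ (Fplus T t) this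
      have m2 : Measurable[Fplus T t] (c l.1) :=
        (hcm _ hl).mono ((le_Fplus hgm.2).trans (Fplus_mono h1)) le_rfl
      exact mmul (m := Fplus T t) (mind (m := Fplus T t) m1) m2 hB
    · have e : (fun ω => (if gr T j l.1 < τ ω then 1 else 0) * c l.1 ω) ⁻¹' B ∩
          {ω | min (gr T j l.1) (τ ω) ≤ t} = {ω | τ ω ≤ t} ∩ {ω | (0:ℝ) ∈ B} := by
        ext ω
        simp only [mem_inter_iff, mem_preimage, mem_ofPred_eq, min_le_iff, not_le.2 h1, false_or]
        rw [and_comm]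
        refine and_congr_right fun h2 => ?_
        rw [if_neg (not_lt.2 (h2.trans h1.le)), zero_mul]
      rw [e]
      exact @MeasurableSet.inter _ (Fplus T t) _ _ (hτ t ht) (@MeasurableSet.const _ (Fplus T t) _)
  · intro X t ω
    unfold integ
    simp only [Fin.val_castSucc, Fin.val_succ]
    rw [Finset.sum_range (fun i => c i ω * (X (min (gr T j (i+1)) (min (τ ω) t)) ω -
      X (min (gr T j i) (min (τ ω) t)) ω))]
    refine Finset.sum_congr rfl fun l _ => ?_
    rw [min_assoc, min_assoc]
    split_ifs with h1
    · rw [one_mul]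
    · have h2 : τ ω ≤ gr T j l.1 := not_lt.1 h1
      have h3 : τ ω ≤ gr T j (l.1+1) := h2.trans (gr_mono hT j (Nat.le_succ _))
      rw [min_eq_right ((min_le_left _ _).trans h2), min_eq_right ((min_le_left _ _).trans h3)]
      ring

/-- the value process of the unstopped strategy -/
def Wp (T : ℝ) (hT : 0 ≤ T) (lam : ℝ) (j : ℕ) (h g : ℕ → (PathPair T →ᵇ ℝ)) (t : ℝ)
    (ω : Path T) : ℝ :=
  lam + ∑ i ∈ Finset.range (2^j),
    (h i (psiMap T hT (stopPath T ω (clamp T hT (gr T j i)))) *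
        (Sproc T hT (min (gr T j (i+1)) t) ω - Sproc T hT (min (gr T j i) t) ω) +
      g i (psiMap T hT (stopPath T ω (clamp T hT (gr T j i)))) *
        (SS T hT (min (gr T j (i+1)) t) ω - SS T hT (min (gr T j i) t) ω))

lemma Wp_psi (lam : ℝ) (j : ℕ) (h g : ℕ → (PathPair T →ᵇ ℝ)) {ω : Path T}
    (hω : ω ∈ BigOmega T hT) (t : Set.Icc (0:ℝ) T) :
    Wp T hT lam j h g t.1 ω = lam + vI T hT j h g (stopP T (psiMap T hT ω) t) := by
  rw [vI_stop]
  unfold Wp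
  congr 1
  refine Finset.sum_congr rfl fun i hi => ?_
  have hi := Finset.mem_range.1 hi
  have m1 : min (gr T j (i+1)) t.1 ∈ Set.Icc 0 T :=
    ⟨le_min (gr_mem hT hi).1 t.2.1, (min_le_right _ _).trans t.2.2⟩
  have m2 : min (gr T j i) t.1 ∈ Set.Icc 0 T :=
    ⟨le_min (gr_mem hT hi.le).1 t.2.1, (min_le_right _ _).trans t.2.2⟩
  rw [psi_stop hω, SSbar_psi hω m1, SSbar_psi hω m2]
  rfl

lemma Wp_meas (lam : ℝ) (j : ℕ) (h g : ℕ → (PathPair T →ᵇ ℝ)) {t : ℝ} (ht : t ∈ Set.Icc 0 T) :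
    Measurable[Fraw T t] (Wp T hT lam j h g t) := by
  have hb : Measurable (Wp T hT lam j h g t) := by
    unfold Wp
    refine measurable_const.add (Finset.measurable_fun_sum _ fun i hi => ?_)
    have hps : Measurable fun ω => psiMap T hT (stopPath T ω (clamp T hT (gr T j i))) :=
      psi_meas.comp (stop_cont _).measurable
    have hS : ∀ u, Measurable (Sproc T hT u) := fun u => meas_ev measurable_id measurable_const
    have hSS : ∀ u, Measurable (SS T hT (min u t)) := fun u =>
      SS_meas measurable_id measurable_const fun _ => (min_le_right _ _).trans ht.2
    exact (((h i).continuous.measurable.comp hps).mul ((hS _).sub (hS _))).add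
      (((g i).continuous.measurable.comp hps).mul ((hSS _).sub (hSS _)))
  refine Fraw_of_stop hT hb ⟨t, ht⟩ fun ω => ?_
  unfold Wp
  congr 1
  refine Finset.sum_congr rfl fun i hi => ?_
  have hi := Finset.mem_range.1 hi
  have hmin : ∀ u, min t (min u t) = min u t := fun u => min_eq_right (min_le_right _ _)
  simp only [Sproc, ev_stop, SS_stop, hmin]
  rcases le_or_gt (gr T j i) t with h1 | h1
  · rw [stop_stop, min_eq_right]
    rw [← Subtype.coe_le_coe, clamp_val (gr_mem hT hi.le)]
    exact h1
  · have h2 : t < gr T j (i+1) := h1.trans_le (gr_mono hT j (Nat.le_succ _))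
    rw [min_eq_right h1.le, min_eq_right h2.le]
    simp

lemma hedge_strat (lam : ℝ) (hl : 0 ≤ lam) (j : ℕ) (h g : ℕ → (PathPair T →ᵇ ℝ)) :
    ∃ HG : SimpleStrategy T × SimpleStrategy T,
      (∀ ω ∈ BigOmega T hT, ∀ t ∈ Set.Icc 0 T, 0 ≤ lam + genInteg T hT HG t ω) ∧
      ∀ ω ∈ BigOmega T hT,
        (∀ t : Set.Icc (0:ℝ) T, 0 ≤ lam + vI T hT j h g (stopP T (psiMap T hT ω) t)) →
        genInteg T hT HG T ω = vI T hT j h g (psiMap T hT ω) := by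
  set W := Wp T hT lam j h g with hW
  set A : Path T → Set ℝ := fun ω => {u | ∃ q : ℚ, (q:ℝ) = u ∧ (q:ℝ) ∈ Set.Icc 0 T ∧ W q ω < 0} ∪ {T}
    with hAd
  set τ : Path T → ℝ := fun ω => sInf (A ω) with hτd
  have hne : ∀ ω, (A ω).Nonempty := fun ω => ⟨T, Or.inr rfl⟩
  have hA0 : ∀ ω, ∀ u ∈ A ω, 0 ≤ u := by
    rintro ω u (⟨q, rfl, hq, -⟩ | rfl)
    · exact hq.1
    · exact hT
  have hbd : ∀ ω, BddBelow (A ω) := fun ω => ⟨0, fun u hu => hA0 ω u hu⟩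
  have hτ0 : ∀ ω, 0 ≤ τ ω := fun ω => le_csInf (hne ω) (hA0 ω)
  have hτT : ∀ ω, τ ω ≤ T := fun ω => csInf_le (hbd ω) (Or.inr rfl)
  have hτs : IsStopPlus T τ := by
    refine stop_of_lt hτT fun u hu => ?_
    have e : {ω | τ ω < u} = ⋃ (q : ℚ) (_ : (q:ℝ) ∈ Set.Icc 0 T ∧ (q:ℝ) < u), {ω | W q ω < 0} := by
      ext ω
      simp only [mem_ofPred_eq, mem_iUnion, exists_prop]
      constructor
      · intro h1
        obtain ⟨v, hv, hvu⟩ := exists_lt_of_csInf_lt (hne ω) h1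
        rcases hv with ⟨q, rfl, hq, hq2⟩ | rfl
        · exact ⟨q, ⟨hq, hvu⟩, hq2⟩
        · exact absurd hvu (not_lt.2 hu.2)
      · rintro ⟨q, ⟨hq, hqu⟩, hq2⟩
        exact (csInf_le (hbd ω) (Or.inl ⟨q, rfl, hq, hq2⟩)).trans_lt hqu
    rw [e]
    refine @MeasurableSet.iUnion _ _ (Fraw T u) _ _ fun q => @MeasurableSet.iUnion _ _ (Fraw T u)
      _ _ fun hq => ?_
    have := Wp_meas (hT := hT) lam j h g hq.1
    exact Fraw_mono hq.2.le _ (this measurableSet_Iio)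
  have hcm : ∀ (f : ℕ → (PathPair T →ᵇ ℝ)), ∀ i < 2^j, Measurable[Fraw T (gr T j i)]
      (fun ω => f i (psiMap T hT (stopPath T ω (clamp T hT (gr T j i))))) := by
    intro f i hi
    have := Fraw_stop hT (clamp T hT (gr T j i))
    rw [clamp_val (gr_mem hT hi.le)] at this
    exact ((f i).continuous.measurable.comp psi_meas).comp this
  have hcb : ∀ (f : ℕ → (PathPair T →ᵇ ℝ)), ∀ i, ∃ C : ℝ, ∀ ω : Path T,
      |f i (psiMap T hT (stopPath T ω (clamp T hT (gr T j i))))| ≤ C :=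
    fun f i => ⟨‖f i‖, fun ω => (f i).norm_coe_le_norm _⟩
  obtain ⟨H, hH⟩ := exists_strat hT hτ0 hτT hτs j _ (hcb h) (hcm h)
  obtain ⟨G, hG⟩ := exists_strat hT hτ0 hτT hτs j _ (hcb g) (hcm g)
  have key : ∀ t ω, lam + genInteg T hT (H, G) t ω = W (min (τ ω) t) ω := by
    intro t ω
    unfold genInteg
    simp only [hH, hG]
    rw [← Finset.sum_add_distrib]
    rfl
  refine ⟨(H, G), fun ω hω t ht => ?_, fun ω hω hpos => ?_⟩
  · rw [key]
    have hs : min (τ ω) t ∈ Set.Icc 0 T := ⟨le_min (hτ0 ω) ht.1, (min_le_right _ _).trans ht.2⟩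
    have hsτ : min (τ ω) t ≤ τ ω := min_le_left _ _
    set s := min (τ ω) t
    by_contra hneg
    have hneg := not_le.1 hneg
    have hWc : Continuous (fun u : ℝ => W (clamp T hT u).1 ω) := by
      have e : (fun u : ℝ => W (clamp T hT u).1 ω) = fun u : ℝ =>
          lam + vI T hT j h g (stopP T (psiMap T hT ω) (clamp T hT u)) := by
        funext u; exact Wp_psi lam j h g hω _
      rw [e]
      exact continuous_const.add ((vI_cont j h g).comp (stopP_joint.comp
        (continuous_const.prodMk (continuous_clamp (hT := hT)))))
    have hWs : ∀ u ∈ Set.Icc 0 T, W (clamp T hT u).1 ω = W u ω := fun u hu => by rw [clamp_val hu]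
    rcases hs.1.eq_or_lt with h0 | h0
    · have e := Wp_psi lam j h g hω (t0 T hT)
      rw [vI_stop0, add_zero] at e
      have e' : W s ω = lam := by rw [← h0]; exact e
      linarith
    · have hn : ∀ᶠ u in 𝓝 s, W (clamp T hT u).1 ω < 0 :=
        hWc.continuousAt.eventually (gt_mem_nhds (show W (clamp T hT s).1 ω < 0 by rw [hWs s hs]; exact hneg))
      obtain ⟨l, b, hb1, hb2⟩ := (mem_nhds_iff_exists_Ioo_subset.1 hn)
      obtain ⟨q, hq1, hq2⟩ := exists_rat_btwn (max_lt hb1.1 h0)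
      have hqm : (q:ℝ) ∈ Set.Icc 0 T := ⟨(le_max_right _ _).trans hq1.le, hq2.le.trans hs.2⟩
      have hWq : W (clamp T hT q).1 ω < 0 :=
        hb2 ⟨(le_max_left _ _).trans_lt hq1, hq2.trans hb1.2⟩
      rw [hWs q hqm] at hWq
      have : τ ω ≤ q := csInf_le (hbd ω) (Or.inl ⟨q, rfl, hqm, hWq⟩)
      linarith
  · have hτe : τ ω = T := by
      have : A ω = {T} := by
        simp only [hAd]
        refine union_eq_self_of_subset_left ?_
        rintro u ⟨q, -, hq, hq2⟩
        have := hpos ⟨q, hq⟩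
        rw [← Wp_psi lam j h g hω ⟨q, hq⟩] at this
        exact absurd hq2 (not_lt.2 this)
      simp only [hτd, this, csInf_singleton]
    have e := key T ω
    rw [hτe, min_self] at e
    have e2 := Wp_psi lam j h g hω ⟨T, hT, le_rfl⟩
    have e3 : stopP T (psiMap T hT ω) ⟨T, hT, le_rfl⟩ = psiMap T hT ω := by
      change (stopPath T _ _, stopPath T _ _) = _
      rw [stop_T _ _ rfl, stop_T _ _ rfl]
    rw [e3] at e2
    have e4 : lam + genInteg T hT (H, G) T ω = lam + vI T hT j h g (psiMap T hT ω) := e.trans e2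
    linarith

end Part13

/-- **Theorem 2.4 (superhedging duality with generalized simple strategies).** -/
theorem superhedging_duality_generalized (T : ℝ) (hT : 0 ≤ T)
    (Ξ : Set (Path T)) (Xibar : Set (PathPair T)) (hA : AssumptionA T hT Ξ Xibar)
    (ξ : Path T → ℝ≥0∞) (ξbar : ℕ → PathPair T → ℝ)
    (hbdd : ∀ n, ∃ C : ℝ, ∀ p, |ξbar n p| ≤ C)
    (husc : ∀ n, UpperSemicontinuous (ξbar n))
    (hnonneg : ∀ n p, 0 ≤ ξbar n p)
    (hrep : ∀ ω : Path T, ξ ω =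
      Filter.liminf (fun n => ENNReal.ofReal (ξbar n (ω, qv T hT ω))) Filter.atTop) :
    PhiGen T hT Ξ (fun ω => (ξ ω : EReal)) = (supMart T hT Ξ ξ : EReal) := by
  refine le_antisymm ?_ ?_
  swap
  · refine le_sInf ?_
    rintro _ ⟨lam, hlam, rfl⟩
    exact weak_duality hA ξ hlam
  refine le_of_forall_gt_imp_ge_of_dense fun c hc => ?_
  obtain ⟨lam, hl1, hl2⟩ := EReal.lt_iff_exists_real_btwn.1 hc
  refine le_trans (sInf_le ⟨lam, ?_, rfl⟩) hl2.le
  have hl0 : 0 ≤ lam := by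
    have : (0:EReal) < lam := (EReal.coe_ennreal_nonneg _).trans_lt hl1
    exact (EReal.coe_pos.1 this).le
  have hsup : supMart T hT Ξ ξ < ENNReal.ofReal lam := by
    rw [← EReal.coe_ennreal_lt_coe_ennreal_iff, EReal.coe_ennreal_ofReal, max_eq_left hl0]
    exact hl1
  set η : ℕ → PathPair T → ℝ := fun n p => ⨅ k, ξbar (n + k) p with hη
  have hbb : ∀ n p, BddBelow (Set.range fun k => ξbar (n + k) p) := fun n p =>
    ⟨0, by rintro _ ⟨k, rfl⟩; exact hnonneg _ _⟩
  have hη0 : ∀ n p, 0 ≤ η n p := fun n p => le_ciInf fun k => hnonneg _ _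
  have hηle : ∀ n k p, n ≤ k → η n p ≤ ξbar k p := by
    intro n k p hnk
    have := ciInf_le (hbb n p) (k - n)
    rwa [Nat.add_sub_cancel' hnk] at this
  have hηu : ∀ n, UpperSemicontinuous (η n) := fun n =>
    upperSemicontinuous_ciInf (hbb n) fun k => husc _
  have hηξ : ∀ n ω, ENNReal.ofReal (η n (psiMap T hT ω)) ≤ ξ ω := by
    intro n ω
    rw [hrep ω]
    refine Filter.le_liminf_of_le (by isBoundedDefault) ?_
    filter_upwards [eventually_ge_atTop n] with k hk
    exact ENNReal.ofReal_le_ofReal (hηle n k _ hk)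
  obtain ⟨K, p0, hKc, hKm, hKX, hKs, hK0, hKU⟩ := compact_exhaust hA
  have hex : ∀ n, ∃ HG : SimpleStrategy T × SimpleStrategy T,
      (∀ ω ∈ BigOmega T hT, ∀ t ∈ Set.Icc 0 T, 0 ≤ lam + genInteg T hT HG t ω) ∧
      ∀ ω ∈ BigOmega T hT, psiMap T hT ω ∈ K n →
        η n (psiMap T hT ω) ≤ lam + genInteg T hT HG T ω := by
    intro n
    obtain ⟨C, hC⟩ := hbdd n
    have hb : ∀ p, |η n p| ≤ C := fun p => by
      rw [abs_of_nonneg (hη0 n p)]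
      exact ((hηle n n p le_rfl).trans (le_abs_self _)).trans (hC p)
    obtain ⟨j, h, g, hh⟩ := hedge_K hA hb (hηu n) (hη0 n) (hηξ n) (hKc n) (hKX n) (hK0 n) hsup
    obtain ⟨HG, h1, h2⟩ := hedge_strat (hT := hT) lam hl0 j h g
    refine ⟨HG, h1, fun ω hω hk => ?_⟩
    rw [h2 ω hω fun t => (hη0 n _).trans (hh _ (hKs n _ hk t))]
    exact hh _ hk
  choose HG hadm hhedge using hex
  have hΞ : ∀ ω ∈ Ξ, ω ∈ BigOmega T hT ∧ psiMap T hT ω ∈ Xibar := by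
    intro ω hω
    rw [hA.xi_eq] at hω
    exact hω
  refine ⟨HG, fun n t ht ω hω => hadm n ω (hΞ ω hω).1 t ht, fun ω hω => ?_⟩
  obtain ⟨hΩ, hX⟩ := hΞ ω hω
  obtain ⟨n0, hn0⟩ := hKU _ hX
  refine le_of_forall_lt_imp_le_of_dense fun c hc => ?_
  obtain ⟨b, hb1, hb2⟩ := EReal.lt_iff_exists_real_btwn.1 hc
  refine hb1.le.trans ?_
  have hev : ∀ᶠ k in atTop, b ≤ ξbar k (psiMap T hT ω) := by
    rcases lt_or_ge b 0 with hb | hb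
    · exact Eventually.of_forall fun k => hb.le.trans (hnonneg _ _)
    · have h1 : ENNReal.ofReal b < ξ ω := by
        rw [← EReal.coe_ennreal_lt_coe_ennreal_iff, EReal.coe_ennreal_ofReal, max_eq_left hb]
        exact hb2
      rw [hrep ω] at h1
      filter_upwards [Filter.eventually_lt_of_lt_liminf h1] with k hk
      by_contra hcon
      exact absurd hk (not_lt.2 (ENNReal.ofReal_le_ofReal (not_le.1 hcon).le))
  obtain ⟨k0, hk0⟩ := eventually_atTop.1 hev
  have hlim : ((b - lam : ℝ) : EReal) ≤
      Filter.liminf (fun n => ((genInteg T hT (HG n) T ω : ℝ) : EReal)) Filter.atTop := by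
    refine Filter.le_liminf_of_le (by isBoundedDefault) ?_
    filter_upwards [eventually_ge_atTop n0, eventually_ge_atTop k0] with n hn1 hn2
    have h1 := hhedge n ω hΩ (hKm hn1 hn0)
    have h2 : b ≤ η n (psiMap T hT ω) := le_ciInf fun k => hk0 _ (hn2.trans (Nat.le_add_right _ _))
    exact EReal.coe_le_coe_iff.2 (by linarith)
  calc (b : EReal) = (lam : EReal) + ((b - lam : ℝ) : EReal) := by
        rw [← EReal.coe_add]; congr 1; ring
    _ ≤ _ := by gcongr

end PathwiseSuperhedging
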